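/- Let G be a finite simple vdec graph on n vertices with maximum degree Δ(G) ≥ √(2n) + 4 and minimum degree δ(G) ≥ 5. Then χ'_vd(G) ≤ k(G) + 1. -/

import Mathlib

/-- `φ` is a proper edge-`k`-coloring of `G`: every edge gets a color in `{1,…,k}` and
adjacent (distinct, sharing a vertex) edges get different colors. -/
def IsEdgeKColoring {V : Type*} (G : SimpleGraph V) (k : ℕ) (φ : Sym2 V → ℕ) : Prop :=
  (∀ e ∈ G.edgeSet, φ e ∈ Finset.Icc 1 k) ∧
  ∀ e₁ ∈ G.edgeSet, ∀ e₂ ∈ G.edgeSet, e₁ ≠ e₂ → (∃ v : V, v ∈ e₁ ∧ v ∈ e₂) → φ e₁ ≠ φ e₂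

/-- The color-set of a vertex `v`: the set of colors appearing on edges incident with `v`. -/
def colorSet {V : Type*} (G : SimpleGraph V) (φ : Sym2 V → ℕ) (v : V) : Set ℕ :=
  {c | ∃ e ∈ G.edgeSet, v ∈ e ∧ φ e = c}

/-- A vertex-distinguishing edge-`k`-coloring. -/
def IsVDEC {V : Type*} (G : SimpleGraph V) (k : ℕ) (φ : Sym2 V → ℕ) : Prop :=
  IsEdgeKColoring G k φ ∧ ∀ u v : V, u ≠ v → colorSet G φ u ≠ colorSet G φ v

/-- The vertex-distinguishing chromatic index: the least `k` admitting a `k`-vdec. -/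
noncomputable def vdIndex {V : Type*} (G : SimpleGraph V) : ℕ :=
  sInf {k | ∃ φ : Sym2 V → ℕ, IsVDEC G k φ}

/-- `k(G)`: the least `k` such that `C(k,d) ≥ n_d` for every `d ∈ [δ(G), Δ(G)]`,
where `n_d` is the number of vertices of degree `d`. -/
noncomputable def paramK {V : Type*} [Fintype V] (G : SimpleGraph V) [DecidableRel G.Adj] : ℕ :=
  sInf {k | ∀ d : ℕ, G.minDegree ≤ d → d ≤ G.maxDegree →
    (Finset.univ.filter (fun v => G.degree v = d)).card ≤ k.choose d}

/-- A graph is vdec if it has at most one isolated vertex and no isolated edge. -/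
def IsVdecGraph {V : Type*} [Fintype V] (G : SimpleGraph V) [DecidableRel G.Adj] : Prop :=
  {v : V | G.degree v = 0}.Subsingleton ∧
  ¬ ∃ u v : V, G.Adj u v ∧ G.degree u = 1 ∧ G.degree v = 1

namespace VertexDistinguishing

variable {V : Type*}

/-- `X` is closed under passing along edges colored `a` or `b`. -/
def KempeClosed (G : SimpleGraph V) (φ : Sym2 V → ℕ) (a b : ℕ) (X : Set V) : Prop :=
  ∀ ⦃x y⦄, x ∈ X → G.Adj x y → (φ s(x, y) = a ∨ φ s(x, y) = b) → y ∈ X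

/-- The edges colored `a` or `b`. -/
def twoColored (G : SimpleGraph V) (φ : Sym2 V → ℕ) (a b : ℕ) : SimpleGraph V where
  Adj x y := G.Adj x y ∧ (φ s(x, y) = a ∨ φ s(x, y) = b)
  symm := ⟨fun x y h => ⟨h.1.symm, by rw [Sym2.eq_swap]; exact h.2⟩⟩
  loopless := ⟨fun x h => G.loopless.irrefl x h.1⟩

theorem twoColored_adj {G : SimpleGraph V} {φ : Sym2 V → ℕ} {a b : ℕ} {x y : V} :
    (twoColored G φ a b).Adj x y ↔ G.Adj x y ∧ (φ s(x, y) = a ∨ φ s(x, y) = b) := Iff.rfl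

theorem kempeClosed_reachable (G : SimpleGraph V) (φ : Sym2 V → ℕ) (a b : ℕ)
    (M : SimpleGraph V) (x : V) :
    KempeClosed G φ a b {y | (twoColored G φ a b ⊔ M).Reachable x y} := by
  intro y z hy hyz hc
  have : (twoColored G φ a b ⊔ M).Adj y z := Or.inl ⟨hyz, hc⟩
  exact hy.trans this.reachable

/-- `φ` is a proper edge coloring of `G` with colors in `C`. -/
structure ProperOn (G : SimpleGraph V) (C : Finset ℕ) (φ : Sym2 V → ℕ) : Prop where
  mem : ∀ ⦃v w⦄, G.Adj v w → φ s(v, w) ∈ C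
  inj : ∀ ⦃v w w'⦄, G.Adj v w → G.Adj v w' → φ s(v, w) = φ s(v, w') → w = w'

/-- The image of a color set under the transposition of `a` and `b`. -/
def swapColors (a b : ℕ) (P : Finset ℕ) : Finset ℕ := P.map (Equiv.swap a b).toEmbedding

@[simp] theorem mem_swapColors {a b c : ℕ} {P : Finset ℕ} :
    c ∈ swapColors a b P ↔ Equiv.swap a b c ∈ P := by
  simp [swapColors, Finset.mem_map_equiv]

@[simp] theorem swapColors_swapColors (a b : ℕ) (P : Finset ℕ) :
    swapColors a b (swapColors a b P) = P := by
  ext c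
  simp

theorem swapColors_injective (a b : ℕ) : Function.Injective (swapColors a b) :=
  Function.LeftInverse.injective (swapColors_swapColors a b)

@[simp] theorem card_swapColors (a b : ℕ) (P : Finset ℕ) :
    (swapColors a b P).card = P.card := by
  simp [swapColors]

theorem swapColors_eq_self {a b : ℕ} {P : Finset ℕ} (h : a ∈ P ↔ b ∈ P) :
    swapColors a b P = P := by
  ext c
  rw [mem_swapColors]
  rcases eq_or_ne c a with rfl | hca
  · simp [h]
  · rcases eq_or_ne c b with rfl | hcb
    · simp [h]
    · rw [Equiv.swap_apply_of_ne_of_ne hca hcb]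

theorem swapColors_subset {a b : ℕ} {P C : Finset ℕ} (ha : a ∈ C) (hb : b ∈ C) (hP : P ⊆ C) :
    swapColors a b P ⊆ C := by
  intro c hc
  rw [mem_swapColors] at hc
  rcases eq_or_ne c a with rfl | hca
  · exact ha
  · rcases eq_or_ne c b with rfl | hcb
    · exact hb
    · rw [Equiv.swap_apply_of_ne_of_ne hca hcb] at hc
      exact hP hc

theorem swapColors_eq_insert_erase {a b : ℕ} {P : Finset ℕ} (ha : a ∈ P) (hb : b ∉ P) :
    swapColors a b P = insert b (P.erase a) := by
  ext c
  simp only [mem_swapColors, Finset.mem_insert, Finset.mem_erase]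
  rcases eq_or_ne c a with rfl | hca
  · have : c ≠ b := fun h => hb (h ▸ ha)
    simp [hb, this]
  · rcases eq_or_ne c b with rfl | hcb
    · simp [ha]
    · rw [Equiv.swap_apply_of_ne_of_ne hca hcb]
      simp [hca, hcb]

open Classical in
/-- Apply `swapColors a b` to the color sets of the vertices in `X`. -/
noncomputable def swapOn (P : V → Finset ℕ) (X : Set V) (a b : ℕ) (v : V) : Finset ℕ :=
  if v ∈ X then swapColors a b (P v) else P v

theorem swapOn_of_mem {P : V → Finset ℕ} {X : Set V} {a b : ℕ} {v : V} (h : v ∈ X) :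
    swapOn P X a b v = swapColors a b (P v) := if_pos h

theorem swapOn_of_notMem {P : V → Finset ℕ} {X : Set V} {a b : ℕ} {v : V} (h : v ∉ X) :
    swapOn P X a b v = P v := if_neg h

open Classical in
/-- Exchange the colors `a` and `b` on all edges meeting `X`. -/
noncomputable def exchange (φ : Sym2 V → ℕ) (X : Set V) (a b : ℕ) (e : Sym2 V) : ℕ :=
  if ∃ x ∈ e, x ∈ X then Equiv.swap a b (φ e) else φ e

theorem exchange_of_mem {φ : Sym2 V → ℕ} {X : Set V} {a b : ℕ} {x y : V} (hx : x ∈ X) :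
    exchange φ X a b s(x, y) = Equiv.swap a b (φ s(x, y)) :=
  if_pos ⟨x, Sym2.mem_mk_left x y, hx⟩

theorem exchange_of_notMem {G : SimpleGraph V} {φ : Sym2 V → ℕ} {X : Set V} {a b : ℕ}
    (hX : KempeClosed G φ a b X) {x y : V} (hx : x ∉ X) (hxy : G.Adj x y) :
    exchange φ X a b s(x, y) = φ s(x, y) := by
  by_cases hy : y ∈ X
  · rw [Sym2.eq_swap, exchange_of_mem hy]
    apply Equiv.swap_apply_of_ne_of_ne
    · exact fun h => hx (hX hy hxy.symm (Or.inl h))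
    · exact fun h => hx (hX hy hxy.symm (Or.inr h))
  · apply if_neg
    rintro ⟨z, hz, hzX⟩
    rcases Sym2.mem_iff.1 hz with rfl | rfl
    · exact hx hzX
    · exact hy hzX

theorem exchange_eq_of_ne {φ : Sym2 V → ℕ} {X : Set V} {a b : ℕ} {e : Sym2 V}
    (ha : φ e ≠ a) (hb : φ e ≠ b) : exchange φ X a b e = φ e := by
  unfold exchange
  split_ifs
  · exact Equiv.swap_apply_of_ne_of_ne ha hb
  · rfl

theorem exchange_eq_or {φ : Sym2 V → ℕ} {X : Set V} {a b : ℕ} (e : Sym2 V) :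
    exchange φ X a b e = φ e ∨ exchange φ X a b e = Equiv.swap a b (φ e) := by
  unfold exchange
  split_ifs <;> simp

theorem ProperOn.exchange {G : SimpleGraph V} {C : Finset ℕ} {φ : Sym2 V → ℕ} {X : Set V}
    {a b : ℕ} (h : ProperOn G C φ) (ha : a ∈ C) (hb : b ∈ C) (hX : KempeClosed G φ a b X) :
    ProperOn G C (exchange φ X a b) where
  mem v w hvw := by
    rcases exchange_eq_or (φ := φ) (X := X) (a := a) (b := b) s(v, w) with e | e
    · rw [e]
      exact h.mem hvw
    · rw [e, Equiv.swap_apply_def]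
      split_ifs
      exacts [hb, ha, h.mem hvw]
  inj v w w' hw hw' e := by
    by_cases hv : v ∈ X
    · rw [exchange_of_mem hv, exchange_of_mem hv] at e
      exact h.inj hw hw' ((Equiv.swap a b).injective e)
    · rw [exchange_of_notMem hX hv hw, exchange_of_notMem hX hv hw'] at e
      exact h.inj hw hw' e

variable [Fintype V]

open Classical in
/-- The number of elements with property `p`. -/
noncomputable def numOf (p : V → Prop) : ℕ := (Finset.univ.filter p).card

theorem numOf_eq_card (p : V → Prop) [DecidablePred p] :
    numOf p = (Finset.univ.filter p).card := by
  unfold numOf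
  congr

theorem card_filter_eq_numOf (N : Finset V) (p : V → Prop) [DecidablePred p] :
    (N.filter p).card = numOf fun u => u ∈ N ∧ p u := by
  classical
  rw [numOf_eq_card]
  congr 1
  ext u
  simp

theorem numOf_congr {p q : V → Prop} (h : ∀ x, p x ↔ q x) : numOf p = numOf q := by
  rw [funext fun x => propext (h x)]

theorem numOf_mono {p q : V → Prop} (h : ∀ x, p x → q x) : numOf p ≤ numOf q := by
  classical
  rw [numOf_eq_card, numOf_eq_card]
  exact Finset.card_le_card (Finset.monotone_filter_right _ fun x _ => h x)

theorem numOf_split (p q : V → Prop) :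
    numOf p = numOf (fun x => p x ∧ q x) + numOf fun x => p x ∧ ¬ q x := by
  classical
  rw [numOf_eq_card, numOf_eq_card, numOf_eq_card,
    ← Finset.card_filter_add_card_filter_not (s := Finset.univ.filter p) q,
    Finset.filter_filter, Finset.filter_filter]

theorem numOf_pos {p : V → Prop} : 0 < numOf p ↔ ∃ x, p x := by
  classical
  rw [numOf_eq_card, Finset.card_pos]
  simp [Finset.Nonempty]

theorem numOf_eq_zero {p : V → Prop} : numOf p = 0 ↔ ∀ x, ¬ p x := by
  have := numOf_pos (p := p)
  rw [← not_iff_not, ← ne_eq, ← Nat.pos_iff_ne_zero, this]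
  push Not
  rfl

open Classical in
/-- The set of colors on the edges at `v`, as a finset. -/
noncomputable def palette (G : SimpleGraph V) (φ : Sym2 V → ℕ) (v : V) : Finset ℕ :=
  (Finset.univ.filter (G.Adj v)).image fun w => φ s(v, w)

theorem mem_palette {G : SimpleGraph V} {φ : Sym2 V → ℕ} {v : V} {c : ℕ} :
    c ∈ palette G φ v ↔ ∃ w, G.Adj v w ∧ φ s(v, w) = c := by
  simp [palette]

theorem mem_palette_left {G : SimpleGraph V} {φ : Sym2 V → ℕ} {v w : V} (h : G.Adj v w) :
    φ s(v, w) ∈ palette G φ v :=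
  mem_palette.2 ⟨w, h, rfl⟩

theorem mem_palette_right {G : SimpleGraph V} {φ : Sym2 V → ℕ} {v w : V} (h : G.Adj v w) :
    φ s(v, w) ∈ palette G φ w :=
  mem_palette.2 ⟨v, h.symm, by rw [Sym2.eq_swap]⟩

theorem ProperOn.palette_subset {G : SimpleGraph V} {C : Finset ℕ} {φ : Sym2 V → ℕ}
    (h : ProperOn G C φ) (v : V) : palette G φ v ⊆ C := by
  intro c hc
  obtain ⟨w, hw, rfl⟩ := mem_palette.1 hc
  exact h.mem hw

theorem ProperOn.card_palette {G : SimpleGraph V} {C : Finset ℕ} {φ : Sym2 V → ℕ}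
    (h : ProperOn G C φ) (v : V) [Fintype (G.neighborSet v)] :
    (palette G φ v).card = G.degree v := by
  classical
  rw [palette, Finset.card_image_of_injOn]
  · rw [← SimpleGraph.card_neighborFinset_eq_degree]
    congr 1
    ext w
    simp
  · intro w hw w' hw' e
    simp only [Finset.coe_filter, Finset.mem_univ, true_and, Set.mem_ofPred_eq] at hw hw'
    exact h.inj hw hw' e

theorem palette_exchange_of_mem {G : SimpleGraph V} {φ : Sym2 V → ℕ} {X : Set V}
    {a b : ℕ} {v : V} (hv : v ∈ X) :
    palette G (exchange φ X a b) v = swapColors a b (palette G φ v) := by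
  ext c
  simp only [mem_swapColors, mem_palette, exchange_of_mem hv]
  constructor
  · rintro ⟨w, hw, rfl⟩
    exact ⟨w, hw, by simp⟩
  · rintro ⟨w, hw, e⟩
    exact ⟨w, hw, by rw [e]; simp⟩

theorem palette_exchange_of_notMem {G : SimpleGraph V} {φ : Sym2 V → ℕ} {X : Set V}
    {a b : ℕ} (hX : KempeClosed G φ a b X) {v : V} (hv : v ∉ X) :
    palette G (exchange φ X a b) v = palette G φ v := by
  ext c
  simp only [mem_palette]
  constructor
  · rintro ⟨w, hw, e⟩
    exact ⟨w, hw, by rwa [exchange_of_notMem hX hv hw] at e⟩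
  · rintro ⟨w, hw, e⟩
    exact ⟨w, hw, by rwa [exchange_of_notMem hX hv hw]⟩

theorem palette_exchange {G : SimpleGraph V} {φ : Sym2 V → ℕ} {X : Set V}
    {a b : ℕ} (hX : KempeClosed G φ a b X) :
    palette G (exchange φ X a b) = swapOn (palette G φ) X a b := by
  funext v
  by_cases hv : v ∈ X
  · rw [palette_exchange_of_mem hv, swapOn_of_mem hv]
  · rw [palette_exchange_of_notMem hX hv, swapOn_of_notMem hv]

/-- Within one component of a graph of maximum degree two, at most two vertices have degree
at most one. -/
theorem card_degree_le_one_of_reachable [DecidableEq V] (Γ : SimpleGraph V) [DecidableRel Γ.Adj]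
    (hΓ : ∀ v, Γ.degree v ≤ 2) (x : V) (S : Finset V) (hS : ∀ v ∈ S, Γ.Reachable x v)
    (hd : ∀ v ∈ S, Γ.degree v ≤ 1) : S.card ≤ 2 := by
  classical
  set c := Γ.connectedComponentMk x with hc
  have hconn : c.toSimpleGraph.Connected := c.connected_toSimpleGraph
  have h1 := hconn.card_vert_le_card_edgeSet_add_one
  have h2 := c.toSimpleGraph.sum_degrees_eq_twice_card_edges
  have hdeg : ∀ v : c, c.toSimpleGraph.degree v ≤ Γ.degree v.1 := by
    intro v
    rw [← SimpleGraph.card_neighborFinset_eq_degree, ← SimpleGraph.card_neighborFinset_eq_degree]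
    apply Finset.card_le_card_of_injOn (fun w => w.1)
    · intro w hw
      simp only [Finset.mem_coe, SimpleGraph.mem_neighborFinset] at hw ⊢
      exact hw
    · intro w _ w' _ e
      exact Subtype.ext e
  have hmem : ∀ v ∈ S, v ∈ c.supp := by
    intro v hv
    rw [SimpleGraph.ConnectedComponent.mem_supp_iff, hc, SimpleGraph.ConnectedComponent.eq]
    exact (hS v hv).symm
  have h3 : ∑ v : c, (c.toSimpleGraph.degree v + if v.1 ∈ S then 1 else 0) ≤ ∑ v : c, 2 := by
    apply Finset.sum_le_sum
    intro v _
    have := hdeg v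
    split_ifs with h
    · have := hd _ h
      omega
    · have := hΓ v.1
      omega
  rw [Finset.sum_add_distrib, h2] at h3
  have h4 : ∑ v : c, (if v.1 ∈ S then 1 else 0) = S.card := by
    rw [← Finset.card_filter]
    apply Finset.card_bij (fun v _ => v.1)
    · intro v hv
      simpa using hv
    · intro v _ w _ e
      exact Subtype.ext e
    · intro v hv
      exact ⟨⟨v, hmem v hv⟩, by simpa using hv, rfl⟩
  rw [h4] at h3
  simp only [Finset.sum_const, Finset.card_univ, smul_eq_mul] at h3
  rw [Nat.card_eq_fintype_card, Nat.card_eq_fintype_card, ← SimpleGraph.edgeFinset_card] at h1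
  omega

/-- In a graph of maximum degree two, the component of a vertex of degree one contains another
vertex of degree one. -/
theorem exists_ne_degree_eq_one_of_reachable (Γ : SimpleGraph V)
    [DecidableRel Γ.Adj] (hΓ : ∀ v, Γ.degree v ≤ 2) {x : V} (hx : Γ.degree x = 1) :
    ∃ y, y ≠ x ∧ Γ.Reachable x y ∧ Γ.degree y = 1 := by
  classical
  let Δ : SimpleGraph V :=
    { Adj := fun u v => Γ.Adj u v ∧ Γ.Reachable x u
      symm := ⟨fun u v h => ⟨h.1.symm, h.2.trans h.1.reachable⟩⟩
      loopless := ⟨fun u h => Γ.loopless.irrefl u h.1⟩ }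
  have hΔ : ∀ v, Γ.Reachable x v → Δ.degree v = Γ.degree v := by
    intro v hv
    rw [← SimpleGraph.card_neighborFinset_eq_degree, ← SimpleGraph.card_neighborFinset_eq_degree]
    congr 1
    ext w
    simp [Δ, hv]
  have hΔ' : ∀ v, ¬ Γ.Reachable x v → Δ.degree v = 0 := by
    intro v hv
    rw [← SimpleGraph.card_neighborFinset_eq_degree, Finset.card_eq_zero]
    ext w
    simp [Δ, hv]
  have hodd : Odd (Δ.degree x) := by
    rw [hΔ x (SimpleGraph.Reachable.refl x), hx]
    exact odd_one
  obtain ⟨y, hne, hy⟩ := Δ.exists_ne_odd_degree_of_exists_odd_degree x hodd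
  have hr : Γ.Reachable x y := by
    by_contra h
    rw [hΔ' y h] at hy
    simp at hy
  refine ⟨y, hne, hr, ?_⟩
  rw [hΔ y hr] at hy
  have := hΓ y
  obtain ⟨m, hm⟩ := hy
  omega

/-- `M` is a matching: every vertex has at most one neighbor. -/
def IsMating (M : SimpleGraph V) : Prop := ∀ ⦃x y z⦄, M.Adj x y → M.Adj x z → y = z

theorem exists_maximal_mating (R : SimpleGraph V) :
    ∃ M ≤ R, IsMating M ∧
      ∀ ⦃x y⦄, R.Adj x y → (∃ z, M.Adj x z) ∨ ∃ z, M.Adj y z := by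
  classical
  obtain ⟨M, hM⟩ := (Set.toFinite {M : SimpleGraph V | M ≤ R ∧ IsMating M}).exists_maximal
    ⟨⊥, bot_le, fun x y z h => by simp at h⟩
  refine ⟨M, hM.prop.1, hM.prop.2, ?_⟩
  intro x y hxy
  by_contra! hcon
  obtain ⟨hx, hy⟩ := hcon
  have hle : M ⊔ SimpleGraph.edge x y ≤ M := by
    apply hM.le_of_ge _ le_sup_left
    refine ⟨sup_le hM.prop.1 ?_, ?_⟩
    · intro u v huv
      rw [SimpleGraph.edge_adj] at huv
      rcases huv.1 with ⟨rfl, rfl⟩ | ⟨rfl, rfl⟩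
      · exact hxy
      · exact hxy.symm
    · intro u v w huv huw
      have h1 := hM.prop.2 (x := u) (y := v) (z := w)
      simp only [SimpleGraph.sup_adj, SimpleGraph.edge_adj] at huv huw
      grind [hxy.ne, M.symm]
  exact hx y (hle (Or.inr (by simp [SimpleGraph.edge_adj, hxy.ne])))

section Degree

open Classical

theorem card_colored_neighbors {G : SimpleGraph V} {C : Finset ℕ} {φ : Sym2 V → ℕ}
    (h : ProperOn G C φ) (x : V) (a : ℕ) :
    (Finset.univ.filter fun y => G.Adj x y ∧ φ s(x, y) = a).card =
      if a ∈ palette G φ x then 1 else 0 := by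
  split_ifs with ha
  · obtain ⟨w, hw, e⟩ := mem_palette.1 ha
    rw [Finset.card_eq_one]
    refine ⟨w, ?_⟩
    ext y
    simp only [Finset.mem_filter, Finset.mem_univ, true_and, Finset.mem_singleton]
    constructor
    · rintro ⟨h1, h2⟩
      exact h.inj h1 hw (h2.trans e.symm)
    · rintro rfl
      exact ⟨hw, e⟩
  · rw [Finset.card_eq_zero]
    ext y
    simp only [Finset.mem_filter, Finset.mem_univ, true_and, Finset.notMem_empty, iff_false]
    exact fun hy => ha (mem_palette.2 ⟨y, hy⟩)

theorem card_mates {M : SimpleGraph V} (hM : IsMating M) (x : V) :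
    (Finset.univ.filter fun y => M.Adj x y).card = if ∃ y, M.Adj x y then 1 else 0 := by
  split_ifs with h
  · obtain ⟨w, hw⟩ := h
    rw [Finset.card_eq_one]
    refine ⟨w, ?_⟩
    ext y
    simp only [Finset.mem_filter, Finset.mem_univ, true_and, Finset.mem_singleton]
    exact ⟨fun hy => hM hy hw, fun e => e ▸ hw⟩
  · rw [Finset.card_eq_zero]
    ext y
    simpa using fun hy => h ⟨y, hy⟩

theorem degree_kempe_le {G : SimpleGraph V} {C : Finset ℕ} {φ : Sym2 V → ℕ}
    (h : ProperOn G C φ) {M : SimpleGraph V} (hM : IsMating M) (a b : ℕ) (x : V) :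
    (twoColored G φ a b ⊔ M).degree x ≤ (if a ∈ palette G φ x then 1 else 0) +
      (if b ∈ palette G φ x then 1 else 0) + if ∃ y, M.Adj x y then 1 else 0 := by
  rw [← card_colored_neighbors h, ← card_colored_neighbors h, ← card_mates hM,
    ← SimpleGraph.card_neighborFinset_eq_degree]
  refine le_trans (Finset.card_le_card ?_)
    ((Finset.card_union_le _ _).trans (Nat.add_le_add_right (Finset.card_union_le _ _) _))
  intro y
  simp only [SimpleGraph.mem_neighborFinset, SimpleGraph.sup_adj, twoColored_adj, Finset.mem_union,
    Finset.mem_filter, Finset.mem_univ, true_and]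
  tauto

theorem degree_kempe_eq {G : SimpleGraph V} {C : Finset ℕ} {φ : Sym2 V → ℕ}
    (h : ProperOn G C φ) {M : SimpleGraph V} (hM : IsMating M) {a b : ℕ} (hab : a ≠ b)
    (hsep : ∀ ⦃x y⦄, M.Adj x y → (a ∈ palette G φ x ↔ b ∉ palette G φ x) ∧
      (a ∈ palette G φ y ↔ b ∈ palette G φ x)) (x : V) :
    (twoColored G φ a b ⊔ M).degree x = (if a ∈ palette G φ x then 1 else 0) +
      (if b ∈ palette G φ x then 1 else 0) + if ∃ y, M.Adj x y then 1 else 0 := by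
  rw [← card_colored_neighbors h, ← card_colored_neighbors h, ← card_mates hM,
    ← SimpleGraph.card_neighborFinset_eq_degree, ← Finset.card_union_of_disjoint,
    ← Finset.card_union_of_disjoint]
  · congr 1
    ext y
    simp only [SimpleGraph.mem_neighborFinset, SimpleGraph.sup_adj, twoColored_adj,
      Finset.mem_union,
      Finset.mem_filter, Finset.mem_univ, true_and]
    tauto
  · rw [Finset.disjoint_left]
    intro y hy hy'
    simp only [Finset.mem_union, Finset.mem_filter, Finset.mem_univ, true_and] at hy hy'
    obtain ⟨h1, h2⟩ := hsep hy'
    obtain ⟨h3, h4⟩ := hsep hy'.symm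
    rcases hy with ⟨h5, rfl⟩ | ⟨h5, rfl⟩
    · have h7 := mem_palette_left (φ := φ) h5
      have h8 := mem_palette_right (φ := φ) h5
      tauto
    · have h7 := mem_palette_left (φ := φ) h5
      have h8 := mem_palette_right (φ := φ) h5
      tauto
  · rw [Finset.disjoint_left]
    intro y hy hy'
    simp only [Finset.mem_filter, Finset.mem_univ, true_and] at hy hy'
    exact hab (hy.2.symm.trans hy'.2)

/-- A matching pairs off the matched vertices of two kinds inside a closed set. -/
theorem card_mated_eq {M : SimpleGraph V} (hM : IsMating M) {X : Set V}
    (hX : ∀ ⦃x y⦄, x ∈ X → M.Adj x y → y ∈ X) (A B : V → Prop)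
    (hAB : ∀ ⦃x y⦄, M.Adj x y → (A x ↔ B y)) :
    numOf (fun x => x ∈ X ∧ A x ∧ ∃ y, M.Adj x y) =
      numOf fun x => x ∈ X ∧ B x ∧ ∃ y, M.Adj x y := by
  have key : ∀ x : V, ∃ y, (∃ z, M.Adj x z) → M.Adj x y := fun x => by
    by_cases h : ∃ z, M.Adj x z
    · exact ⟨h.choose, fun _ => h.choose_spec⟩
    · exact ⟨x, fun h' => absurd h' h⟩
  choose f hf using key
  rw [numOf_eq_card, numOf_eq_card]
  apply Finset.card_bij' (fun x _ => f x) (fun x _ => f x)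
  · intro x hx
    simp only [Finset.mem_filter, Finset.mem_univ, true_and] at hx ⊢
    exact ⟨hX hx.1 (hf x hx.2.2), (hAB (hf x hx.2.2)).1 hx.2.1, x, (hf x hx.2.2).symm⟩
  · intro x hx
    simp only [Finset.mem_filter, Finset.mem_univ, true_and] at hx ⊢
    exact ⟨hX hx.1 (hf x hx.2.2), (hAB (hf x hx.2.2).symm).2 hx.2.1, x, (hf x hx.2.2).symm⟩
  · intro x hx
    simp only [Finset.mem_filter, Finset.mem_univ, true_and] at hx
    have := (hf x hx.2.2).symm
    exact hM (hf _ ⟨_, this⟩) this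
  · intro x hx
    simp only [Finset.mem_filter, Finset.mem_univ, true_and] at hx
    have := (hf x hx.2.2).symm
    exact hM (hf _ ⟨_, this⟩) this

end Degree

end VertexDistinguishing

namespace VertexDistinguishing

theorem exists_forall_le_of_exists {α : Type*} (p : α → Prop) (f : α → ℕ) (h : ∃ a, p a) :
    ∃ a, p a ∧ ∀ b, p b → f a ≤ f b := by
  obtain ⟨a, ha, hm⟩ := (measure f).wf.has_min {a | p a} h
  exact ⟨a, ha, fun b hb => not_lt.1 (hm b hb)⟩

/-- Moving `t` units from a large entry to a sufficiently smaller one decreases the sum of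
squares. -/
theorem sum_sq_lt_of_transfer {α : Type*} [DecidableEq α] {C : Finset α} {f g : α → ℕ} {i j : α}
    {t : ℕ} (hi : i ∈ C) (hj : j ∈ C) (hij : i ≠ j) (h1 : g i + t = f i) (h2 : g j = f j + t)
    (h : ∀ c, c ≠ i → c ≠ j → g c = f c) (ht : 0 < t) (hlt : f j + t < f i) :
    ∑ c ∈ C, g c ^ 2 < ∑ c ∈ C, f c ^ 2 := by
  have hj' : j ∈ C.erase i := Finset.mem_erase.2 ⟨hij.symm, hj⟩
  rw [← Finset.add_sum_erase C _ hi, ← Finset.add_sum_erase C _ hi,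
    ← Finset.add_sum_erase _ _ hj', ← Finset.add_sum_erase _ _ hj']
  have : ∑ c ∈ (C.erase i).erase j, g c ^ 2 = ∑ c ∈ (C.erase i).erase j, f c ^ 2 := by
    apply Finset.sum_congr rfl
    intro c hc
    simp only [Finset.mem_erase] at hc
    rw [h c hc.2.1 hc.1]
  rw [this, h2, ← h1]
  obtain ⟨s, hs⟩ : ∃ s, g i = f j + s + 1 := ⟨g i - f j - 1, by omega⟩
  rw [hs]
  nlinarith [Nat.zero_le (s * t)]

variable {V : Type*}

/-- The star with center `v` and leaves `N`. -/
def star (v : V) (N : Finset V) : SimpleGraph V :=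
  SimpleGraph.fromRel fun x y => x = v ∧ y ∈ N

/-- The subgraph of the edges whose color is not `i`. -/
def avoidColor (G : SimpleGraph V) (φ : Sym2 V → ℕ) (i : ℕ) : SimpleGraph V where
  Adj x y := G.Adj x y ∧ φ s(x, y) ≠ i
  symm := ⟨fun x y h => ⟨h.1.symm, by rw [Sym2.eq_swap]; exact h.2⟩⟩
  loopless := ⟨fun x h => G.loopless.irrefl x h.1⟩

variable [Fintype V]

/-- The hypotheses under which the edges from `v` to `N` can be added to a colored graph:
`P u` is a set of colors that are not available at `u`. -/
structure StarData (H : SimpleGraph V) (C : Finset ℕ) (N : Finset V) (φ : Sym2 V → ℕ)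
    (P : V → Finset ℕ) : Prop where
  proper : ProperOn H C φ
  palette_subset : ∀ u ∈ N, palette H φ u ⊆ P u
  subset : ∀ u ∈ N, P u ⊆ C

theorem StarData.exchange {H : SimpleGraph V} {C : Finset ℕ} {N : Finset V} {φ : Sym2 V → ℕ}
    {P : V → Finset ℕ} (h : StarData H C N φ P) {i j : ℕ} (hi : i ∈ C) (hj : j ∈ C) {X : Set V}
    (hX : KempeClosed H φ i j X) :
    StarData H C N (exchange φ X i j) (swapOn P X i j) where
  proper := h.proper.exchange hi hj hX
  palette_subset u hu := by
    by_cases hx : u ∈ X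
    · rw [swapOn_of_mem hx, palette_exchange_of_mem hx]
      exact Finset.map_subset_map.2 (h.palette_subset u hu)
    · rw [swapOn_of_notMem hx, palette_exchange_of_notMem hX hx]
      exact h.palette_subset u hu
  subset u hu := by
    by_cases hx : u ∈ X
    · rw [swapOn_of_mem hx]
      exact swapColors_subset hi hj (h.subset u hu)
    · rw [swapOn_of_notMem hx]
      exact h.subset u hu

theorem StarData.numOf_le {H : SimpleGraph V} {C : Finset ℕ} {N : Finset V}
    {φ : Sym2 V → ℕ} {P : V → Finset ℕ} (h : StarData H C N φ P)
    (hmin : ∀ φ' P', StarData H C N φ' P' → (∀ u, (P' u).card = (P u).card) →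
      ∑ c ∈ C, numOf (fun u => u ∈ N ∧ c ∉ P u) ^ 2 ≤
        ∑ c ∈ C, numOf (fun u => u ∈ N ∧ c ∉ P' u) ^ 2)
    {i j : ℕ} (hi : i ∈ C) (hj : j ∈ C) :
    numOf (fun u => u ∈ N ∧ i ∉ P u) ≤ numOf (fun u => u ∈ N ∧ j ∉ P u) + 2 := by
  classical
  by_contra! hcon
  have hij : i ≠ j := by
    rintro rfl
    omega
  let A : V → Prop := fun x => x ∈ N ∧ i ∉ P x ∧ j ∈ P x
  let B : V → Prop := fun x => x ∈ N ∧ j ∉ P x ∧ i ∈ P x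
  have hAB : ∀ x, A x → ¬ B x := fun x hA hB => hA.2.1 hB.2.2
  let R : SimpleGraph V :=
    { Adj := fun x y => (A x ∧ B y) ∨ (B x ∧ A y)
      symm := ⟨fun x y h => by tauto⟩
      loopless := ⟨fun x h => by have := hAB x; tauto⟩ }
  obtain ⟨M, hMR, hM, hmax⟩ := exists_maximal_mating R
  have hMA : ∀ ⦃x y⦄, M.Adj x y → (A x ↔ B y) := by
    intro x y hxy
    have h1 := hMR hxy
    have h2 := hAB x
    have h3 := hAB y
    simp only [R] at h1
    tauto
  have count : ∀ X : Set V, (∀ ⦃x y⦄, x ∈ X → M.Adj x y → y ∈ X) →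
      numOf (fun x => x ∈ X ∧ A x) = numOf (fun x => x ∈ X ∧ A x ∧ ¬ ∃ y, M.Adj x y) +
        numOf (fun x => x ∈ X ∧ B x ∧ ∃ y, M.Adj x y) := by
    intro X hX
    rw [← card_mated_eq hM hX A B hMA, add_comm, numOf_split _ fun x => ∃ y, M.Adj x y]
    simp only [and_assoc]
  have hunm : ∃ x, A x ∧ ¬ ∃ y, M.Adj x y := by
    by_contra! hno
    have h1 := count Set.univ (fun _ _ _ _ => trivial)
    have h2 : numOf (fun x => x ∈ Set.univ ∧ A x ∧ ¬ ∃ y, M.Adj x y) = 0 := by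
      rw [numOf_eq_zero]
      rintro x ⟨-, hA, hn⟩
      exact hn (hno x hA)
    have h3 : numOf (fun x => x ∈ Set.univ ∧ B x ∧ ∃ y, M.Adj x y) ≤
        numOf (fun u => (u ∈ N ∧ j ∉ P u) ∧ ¬ i ∉ P u) :=
      numOf_mono fun x hx => ⟨⟨hx.2.1.1, hx.2.1.2.1⟩, not_not.2 hx.2.1.2.2⟩
    have h4 : numOf (fun x => x ∈ Set.univ ∧ A x) =
        numOf (fun u => (u ∈ N ∧ i ∉ P u) ∧ ¬ j ∉ P u) := by
      apply numOf_congr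
      simp [A, and_assoc]
    have h5 := numOf_split (fun u => u ∈ N ∧ i ∉ P u) (fun u => j ∉ P u)
    have h6 := numOf_split (fun u => u ∈ N ∧ j ∉ P u) (fun u => i ∉ P u)
    have h7 : numOf (fun u => (u ∈ N ∧ i ∉ P u) ∧ j ∉ P u) =
        numOf (fun u => (u ∈ N ∧ j ∉ P u) ∧ i ∉ P u) := numOf_congr fun x => by tauto
    omega
  obtain ⟨x, hxA, hxM⟩ := hunm
  have hB : ∀ y, B y → ∃ z, M.Adj y z := by
    intro y hy
    have : R.Adj x y := Or.inl ⟨hxA, hy⟩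
    rcases hmax this with h' | h'
    · exact absurd h' hxM
    · exact h'
  set X : Set V := {y | (twoColored H φ i j ⊔ M).Reachable x y} with hXdef
  have hXK : KempeClosed H φ i j X := kempeClosed_reachable H φ i j M x
  have hXM : ∀ ⦃x y⦄, x ∈ X → M.Adj x y → y ∈ X := by
    intro y z hy hyz
    have : (twoColored H φ i j ⊔ M).Adj y z := Or.inr hyz
    exact SimpleGraph.Reachable.trans hy this.reachable
  set t := numOf (fun x => x ∈ X ∧ A x ∧ ¬ ∃ y, M.Adj x y) with ht
  have hU1 : 0 < t := numOf_pos.2 ⟨x, SimpleGraph.Reachable.refl x, hxA, hxM⟩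
  have hsep : ∀ y, (∃ z, M.Adj y z) → y ∈ N ∧ (i ∈ P y ↔ j ∉ P y) := by
    rintro y ⟨z, hz⟩
    have := hMR hz
    simp only [R, A, B] at this
    tauto
  have hU2 : t ≤ 2 := by
    rw [ht, numOf_eq_card]
    apply card_degree_le_one_of_reachable (twoColored H φ i j ⊔ M) _ x
    · intro v hv
      exact (Finset.mem_filter.1 hv).2.1
    · intro v hv
      have hv := (Finset.mem_filter.1 hv).2
      refine (degree_kempe_le h.proper hM i j v).trans ?_
      have h1 := h.palette_subset v hv.2.1.1
      have h2 : i ∉ palette H φ v := fun h' => hv.2.1.2.1 (h1 h')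
      rw [if_neg h2, if_neg hv.2.2]
      split_ifs <;> omega
    · intro v
      refine (degree_kempe_le h.proper hM i j v).trans ?_
      by_cases hv : ∃ y, M.Adj v y
      · obtain ⟨hvN, hv'⟩ := hsep v hv
        have h1 := h.palette_subset v hvN
        by_cases hiP : i ∈ P v
        · have : j ∉ palette H φ v := fun h' => hv'.1 hiP (h1 h')
          rw [if_neg this]
          split_ifs <;> omega
        · have : i ∉ palette H φ v := fun h' => hiP (h1 h')
          rw [if_neg this]
          split_ifs <;> omega
      · rw [if_neg hv]
        split_ifs <;> omega
  refine absurd (hmin _ _ (h.exchange hi hj hXK) ?_) (not_le.2 ?_)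
  · intro u
    by_cases hu : u ∈ X
    · rw [swapOn_of_mem hu, card_swapColors]
    · rw [swapOn_of_notMem hu]
  have hnew : ∀ c, numOf (fun u => u ∈ N ∧ c ∉ swapOn P X i j u) =
      numOf (fun u => (u ∈ N ∧ Equiv.swap i j c ∉ P u) ∧ u ∈ X) +
        numOf (fun u => (u ∈ N ∧ c ∉ P u) ∧ ¬ u ∈ X) := by
    intro c
    rw [numOf_split _ fun u => u ∈ X]
    congr 1
    · apply numOf_congr
      intro u
      by_cases hu : u ∈ X <;> simp [hu, swapOn]
    · apply numOf_congr
      intro u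
      by_cases hu : u ∈ X <;> simp [hu, swapOn]
  have hni := hnew i
  have hnj := hnew j
  rw [Equiv.swap_apply_left] at hni
  rw [Equiv.swap_apply_right] at hnj
  have hi1 := numOf_split (fun u => u ∈ N ∧ i ∉ P u) (fun u => u ∈ X)
  have hj1 := numOf_split (fun u => u ∈ N ∧ j ∉ P u) (fun u => u ∈ X)
  have hi2 := numOf_split (fun u => (u ∈ N ∧ i ∉ P u) ∧ u ∈ X) (fun u => j ∉ P u)
  have hj2 := numOf_split (fun u => (u ∈ N ∧ j ∉ P u) ∧ u ∈ X) (fun u => i ∉ P u)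
  have hc := count X hXM
  have h1 : numOf (fun x => x ∈ X ∧ A x) =
      numOf (fun u => ((u ∈ N ∧ i ∉ P u) ∧ u ∈ X) ∧ ¬ j ∉ P u) :=
    numOf_congr fun u => by simp only [A]; tauto
  have h2 : numOf (fun x => x ∈ X ∧ B x ∧ ∃ y, M.Adj x y) =
      numOf (fun u => ((u ∈ N ∧ j ∉ P u) ∧ u ∈ X) ∧ ¬ i ∉ P u) :=
    numOf_congr fun u => by
      have := hB u
      simp only [B] at this ⊢
      tauto
  have h3 : numOf (fun u => ((u ∈ N ∧ i ∉ P u) ∧ u ∈ X) ∧ j ∉ P u) =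
      numOf (fun u => ((u ∈ N ∧ j ∉ P u) ∧ u ∈ X) ∧ i ∉ P u) :=
    numOf_congr fun u => by tauto
  rw [← ht] at hc
  apply sum_sq_lt_of_transfer (t := t) hi hj hij
  · omega
  · omega
  · intro c hci hcj
    rw [hnew c, Equiv.swap_apply_of_ne_of_ne hci hcj, ← numOf_split]
  · exact hU1
  · omega

open Classical in
theorem exists_properOn_sup_star (n : ℕ) : ∀ (H : SimpleGraph V) (C : Finset ℕ) (v u₀ : V)
    (N : Finset V) (φ : Sym2 V → ℕ) (P : V → Finset ℕ), N.card = n → (∀ w, ¬ H.Adj v w) →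
    v ∉ N → StarData H C N φ P → N.card ≤ C.card →
    (∀ u ∈ N, u ≠ u₀ → (P u).card + 2 ≤ C.card) → (∀ u ∈ N, (P u).card + 1 ≤ C.card) →
    ∃ φ', ProperOn (H ⊔ star v N) C φ' := by
  induction n with
  | zero =>
    intro H C v u₀ N φ P hn _ _ hd _ _ _
    refine ⟨φ, ?_⟩
    rw [Finset.card_eq_zero] at hn
    have : star v N = ⊥ := by
      ext x y
      simp [star, hn]
    rw [this, sup_bot_eq]
    exact hd.proper
  | succ n ih =>
    intro H C v u₀' N φ₀ P₀ hn hv hvN hd₀ hNC hP2 hP1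
    obtain ⟨u₀, hu₀, hP2⟩ : ∃ u₀ ∈ N, ∀ u ∈ N, u ≠ u₀ → (P₀ u).card + 2 ≤ C.card := by
      by_cases h : u₀' ∈ N
      · exact ⟨u₀', h, hP2⟩
      · obtain ⟨w, hw⟩ : N.Nonempty := Finset.card_pos.1 (by omega)
        exact ⟨w, hw, fun u hu _ => hP2 u hu fun e => h (e ▸ hu)⟩
    have henl : ∀ u, ∃ Q : Finset ℕ, u ∈ N →
        P₀ u ⊆ Q ∧ Q ⊆ C ∧ Q.card + (if u = u₀ then 1 else 2) = C.card := by
      intro u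
      by_cases hu : u ∈ N
      · have hle : (P₀ u).card + (if u = u₀ then 1 else 2) ≤ C.card := by
          split_ifs with h
          · exact hP1 u hu
          · exact hP2 u hu h
        obtain ⟨Q, h1, h2, h3⟩ := Finset.exists_subsuperset_card_eq (hd₀.subset u hu)
          (n := C.card - (if u = u₀ then 1 else 2)) (by omega) (by omega)
        exact ⟨Q, fun _ => ⟨h1, h2, by omega⟩⟩
      · exact ⟨∅, fun h => absurd h hu⟩
    choose P₁ hP₁ using henl
    obtain ⟨⟨φ, P⟩, ⟨hd, hcard⟩, hmin⟩ := exists_forall_le_of_exists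
      (fun p : (Sym2 V → ℕ) × (V → Finset ℕ) => StarData H C N p.1 p.2 ∧
        ∀ u ∈ N, (p.2 u).card + (if u = u₀ then 1 else 2) = C.card)
      (fun p => ∑ c ∈ C, numOf (fun u => u ∈ N ∧ c ∉ p.2 u) ^ 2)
      ⟨(φ₀, P₁), ⟨hd₀.proper, fun u hu => (hd₀.palette_subset u hu).trans (hP₁ u hu).1,
        fun u hu => (hP₁ u hu).2.1⟩, fun u hu => (hP₁ u hu).2.2⟩
    simp only at hd hcard hmin
    have hdiff : ∀ i ∈ C, ∀ j ∈ C, (N.filter fun u => i ∉ P u).card ≤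
        (N.filter fun u => j ∉ P u).card + 2 := by
      intro i hi j hj
      rw [card_filter_eq_numOf, card_filter_eq_numOf]
      apply hd.numOf_le _ hi hj
      intro φ' P' hd' hc
      exact hmin (φ', P') ⟨hd', fun u hu => by rw [hc]; exact hcard u hu⟩
    have hsum : ∑ c ∈ C, (N.filter fun u => c ∉ P u).card + 1 = 2 * N.card := by
      have h1 : ∑ c ∈ C, (N.filter fun u => c ∉ P u).card =
          ∑ u ∈ N, (C.filter fun c => c ∉ P u).card := by
        simp only [Finset.card_filter]
        exact Finset.sum_comm
      have h2 : ∀ u ∈ N, (C.filter fun c => c ∉ P u).card = if u = u₀ then 1 else 2 := by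
        intro u hu
        have h3 := hcard u hu
        have h4 := Finset.card_sdiff_add_card_eq_card (hd.subset u hu)
        rw [Finset.filter_notMem_eq_sdiff]
        omega
      rw [h1, Finset.sum_congr rfl h2, ← Finset.add_sum_erase N _ hu₀, if_pos rfl,
        Finset.sum_congr rfl (g := fun _ => 2) fun u hu => if_neg (Finset.mem_erase.1 hu).1,
        Finset.sum_const, Finset.card_erase_of_mem hu₀, hn, smul_eq_mul]
      omega
    obtain ⟨i, hiC, hi⟩ : ∃ i ∈ C, (N.filter fun u => i ∉ P u).card = 1 := by
      by_contra! hno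
      have hsmall : ∃ j ∈ C, (N.filter fun u => j ∉ P u).card < 2 := by
        by_contra! hge
        have := Finset.card_nsmul_le_sum C _ 2 hge
        rw [smul_eq_mul] at this
        omega
      obtain ⟨j, hj, hj2⟩ := hsmall
      have heven : Even (∑ c ∈ C, (N.filter fun u => c ∉ P u).card) := by
        apply Finset.even_sum
        intro c hc
        have h1 := hdiff c hc j hj
        have h2 := hno j hj
        have h3 := hno c hc
        have : (N.filter fun u => c ∉ P u).card = 0 ∨ (N.filter fun u => c ∉ P u).card = 2 := by
          omega
        rcases this with e | e <;> rw [e] <;> decide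
      obtain ⟨m, hm⟩ := heven
      omega
    obtain ⟨u₁, hu₁⟩ := Finset.card_eq_one.1 hi
    have hu₁' : u₁ ∈ N ∧ i ∉ P u₁ := by
      have : u₁ ∈ N.filter fun u => i ∉ P u := by simp [hu₁]
      simpa using this
    have hother : ∀ u ∈ N, u ≠ u₁ → i ∈ P u := by
      intro u hu hne
      by_contra hiu
      have : u ∈ N.filter fun u => i ∉ P u := Finset.mem_filter.2 ⟨hu, hiu⟩
      rw [hu₁, Finset.mem_singleton] at this
      exact hne this
    have hd' : StarData (avoidColor H φ i) (C.erase i) (N.erase u₁) φ fun u => (P u).erase i := by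
      refine ⟨⟨fun x y h => Finset.mem_erase.2 ⟨h.2, hd.proper.mem h.1⟩,
        fun x y z h h' e => hd.proper.inj h.1 h'.1 e⟩, ?_, ?_⟩
      · intro u hu c hc
        obtain ⟨w, hw, rfl⟩ := mem_palette.1 hc
        exact Finset.mem_erase.2 ⟨hw.2, hd.palette_subset u (Finset.mem_of_mem_erase hu)
          (mem_palette_left hw.1)⟩
      · intro u hu
        exact Finset.erase_subset_erase _ (hd.subset u (Finset.mem_of_mem_erase hu))
    have hPe : ∀ u ∈ N.erase u₁, ((P u).erase i).card + 1 = (P u).card := by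
      intro u hu
      rw [Finset.mem_erase] at hu
      exact Finset.card_erase_add_one (hother u hu.2 hu.1)
    have hCe : (C.erase i).card + 1 = C.card := Finset.card_erase_add_one hiC
    obtain ⟨φ', hφ'⟩ := ih (avoidColor H φ i) (C.erase i) v u₀ (N.erase u₁) φ _
      (by rw [Finset.card_erase_of_mem hu₁'.1]; omega) (fun w h => hv w h.1)
      (fun h => hvN (Finset.mem_of_mem_erase h)) hd'
      (by rw [Finset.card_erase_of_mem hu₁'.1]; omega)
      (by
        intro u hu hne
        have h1 := hPe u hu
        have h2 := hcard u (Finset.mem_of_mem_erase hu)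
        rw [if_neg hne] at h2
        omega)
      (by
        intro u hu
        have h1 := hPe u hu
        have h2 := hcard u (Finset.mem_of_mem_erase hu)
        split_ifs at h2 <;> omega)
    let κ : Sym2 V → Prop := fun e => e = s(v, u₁) ∨ (e ∈ H.edgeSet ∧ φ e = i)
    have hvu : v ≠ u₁ := fun e => hvN (e ▸ hu₁'.1)
    have hadj : ∀ x y, (H ⊔ star v N).Adj x y → ¬ κ s(x, y) →
        (avoidColor H φ i ⊔ star v (N.erase u₁)).Adj x y := by
      intro x y hxy hk
      simp only [κ, SimpleGraph.mem_edgeSet, not_or, not_and, Sym2.eq_iff] at hk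
      simp only [SimpleGraph.sup_adj, avoidColor, star, SimpleGraph.fromRel_adj,
        Finset.mem_erase] at hxy ⊢
      grind
    have hmatch : ∀ x y z, κ s(x, y) → κ s(x, z) → y = z := by
      intro x y z h1 h2
      have hiu : ∀ w, H.Adj u₁ w → φ s(u₁, w) ≠ i := fun w hw e =>
        hu₁'.2 (hd.palette_subset u₁ hu₁'.1 (mem_palette.2 ⟨w, hw, e⟩))
      simp only [κ, SimpleGraph.mem_edgeSet, Sym2.eq_iff] at h1 h2
      have h3 := hd.proper.inj (v := x) (w := y) (w' := z)
      grind
    refine ⟨fun e => if κ e then i else φ' e, ⟨?_, ?_⟩⟩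
    · intro x y hxy
      split_ifs with h
      · exact hiC
      · exact Finset.mem_of_mem_erase (hφ'.mem (hadj x y hxy h))
    · intro x y z hxy hxz e
      split_ifs at e with h1 h2 h2
      · exact hmatch x y z h1 h2
      · exact absurd e.symm (Finset.mem_erase.1 (hφ'.mem (hadj x z hxz h2))).1
      · exact absurd e (Finset.mem_erase.1 (hφ'.mem (hadj x y hxy h1))).1
      · exact hφ'.inj (hadj x y hxy h1) (hadj x z hxz h2) e

/-- The subgraph of the edges with both ends in `S`. -/
def within (G : SimpleGraph V) (S : Finset V) : SimpleGraph V where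
  Adj x y := G.Adj x y ∧ x ∈ S ∧ y ∈ S
  symm := ⟨fun _ _ h => ⟨h.1.symm, h.2.2, h.2.1⟩⟩
  loopless := ⟨fun x h => G.loopless.irrefl x h.1⟩

open Classical in
theorem exists_properOn_within_insert {G : SimpleGraph V} {C : Finset ℕ} {S : Finset V} {v : V}
    (hv : v ∉ S) (hS : ∀ u ∈ S, G.degree u + 1 ≤ C.card) (hvC : G.degree v ≤ C.card)
    (h : ∃ φ, ProperOn (within G S) C φ) : ∃ φ, ProperOn (within G (insert v S)) C φ := by
  obtain ⟨φ, hφ⟩ := h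
  set N := S.filter fun u => G.Adj v u with hN
  have hgraph : within G (insert v S) = within G S ⊔ star v N := by
    ext x y
    simp only [within, SimpleGraph.sup_adj, star, SimpleGraph.fromRel_adj, hN, Finset.mem_filter,
      Finset.mem_insert]
    have := G.adj_comm x y
    have := G.irrefl (v := v)
    grind [G.ne_of_adj]
  have hpal : ∀ u ∈ N, (palette (within G S) φ u).card + 2 ≤ C.card := by
    intro u hu
    rw [hN, Finset.mem_filter] at hu
    have h1 := hS u hu.1
    rw [hφ.card_palette u, ← SimpleGraph.card_neighborFinset_eq_degree]
    rw [← SimpleGraph.card_neighborFinset_eq_degree] at h1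
    have h2 : (within G S).neighborFinset u ⊂ G.neighborFinset u := by
      rw [Finset.ssubset_iff_of_subset]
      · refine ⟨v, ?_, ?_⟩
        · simpa using hu.2.symm
        · rw [SimpleGraph.mem_neighborFinset]
          exact fun h => hv h.2.2
      · intro w hw
        simp only [SimpleGraph.mem_neighborFinset] at hw ⊢
        exact hw.1
    have := Finset.card_lt_card h2
    omega
  rw [hgraph]
  apply exists_properOn_sup_star N.card (within G S) C v v N φ (palette (within G S) φ) rfl
  · exact fun w hw => hv hw.2.1
  · simp [hN, hv]
  · exact ⟨hφ, fun _ _ => subset_rfl, fun u _ => hφ.palette_subset u⟩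
  · refine le_trans (Finset.card_le_card ?_) hvC
    intro u hu
    rw [hN, Finset.mem_filter] at hu
    simpa using hu.2
  · exact fun u hu _ => hpal u hu
  · exact fun u hu => (Nat.le_succ _).trans (hpal u hu)

/-- A graph is edge colorable with `C.card` colors if at most one vertex has degree `C.card` and
all others have smaller degree. -/
theorem exists_properOn (G : SimpleGraph V) [DecidableRel G.Adj] (C : Finset ℕ) (z : V)
    (hz : G.degree z ≤ C.card) (h : ∀ v, v ≠ z → G.degree v + 1 ≤ C.card) :
    ∃ φ, ProperOn G C φ := by
  classical
  have key : ∀ S : Finset V, z ∉ S → ∃ φ, ProperOn (within G S) C φ := by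
    intro S
    induction S using Finset.induction_on with
    | empty =>
      intro _
      exact ⟨fun _ => 0, fun x y h => by simp [within] at h, fun x y z h => by simp [within] at h⟩
    | insert v S hv ih =>
      intro hzS
      rw [Finset.mem_insert, not_or] at hzS
      apply exists_properOn_within_insert hv
      · intro u hu
        have := h u (fun e => hzS.2 (e ▸ hu))
        convert this
      · have := h v (Ne.symm hzS.1)
        refine le_trans (le_of_eq ?_) ((Nat.le_succ _).trans this)
        convert rfl
      · exact ih hzS.2
  obtain ⟨φ, hφ⟩ := exists_properOn_within_insert (v := z) (S := Finset.univ.erase z) (G := G)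
    (C := C) (by simp) (fun u hu => by convert h u (Finset.ne_of_mem_erase hu))
    (by convert hz) (key _ (by simp))
  refine ⟨φ, ?_⟩
  have : within G (insert z (Finset.univ.erase z)) = G := by
    ext x y
    simp [within]
  rwa [this] at hφ

end VertexDistinguishing

namespace VertexDistinguishing

/-- A family of multiplicity functions on color sets, closed under the changes of multiplicities
caused by exchanging two colors on part of a graph. -/
structure IsCountSystem (C : Finset ℕ) (n : ℕ) (F : Set (Finset ℕ → ℕ)) : Prop where
  support : ∀ ⦃f⦄, f ∈ F → ∀ ⦃Z⦄, f Z ≠ 0 → Z ⊆ C ∧ 5 ≤ Z.card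
  total : ∀ ⦃f⦄, f ∈ F → ∀ T : Finset (Finset ℕ), ∑ Z ∈ T, f Z ≤ n
  layer : ∀ ⦃f⦄, f ∈ F → ∀ d, ∑ Z ∈ C.powersetCard d, f Z ≤ C.card.choose d
  move : ∀ ⦃f⦄, f ∈ F → ∀ ⦃S : Finset ℕ⦄ ⦃a b : ℕ⦄, a ∈ C → b ∈ C → a ∈ S → b ∉ S →
    f (insert b (S.erase a)) < f S →
    (f S = f (insert b (S.erase a)) + 2 ∧
        (fun Z => f (Equiv.swap S (insert b (S.erase a)) Z)) ∈ F) ∨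
      (f S = f (insert b (S.erase a)) + 1 ∧ ∃ B, ¬ (a ∈ B ↔ b ∈ B) ∧ B ≠ S ∧
        B ≠ insert b (S.erase a) ∧ f B = f (swapColors a b B) + 1 ∧
        (fun Z => f (Equiv.swap S (insert b (S.erase a)) (Equiv.swap B (swapColors a b B) Z))) ∈ F)

theorem insert_erase_inj {S B : Finset ℕ} {a b : ℕ} (ha : a ∈ S) (hb : b ∉ S)
    (h : swapColors a b B = insert b (S.erase a)) : B = S := by
  rw [← swapColors_eq_insert_erase ha hb] at h
  exact swapColors_injective a b h

theorem swapColors_eq_iff {S B : Finset ℕ} {a b : ℕ} :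
    swapColors a b B = S ↔ B = swapColors a b S := by
  constructor <;> rintro rfl <;> simp

namespace IsCountSystem

variable {C : Finset ℕ} {n : ℕ} {F : Set (Finset ℕ → ℕ)}

theorem le_add_two (h : IsCountSystem C n F) {f : Finset ℕ → ℕ} (hf : f ∈ F) {S : Finset ℕ}
    {a b : ℕ} (hb : b ∈ C) (haS : a ∈ S) (hbS : b ∉ S) :
    f S ≤ f (insert b (S.erase a)) + 2 := by
  by_contra! hlt
  have ha : a ∈ C := (h.support hf (Z := S) (by omega)).1 haS
  rcases h.move hf ha hb haS hbS (by omega) with h' | h'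
  · omega
  · omega

/-- A two-step neighbor of a set of multiplicity three that has multiplicity zero can only be
reached through sets of multiplicity two. -/
theorem eq_two_of_dist_two (h : IsCountSystem C n F) {f : Finset ℕ → ℕ} (hf : f ∈ F)
    {S : Finset ℕ} {a₁ a₂ b₁ b₂ : ℕ} (hS : 3 ≤ f S) (ha₁ : a₁ ∈ S) (ha₂ : a₂ ∈ S) (ha : a₁ ≠ a₂)
    (hb₁ : b₁ ∈ C) (hb₂ : b₂ ∈ C) (hb₁S : b₁ ∉ S) (hb₂S : b₂ ∉ S) (hb : b₁ ≠ b₂)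
    (h0 : f (insert b₂ ((insert b₁ (S.erase a₁)).erase a₂)) = 0) :
    f S = 3 ∧ f (insert b₁ (S.erase a₁)) = 2 := by
  set I := insert b₁ (S.erase a₁) with hI
  set X := insert b₂ (I.erase a₂) with hX
  have ha₂I : a₂ ∈ I := by grind
  have hb₂I : b₂ ∉ I := by grind
  have h1 := h.le_add_two hf hb₁ ha₁ hb₁S
  have h2 := h.le_add_two hf hb₂ ha₂I hb₂I
  rw [← hI] at h1
  rw [← hX] at h2
  have haC : a₁ ∈ C := (h.support hf (Z := S) (by omega)).1 ha₁
  rcases h.move hf haC hb₁ ha₁ hb₁S (by rw [← hI]; omega) with ⟨h3, h4⟩ | ⟨h3, -⟩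
  · rw [← hI] at h3 h4
    have h5 := h.le_add_two h4 hb₂ ha₂I hb₂I
    simp only [Equiv.swap_apply_right] at h5
    rw [← hX, Equiv.swap_apply_of_ne_of_ne] at h5
    · omega
    · intro e
      have : b₂ ∈ X := by grind
      exact hb₂S (e ▸ this)
    · intro e
      have : b₂ ∈ X := by grind
      exact hb₂I (e ▸ this)
  · rw [← hI] at h3
    omega

theorem pos_of_dist_two (h : IsCountSystem C n F) {f : Finset ℕ → ℕ} (hf : f ∈ F)
    {S : Finset ℕ} {a₁ a₂ b₁ b₂ : ℕ} (hS : 3 ≤ f S) (ha₁ : a₁ ∈ S) (ha₂ : a₂ ∈ S) (ha : a₁ ≠ a₂)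
    (hb₁ : b₁ ∈ C) (hb₂ : b₂ ∈ C) (hb₁S : b₁ ∉ S) (hb₂S : b₂ ∉ S) (hb : b₁ ≠ b₂) :
    0 < f (insert b₂ ((insert b₁ (S.erase a₁)).erase a₂)) := by
  by_contra! h0
  rw [Nat.le_zero] at h0
  obtain ⟨h3, h4⟩ := h.eq_two_of_dist_two hf hS ha₁ ha₂ ha hb₁ hb₂ hb₁S hb₂S hb h0
  have hcomm : insert b₂ ((insert b₁ (S.erase a₁)).erase a₂) =
      insert b₁ ((insert b₂ (S.erase a₂)).erase a₁) := by
    ext c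
    simp only [Finset.mem_insert, Finset.mem_erase]
    grind
  obtain ⟨-, h5⟩ := h.eq_two_of_dist_two hf hS ha₂ ha₁ ha.symm hb₂ hb₁ hb₂S hb₁S hb.symm
    (hcomm ▸ h0)
  set I := insert b₁ (S.erase a₁) with hI
  set X := insert b₂ (I.erase a₂) with hX
  have ha₂I : a₂ ∈ I := by grind
  have hb₂I : b₂ ∉ I := by grind
  have haC : a₁ ∈ C := (h.support hf (Z := S) (by omega)).1 ha₁
  rcases h.move hf haC hb₁ ha₁ hb₁S (by rw [← hI]; omega) with ⟨h6, -⟩ | ⟨-, B, -, hBS, hBI, hB, h6⟩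
  · rw [← hI] at h6
    omega
  rw [← hI] at hBI h6
  have h7 := h.le_add_two h6 hb₂ ha₂I hb₂I
  rw [← hX] at h7
  have hXS : X ≠ S := by
    intro e
    have : b₂ ∈ X := by grind
    exact hb₂S (e ▸ this)
  have hXI : X ≠ I := by
    intro e
    have : b₂ ∈ X := by grind
    exact hb₂I (e ▸ this)
  have hXB : X ≠ B := by
    intro e
    rw [← e] at hB
    omega
  have hXB' : X ≠ swapColors a₁ b₁ B := by
    intro e
    rw [← e, h0] at hB
    have : B = insert b₂ (S.erase a₂) := by
      rw [eq_comm, swapColors_eq_iff] at e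
      rw [e, hcomm, ← swapColors_eq_insert_erase (by grind) (by grind), swapColors_swapColors]
    rw [this] at hB
    omega
  have hIB' : I ≠ swapColors a₁ b₁ B := fun e => hBS (insert_erase_inj ha₁ hb₁S e.symm)
  rw [Equiv.swap_apply_of_ne_of_ne hBI.symm hIB', Equiv.swap_apply_right,
    Equiv.swap_apply_of_ne_of_ne hXB hXB', Equiv.swap_apply_of_ne_of_ne hXS hXI] at h7
  omega

end IsCountSystem

theorem two_mul_choose_two (m : ℕ) : 2 * m.choose 2 + m = m * m := by
  rcases m with _ | e
  · rfl
  rw [Nat.choose_two_right]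
  have h2 : 2 ∣ (e + 1) * (e + 1 - 1) := by
    rw [mul_comm, Nat.add_sub_cancel]
    exact (Nat.even_mul_succ_self e).two_dvd
  have := Nat.mul_div_cancel' h2
  rw [this, Nat.add_sub_cancel]
  ring

theorem card_filter_sdiff_eq {C S : Finset ℕ} (hS : S ⊆ C) (j : ℕ) :
    ((C.powersetCard S.card).filter fun Z => (S \ Z).card = j).card =
      S.card.choose j * (C.card - S.card).choose j := by
  rw [← Finset.card_sdiff_of_subset hS, ← Finset.card_powersetCard, ← Finset.card_powersetCard,
    ← Finset.card_product]
  symm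
  apply Finset.card_bij' (fun p _ => (S \ p.1) ∪ p.2) (fun Z _ => (S \ Z, Z \ S))
  · rintro ⟨A, B⟩ h
    simp only [Finset.mem_product, Finset.mem_powersetCard, Finset.mem_filter] at h ⊢
    obtain ⟨⟨hA, hAj⟩, hB, hBj⟩ := h
    have h1 : Disjoint (S \ A) B := by
      rw [Finset.disjoint_left]
      grind
    have h2 : S \ (S \ A ∪ B) = A := by grind
    refine ⟨⟨?_, ?_⟩, ?_⟩
    · grind
    · rw [Finset.card_union_of_disjoint h1, Finset.card_sdiff_of_subset hA]
      have := Finset.card_le_card hA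
      omega
    · rw [h2, hAj]
  · intro Z h
    simp only [Finset.mem_product, Finset.mem_powersetCard, Finset.mem_filter] at h ⊢
    obtain ⟨⟨hZC, hZ⟩, hj⟩ := h
    refine ⟨⟨Finset.sdiff_subset, hj⟩, Finset.sdiff_subset_sdiff hZC subset_rfl, ?_⟩
    rw [← hj]
    exact Finset.card_sdiff_comm hZ
  · rintro ⟨A, B⟩ h
    simp only [Finset.mem_product, Finset.mem_powersetCard] at h ⊢
    obtain ⟨⟨hA, hAj⟩, hB, hBj⟩ := h
    ext c <;> grind
  · intro Z h
    grind

namespace IsCountSystem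

variable {C : Finset ℕ} {n : ℕ} {F : Set (Finset ℕ → ℕ)}

theorem pos_of_card_sdiff_le_two (h : IsCountSystem C n F) {f : Finset ℕ → ℕ} (hf : f ∈ F)
    {S Z : Finset ℕ} (hS : 3 ≤ f S) (hZC : Z ⊆ C) (hc : Z.card = S.card) (hle : (S \ Z).card ≤ 2) :
    0 < f Z := by
  have hc' := Finset.card_sdiff_comm hc
  rcases Nat.lt_or_ge (S \ Z).card 1 with h0 | h0
  · have : Z = S := by
      rw [Nat.lt_one_iff, Finset.card_eq_zero, Finset.sdiff_eq_empty_iff_subset] at h0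
      exact (Finset.eq_of_subset_of_card_le h0 hc.le).symm
    rw [this]
    omega
  rcases Nat.lt_or_ge (S \ Z).card 2 with h1 | h1
  · obtain ⟨a, ha⟩ := Finset.card_eq_one.1 (show (S \ Z).card = 1 by omega)
    obtain ⟨b, hb⟩ := Finset.card_eq_one.1 (show (Z \ S).card = 1 by omega)
    have haS : a ∈ S \ Z := by simp [ha]
    have hbS : b ∈ Z \ S := by simp [hb]
    have : Z = insert b (S.erase a) := by
      ext c
      have h1 : c ∈ S \ Z ↔ c = a := by simp [ha]
      have h2 : c ∈ Z \ S ↔ c = b := by simp [hb]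
      grind
    rw [Finset.mem_sdiff] at haS hbS
    have := h.le_add_two hf (hZC hbS.1) haS.1 hbS.2
    grind
  · obtain ⟨a₁, a₂, hane, ha⟩ := Finset.card_eq_two.1 (show (S \ Z).card = 2 by omega)
    obtain ⟨b₁, b₂, hbne, hb⟩ := Finset.card_eq_two.1 (show (Z \ S).card = 2 by omega)
    have ha₁ : a₁ ∈ S \ Z := by simp [ha]
    have ha₂ : a₂ ∈ S \ Z := by simp [ha]
    have hb₁ : b₁ ∈ Z \ S := by simp [hb]
    have hb₂ : b₂ ∈ Z \ S := by simp [hb]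
    have : Z = insert b₂ ((insert b₁ (S.erase a₁)).erase a₂) := by
      ext c
      have h1 : c ∈ S \ Z ↔ c = a₁ ∨ c = a₂ := by simp [ha]
      have h2 : c ∈ Z \ S ↔ c = b₁ ∨ c = b₂ := by simp [hb]
      grind
    rw [Finset.mem_sdiff] at ha₁ ha₂ hb₁ hb₂
    rw [this]
    exact h.pos_of_dist_two hf hS ha₁.1 ha₂.1 hane (hZC hb₁.1) (hZC hb₂.1) hb₁.2 hb₂.2 hbne

theorem le_two (h : IsCountSystem C n F) (hn : 2 * n ≤ (C.card - 4) ^ 2)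
    {f : Finset ℕ → ℕ} (hf : f ∈ F) (S : Finset ℕ) : f S ≤ 2 := by
  by_contra! hS
  obtain ⟨hSC, hS5⟩ := h.support hf (Z := S) (by omega)
  have hle := Finset.card_le_card hSC
  have hlayer := h.layer hf S.card
  have htotal := h.total hf (C.powersetCard S.card)
  have hlow : ∀ J : Finset ℕ, J ⊆ Finset.range 3 → 0 ∈ J →
      2 + ∑ j ∈ J, S.card.choose j * (C.card - S.card).choose j ≤
        ∑ Z ∈ C.powersetCard S.card, f Z := by
    intro J hJ hJ0
    have hmemS : S ∈ (C.powersetCard S.card).filter fun Z => (S \ Z).card ∈ J := by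
      simp [hSC, hJ0]
    calc 2 + ∑ j ∈ J, S.card.choose j * (C.card - S.card).choose j
        = 2 + ((C.powersetCard S.card).filter fun Z => (S \ Z).card ∈ J).card := by
          rw [Finset.card_eq_sum_card_fiberwise (f := fun Z => (S \ Z).card) (t := J)]
          · congr 1
            apply Finset.sum_congr rfl
            intro j hj
            rw [← card_filter_sdiff_eq hSC, Finset.filter_filter]
            congr 1
            ext Z
            simp only [Finset.mem_filter]
            grind
          · intro Z hZ
            simpa using (Finset.mem_filter.1 hZ).2
      _ ≤ ∑ Z ∈ (C.powersetCard S.card).filter fun Z => (S \ Z).card ∈ J, f Z := by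
          rw [← Finset.add_sum_erase _ _ hmemS, ← Finset.card_erase_add_one hmemS,
            Finset.card_eq_sum_ones]
          have : ∑ Z ∈ ((C.powersetCard S.card).filter fun Z => (S \ Z).card ∈ J).erase S, 1 ≤
              ∑ Z ∈ ((C.powersetCard S.card).filter fun Z => (S \ Z).card ∈ J).erase S, f Z := by
            apply Finset.sum_le_sum
            intro Z hZ
            simp only [Finset.mem_erase, Finset.mem_filter, Finset.mem_powersetCard] at hZ
            have := Finset.mem_range.1 (hJ hZ.2.2)
            exact h.pos_of_card_sdiff_le_two hf (by omega) hZ.2.1.1 hZ.2.1.2 (by omega)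
          omega
      _ ≤ ∑ Z ∈ C.powersetCard S.card, f Z :=
          Finset.sum_le_sum_of_subset (Finset.filter_subset _ _)
  rcases Nat.lt_or_ge (C.card - S.card) 2 with hm | hm
  · have h1 := hlow {0, 1} (by decide) (by decide)
    rw [Finset.sum_pair (by decide)] at h1
    simp only [Nat.choose_zero_right, Nat.choose_one_right] at h1
    interval_cases hm' : C.card - S.card
    · have : C.card = S.card := by omega
      rw [this, Nat.choose_self] at hlayer
      omega
    · have : C.card = S.card + 1 := by omega
      rw [this, Nat.choose_succ_self_right] at hlayer
      omega
  · have h1 := hlow {0, 1, 2} (by decide) (by decide)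
    rw [Finset.sum_insert (by decide), Finset.sum_pair (by decide)] at h1
    simp only [Nat.choose_zero_right, Nat.choose_one_right] at h1
    obtain ⟨m, hm'⟩ : ∃ m, C.card = S.card + m := ⟨C.card - S.card, by omega⟩
    rw [hm', Nat.add_sub_cancel_left] at h1 hm
    rw [hm'] at hn
    generalize S.card = d at *
    have e1 := two_mul_choose_two d
    have e2 := two_mul_choose_two m
    have p1 : 1 ≤ d.choose 2 := Nat.choose_pos (by omega)
    have p2 : 1 ≤ m.choose 2 := Nat.choose_pos hm
    obtain ⟨p, hp⟩ : ∃ p, d.choose 2 = p + 1 := ⟨d.choose 2 - 1, by omega⟩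
    obtain ⟨q, hq⟩ : ∃ q, m.choose 2 = q + 1 := ⟨m.choose 2 - 1, by omega⟩
    obtain ⟨e, rfl⟩ : ∃ e, d = e + 4 := ⟨d - 4, by omega⟩
    have : e + 4 + m - 4 = e + m := by omega
    rw [this] at hn
    rw [hp] at e1 h1
    rw [hq] at e2 h1
    nlinarith [Nat.zero_le (p * q)]

end IsCountSystem

end VertexDistinguishing

namespace VertexDistinguishing

theorem sdiff_swapColors_subset {T B : Finset ℕ} {a b : ℕ} (ha : a ∉ T) :
    T \ swapColors a b B ⊆ insert b (T \ B) := by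
  intro c hc
  rw [Finset.mem_sdiff, mem_swapColors] at hc
  rcases eq_or_ne c b with rfl | hcb
  · simp
  · rw [Equiv.swap_apply_of_ne_of_ne (ne_of_mem_of_not_mem hc.1 ha) hcb] at hc
    simp [hc]

theorem card_sdiff_swapColors_le {T B : Finset ℕ} {a b : ℕ} (ha : a ∉ T) :
    (T \ swapColors a b B).card ≤ (T \ B).card + 1 :=
  (Finset.card_le_card (sdiff_swapColors_subset ha)).trans (Finset.card_insert_le _ _)

theorem mem_of_card_sdiff_lt {T B : Finset ℕ} {a b : ℕ} (ha : a ∉ T)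
    (h : (T \ B).card < (T \ swapColors a b B).card) : b ∈ B := by
  by_contra hb
  refine absurd (Finset.card_le_card ?_) (Nat.not_le.2 h)
  intro c hc
  have hc' := sdiff_swapColors_subset ha hc
  rw [Finset.mem_insert] at hc'
  rcases hc' with rfl | hc'
  · exact Finset.mem_sdiff.2 ⟨(Finset.mem_sdiff.1 hc).1, hb⟩
  · exact hc'

theorem sdiff_swapColors {T B : Finset ℕ} {a b : ℕ} (ha : a ∉ T) (hb : b ∉ T) :
    T \ swapColors a b B = T \ B := by
  ext c
  simp only [Finset.mem_sdiff, mem_swapColors, and_congr_right_iff]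
  intro hc
  rw [Equiv.swap_apply_of_ne_of_ne (ne_of_mem_of_not_mem hc ha) (ne_of_mem_of_not_mem hc hb)]

theorem card_sdiff_insert_erase {T S : Finset ℕ} {a b : ℕ} (ha : a ∉ T) (hb : b ∈ T)
    (hbS : b ∉ S) : (T \ insert b (S.erase a)).card + 1 = (T \ S).card := by
  have : T \ insert b (S.erase a) = (T \ S).erase b := by grind
  rw [this, Finset.card_erase_add_one (Finset.mem_sdiff.2 ⟨hb, hbS⟩)]

/-- The number of elements of `T` missing from the sets of multiplicity two. -/
def defect (C T : Finset ℕ) (f : Finset ℕ → ℕ) : ℕ :=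
  ∑ Z ∈ C.powerset, if f Z = 2 then (T \ Z).card else 0

theorem defect_swap {C T : Finset ℕ} {f : Finset ℕ → ℕ} {P Q : Finset ℕ} (hP : P ⊆ C) (hQ : Q ⊆ C)
    (hPQ : P ≠ Q) (hf : f Q ≠ 2) :
    defect C T (fun Z => f (Equiv.swap P Q Z)) + (if f P = 2 then (T \ P).card else 0) =
      defect C T f + if f P = 2 then (T \ Q).card else 0 := by
  have hP' : P ∈ C.powerset := Finset.mem_powerset.2 hP
  have hQ' : Q ∈ C.powerset.erase P := Finset.mem_erase.2 ⟨hPQ.symm, Finset.mem_powerset.2 hQ⟩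
  unfold defect
  rw [← Finset.add_sum_erase _ _ hP', ← Finset.add_sum_erase _ _ hQ',
    ← Finset.add_sum_erase C.powerset (fun Z => if f Z = 2 then (T \ Z).card else 0) hP',
    ← Finset.add_sum_erase _ (fun Z => if f Z = 2 then (T \ Z).card else 0) hQ']
  rw [Finset.sum_congr rfl (g := fun Z => if f Z = 2 then (T \ Z).card else 0)]
  · simp only [Equiv.swap_apply_left, Equiv.swap_apply_right, if_neg hf]
    omega
  · intro Z hZ
    simp only [Finset.mem_erase] at hZ
    simp only [Equiv.swap_apply_of_ne_of_ne hZ.2.1 hZ.1]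

/-- The members of `F` of minimum defect. -/
def IsMinDefect (C T : Finset ℕ) (F : Set (Finset ℕ → ℕ)) (f : Finset ℕ → ℕ) : Prop :=
  f ∈ F ∧ ∀ g ∈ F, defect C T f ≤ defect C T g

namespace IsCountSystem

variable {C T : Finset ℕ} {n : ℕ} {F : Set (Finset ℕ → ℕ)} {f : Finset ℕ → ℕ} {S : Finset ℕ}
  {a b : ℕ}

theorem defect_of_eq_zero (h : IsCountSystem C n F) (hf : IsMinDefect C T F f) (hS : f S = 2)
    (ha : a ∈ S) (hb : b ∈ C) (hbS : b ∉ S) (h0 : f (insert b (S.erase a)) = 0) :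
    (fun Z => f (Equiv.swap S (insert b (S.erase a)) Z)) ∈ F ∧
      defect C T (fun Z => f (Equiv.swap S (insert b (S.erase a)) Z)) + (T \ S).card =
        defect C T f + (T \ insert b (S.erase a)).card := by
  have hSC := (h.support hf.1 (Z := S) (by omega)).1
  have hS' : insert b (S.erase a) ⊆ C :=
    Finset.insert_subset hb ((Finset.erase_subset _ _).trans hSC)
  rcases h.move hf.1 (hSC ha) hb ha hbS (by omega) with ⟨-, h1⟩ | ⟨h1, -⟩
  · refine ⟨h1, ?_⟩
    have := defect_swap (T := T) hSC hS' (by grind) (f := f) (by omega)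
    rwa [if_pos hS, if_pos hS] at this
  · omega

theorem defect_of_eq_one (h : IsCountSystem C n F) (hf : IsMinDefect C T F f) (hS : f S = 2)
    (ha : a ∈ S) (hb : b ∈ C) (hbS : b ∉ S) (h1 : f (insert b (S.erase a)) = 1)
    (hle : ∀ Z, f Z ≤ 2) :
    ∃ B, ¬ (a ∈ B ↔ b ∈ B) ∧ B ≠ S ∧ B ≠ insert b (S.erase a) ∧
      f B = f (swapColors a b B) + 1 ∧ ∃ g ∈ F,
      (∀ Z, g Z = f (Equiv.swap S (insert b (S.erase a))
        (Equiv.swap B (swapColors a b B) Z))) ∧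
      defect C T g + (T \ S).card + (if f B = 2 then (T \ B).card else 0) =
        defect C T f + (T \ insert b (S.erase a)).card +
          if f B = 2 then (T \ swapColors a b B).card else 0 := by
  have hSC := (h.support hf.1 (Z := S) (by omega)).1
  have hS' : insert b (S.erase a) ⊆ C :=
    Finset.insert_subset hb ((Finset.erase_subset _ _).trans hSC)
  rcases h.move hf.1 (hSC ha) hb ha hbS (by omega) with ⟨h2, -⟩ | ⟨-, B, hB, hBS, hBS', hfB, hF⟩
  · omega
  · refine ⟨B, hB, hBS, hBS', hfB, _, hF, fun _ => rfl, ?_⟩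
    have hBC := (h.support hf.1 (Z := B) (by omega)).1
    have e1 := defect_swap (T := T) hSC hS' (by grind) (f := f) (by omega)
    rw [if_pos hS, if_pos hS] at e1
    have hσS : swapColors a b B ≠ S := by
      rw [Ne, swapColors_eq_iff, swapColors_eq_insert_erase ha hbS]
      exact hBS'
    have hσS' : swapColors a b B ≠ insert b (S.erase a) :=
      fun e => hBS (insert_erase_inj ha hbS e)
    have e2 := defect_swap (T := T) hBC (swapColors_subset (hSC ha) hb hBC)
      (fun e => by rw [← e] at hfB; omega)
      (f := fun Z => f (Equiv.swap S (insert b (S.erase a)) Z)) (by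
        rw [Equiv.swap_apply_of_ne_of_ne hσS hσS']
        have := hle B
        omega)
    simp only [Equiv.swap_apply_of_ne_of_ne hBS hBS'] at e2
    omega

end IsCountSystem

end VertexDistinguishing

namespace VertexDistinguishing
namespace IsCountSystem

variable {C T : Finset ℕ} {n : ℕ} {F : Set (Finset ℕ → ℕ)} {f : Finset ℕ → ℕ} {S : Finset ℕ}
  {a b : ℕ}

theorem pos_of_isMinDefect (h : IsCountSystem C n F) (hT : T ⊆ C) (hf : IsMinDefect C T F f)
    (hS : f S = 2) (ha : a ∈ S) (haT : a ∉ T) (hb : b ∈ T) (hbS : b ∉ S) :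
    0 < f (insert b (S.erase a)) := by
  by_contra! h0
  obtain ⟨h1, h2⟩ := h.defect_of_eq_zero hf hS ha (hT hb) hbS (by omega)
  have h3 := hf.2 _ h1
  have h4 := card_sdiff_insert_erase haT hb hbS
  omega

theorem exists_of_eq_one (h : IsCountSystem C n F) (hT : T ⊆ C) (hf : IsMinDefect C T F f)
    (hS : f S = 2) (ha : a ∈ S) (haT : a ∉ T) (hb : b ∈ T) (hbS : b ∉ S)
    (h1 : f (insert b (S.erase a)) = 1) (hle : ∀ Z, f Z ≤ 2) :
    ∃ g, IsMinDefect C T F g ∧ g (insert b (S.erase a)) = 2 ∧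
      ∃ B, b ∈ B ∧ a ∉ B ∧ f B = 2 ∧ B ≠ insert b (S.erase a) ∧ g (swapColors a b B) = 2 := by
  obtain ⟨B, hB, hBS, hBS', hfB, g, hgF, hg, hD⟩ :=
    h.defect_of_eq_one hf hS ha (hT hb) hbS h1 hle
  have h3 := hf.2 _ hgF
  have h4 := card_sdiff_insert_erase haT hb hbS
  have h5 := card_sdiff_swapColors_le haT (B := B) (b := b)
  have hfB2 : f B = 2 := by
    by_contra hne
    rw [if_neg hne, if_neg hne] at hD
    omega
  rw [if_pos hfB2, if_pos hfB2] at hD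
  have hbB : b ∈ B := mem_of_card_sdiff_lt haT (by omega)
  have hσS' : swapColors a b B ≠ insert b (S.erase a) :=
    fun e => hBS (insert_erase_inj ha hbS e)
  refine ⟨g, ⟨hgF, fun g' hg' => (by omega : defect C T g ≤ defect C T f).trans (hf.2 g' hg')⟩, ?_,
    B, hbB, by tauto, hfB2, hBS', ?_⟩
  · rw [hg, Equiv.swap_apply_of_ne_of_ne hBS'.symm hσS'.symm, Equiv.swap_apply_right, hS]
  · rw [hg, Equiv.swap_apply_right, Equiv.swap_apply_of_ne_of_ne hBS hBS', hfB2]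

theorem exists_card_add_two_le (h : IsCountSystem C n F) (hT : T ⊆ C) (hT3 : T.card = 3)
    (hle : ∀ f ∈ F, ∀ Z, f Z ≤ 2) (hf : IsMinDefect C T F f) (hS : f S = 2) (hTS : ¬ T ⊆ S) :
    ∃ g S', IsMinDefect C T F g ∧ g S' = 2 ∧ ¬ T ⊆ S' ∧ S'.card + 2 ≤ C.card := by
  obtain ⟨hSC, hS5⟩ := h.support hf.1 (Z := S) (by omega)
  rcases Nat.lt_or_ge C.card (S.card + 2) with hlt | hge
  swap
  · exact ⟨f, S, hf, hS, hTS, hge⟩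
  obtain ⟨s, hsT, hsS⟩ := Finset.not_subset.1 hTS
  have hins : insert s S = C := by
    apply Finset.eq_of_subset_of_card_le (Finset.insert_subset (hT hsT) hSC)
    rw [Finset.card_insert_of_notMem hsS]
    omega
  have hcard : C.card = S.card + 1 := by rw [← hins, Finset.card_insert_of_notMem hsS]
  have hmem : ∀ p ∈ C \ T, p ∈ S ∧ p ∉ T := by
    intro p hp
    rw [Finset.mem_sdiff, ← hins, Finset.mem_insert] at hp
    refine ⟨hp.1.resolve_left ?_, hp.2⟩
    rintro rfl
    exact hp.2 hsT
  obtain ⟨p, hp, hp1⟩ : ∃ p ∈ C \ T, f (insert s (S.erase p)) = 1 := by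
    by_contra! hne
    have h2 : ∀ p ∈ C \ T, f (insert s (S.erase p)) = 2 := by
      intro p hp
      have h1 := h.pos_of_isMinDefect hT hf hS (hmem p hp).1 (hmem p hp).2 hsT hsS
      have h2 := hle f hf.1 (insert s (S.erase p))
      have h3 := hne p hp
      omega
    have hlayer := h.layer hf.1 S.card
    rw [hcard, Nat.choose_succ_self_right] at hlayer
    have hinj : Set.InjOn (fun p => insert s (S.erase p)) (C \ T : Finset ℕ) := by
      intro p hp p' hp' e
      have hp1 := (hmem p hp).1
      have hps : p ≠ s := fun e => hsS (e ▸ hp1)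
      by_contra hne
      have h1 : p ∈ insert s (S.erase p') := by simp [hp1, hne]
      have h2 : p ∉ insert s (S.erase p) := by simp [hps]
      exact h2 ((congrArg (p ∈ ·) e).mpr h1)
    have hsum : ∑ Z ∈ insert S ((C \ T).image fun p => insert s (S.erase p)), f Z ≤
        ∑ Z ∈ C.powersetCard S.card, f Z := by
      apply Finset.sum_le_sum_of_subset
      intro Z hZ
      rw [Finset.mem_insert, Finset.mem_image] at hZ
      rw [Finset.mem_powersetCard]
      rcases hZ with rfl | ⟨p, hp, rfl⟩
      · exact ⟨hSC, rfl⟩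
      · refine ⟨Finset.insert_subset (hT hsT) ((Finset.erase_subset _ _).trans hSC), ?_⟩
        rw [Finset.card_insert_of_notMem (fun e => hsS (Finset.mem_of_mem_erase e)),
          Finset.card_erase_add_one (hmem p hp).1]
    rw [Finset.sum_insert, Finset.sum_image hinj, Finset.sum_congr rfl h2, Finset.sum_const,
      Finset.card_sdiff_of_subset hT, smul_eq_mul] at hsum
    · omega
    · simp only [Finset.mem_image, not_exists, not_and]
      rintro p - e
      exact hsS (e ▸ Finset.mem_insert_self _ _)
  obtain ⟨hpS, hpT⟩ := hmem p hp
  obtain ⟨g, hg, -, B, hsB, hpB, hfB, hBS', hgB⟩ :=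
    h.exists_of_eq_one hT hf hS hpS hpT hsT hsS hp1 (hle f hf.1)
  refine ⟨g, _, hg, hgB, fun hsub => ?_, ?_⟩
  · have := hsub hsT
    rw [mem_swapColors, Equiv.swap_apply_right] at this
    exact hpB this
  · rw [card_swapColors]
    by_contra! hlt'
    apply hBS'
    have hBC := (h.support hf.1 (Z := B) (by omega)).1
    have hsub : B ⊆ insert s (S.erase p) := by
      intro c hc
      have h1 := hBC hc
      rw [← hins, Finset.mem_insert] at h1
      rw [Finset.mem_insert, Finset.mem_erase]
      exact h1.imp_right fun h => ⟨fun e => hpB (e ▸ hc), h⟩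
    apply Finset.eq_of_subset_of_card_le hsub
    rw [Finset.card_insert_of_notMem (fun e => hsS (Finset.mem_of_mem_erase e)),
          Finset.card_erase_add_one hpS]
    omega

theorem exists_card_sdiff_eq_one (h : IsCountSystem C n F) (hT : T ⊆ C) (hT3 : T.card = 3)
    (hle : ∀ f ∈ F, ∀ Z, f Z ≤ 2) (hf : IsMinDefect C T F f) (hS : f S = 2) (hTS : ¬ T ⊆ S)
    (hSC : S.card + 2 ≤ C.card) :
    ∃ g S', IsMinDefect C T F g ∧ g S' = 2 ∧ (T \ S').card = 1 ∧ S'.card + 2 ≤ C.card := by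
  obtain ⟨m, hm⟩ : ∃ m, (T \ S).card = m + 1 :=
    Nat.exists_eq_succ_of_ne_zero
      (by rwa [Ne, Finset.card_eq_zero, Finset.sdiff_eq_empty_iff_subset])
  clear hTS
  induction m generalizing f S with
  | zero => exact ⟨f, S, hf, hS, hm, hSC⟩
  | succ m ih =>
    obtain ⟨-, hS5⟩ := h.support hf.1 (Z := S) (by omega)
    obtain ⟨s, hs⟩ : (T \ S).Nonempty := Finset.card_pos.1 (by omega)
    obtain ⟨p, hp, hpT⟩ : ∃ p ∈ S, p ∉ T := Finset.exists_mem_notMem_of_card_lt_card (by omega)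
    rw [Finset.mem_sdiff] at hs
    have hpos := h.pos_of_isMinDefect hT hf hS hp hpT hs.1 hs.2
    have hd := card_sdiff_insert_erase hpT hs.1 hs.2
    have hc : (insert s (S.erase p)).card = S.card := by
      rw [Finset.card_insert_of_notMem (fun e => hs.2 (Finset.mem_of_mem_erase e)),
          Finset.card_erase_add_one hp]
    have h2 := hle f hf.1 (insert s (S.erase p))
    rcases (by omega : f (insert s (S.erase p)) = 1 ∨ f (insert s (S.erase p)) = 2) with h1 | h1
    · obtain ⟨g, hg, hgS, -⟩ := h.exists_of_eq_one hT hf hS hp hpT hs.1 hs.2 h1 (hle f hf.1)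
      exact ih hg hgS (by omega) (by omega)
    · exact ih hf h1 (by omega) (by omega)

/-- Replacing an element outside `T` by another one moves a set of multiplicity two, and fills at
most one other set of multiplicity zero. -/
theorem exists_move (h : IsCountSystem C n F) (hle : ∀ f ∈ F, ∀ Z, f Z ≤ 2)
    (hf : IsMinDefect C T F f) (hS : f S = 2) (ha : a ∈ S) (haT : a ∉ T) (hb : b ∈ C) (hbT : b ∉ T)
    (hbS : b ∉ S) :
    ∃ g, IsMinDefect C T F g ∧ g (insert b (S.erase a)) = 2 ∧
      ∃ Y, ∀ Z, Z ≠ insert b (S.erase a) → (f (insert b (S.erase a)) = 1 → Z ≠ Y) →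
        f Z = 0 → g Z = 0 := by
  have hd : T \ insert b (S.erase a) = T \ S := by
    rw [← swapColors_eq_insert_erase ha hbS, sdiff_swapColors haT hbT]
  have h2 := hle f hf.1 (insert b (S.erase a))
  rcases (by omega : f (insert b (S.erase a)) = 0 ∨ f (insert b (S.erase a)) = 1 ∨
    f (insert b (S.erase a)) = 2) with h1 | h1 | h1
  · obtain ⟨hF, hD⟩ := h.defect_of_eq_zero hf hS ha hb hbS h1
    rw [hd] at hD
    refine ⟨_, ⟨hF, fun g' hg' => ?_⟩, ?_, ∅, fun Z hZ _ hZ0 => ?_⟩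
    · have := hf.2 g' hg'
      omega
    · simpa only [Equiv.swap_apply_right] using hS
    · rcases eq_or_ne Z S with rfl | hZS
      · omega
      · simpa only [Equiv.swap_apply_of_ne_of_ne hZS hZ] using hZ0
  · obtain ⟨B, hB, hBS, hBS', hfB, g, hgF, hg, hD⟩ :=
      h.defect_of_eq_one hf hS ha hb hbS h1 (hle f hf.1)
    rw [hd, sdiff_swapColors haT hbT] at hD
    have hσS' : swapColors a b B ≠ insert b (S.erase a) :=
      fun e => hBS (insert_erase_inj ha hbS e)
    refine ⟨g, ⟨hgF, fun g' hg' => ?_⟩, ?_, swapColors a b B, fun Z hZ hZY hZ0 => ?_⟩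
    · have := hf.2 g' hg'
      omega
    · rw [hg, Equiv.swap_apply_of_ne_of_ne hBS'.symm hσS'.symm, Equiv.swap_apply_right, hS]
    · rw [hg, Equiv.swap_apply_of_ne_of_ne _ (hZY h1), Equiv.swap_apply_of_ne_of_ne _ hZ, hZ0]
      · rintro rfl
        omega
      · rintro rfl
        omega
  · exact ⟨f, hf, h1, ∅, fun Z _ _ hZ0 => hZ0⟩

end IsCountSystem
end VertexDistinguishing

namespace VertexDistinguishing
namespace IsCountSystem

variable {C T U : Finset ℕ} {n : ℕ} {F : Set (Finset ℕ → ℕ)} {f : Finset ℕ → ℕ} {s : ℕ}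

theorem pos_union_erase (h : IsCountSystem C n F) (hT : T ⊆ C) (hs : s ∈ T) (hU : U ⊆ C \ T)
    (hf : IsMinDefect C T F f) (hfU : f (T.erase s ∪ U) = 2) {p : ℕ} (hp : p ∈ U) :
    0 < f (T ∪ U.erase p) := by
  have hpT := Finset.mem_sdiff.1 (hU hp)
  have hsU : s ∉ U := fun e => (Finset.mem_sdiff.1 (hU e)).2 hs
  have := h.pos_of_isMinDefect hT hf hfU (a := p) (b := s) (by simp [hp]) hpT.2 hs (by simp [hsU])
  rwa [show insert s ((T.erase s ∪ U).erase p) = T ∪ U.erase p by grind] at this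

theorem exists_move_union (h : IsCountSystem C n F) (hU : U ⊆ C \ T)
    (hle : ∀ f ∈ F, ∀ Z, f Z ≤ 2) (hf : IsMinDefect C T F f) (hfU : f (T.erase s ∪ U) = 2)
    {r x : ℕ} (hr : r ∈ U) (hx : x ∈ C \ T) (hxU : x ∉ U) :
    ∃ g, IsMinDefect C T F g ∧ g (T.erase s ∪ insert x (U.erase r)) = 2 ∧
      ∃ Y, ∀ Z, Z ≠ T.erase s ∪ insert x (U.erase r) →
        (f (T.erase s ∪ insert x (U.erase r)) = 1 → Z ≠ Y) → f Z = 0 → g Z = 0 := by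
  have hrT := Finset.mem_sdiff.1 (hU hr)
  rw [Finset.mem_sdiff] at hx
  have := h.exists_move hle hf hfU (a := r) (b := x) (by simp [hr]) hrT.2 hx.1 hx.2
    (by simp [hx.2, hxU])
  rwa [show insert x ((T.erase s ∪ U).erase r) = T.erase s ∪ insert x (U.erase r) by grind] at this

theorem pos_of_replace (h : IsCountSystem C n F) (hT : T ⊆ C) (hs : s ∈ T) (hU : U ⊆ C \ T)
    (hle : ∀ f ∈ F, ∀ Z, f Z ≤ 2) (hf : IsMinDefect C T F f) (hfU : f (T.erase s ∪ U) = 2)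
    {r x p : ℕ} (hr : r ∈ U) (hx : x ∈ C \ T) (hxU : x ∉ U)
    (h0 : f (T.erase s ∪ insert x (U.erase r)) = 0) (hp : p ∈ insert x (U.erase r)) :
    0 < f (T ∪ (insert x (U.erase r)).erase p) := by
  by_contra! hn
  obtain ⟨g, hg, hg2, Y, hY⟩ := h.exists_move_union hU hle hf hfU hr hx hxU
  have hU' : insert x (U.erase r) ⊆ C \ T :=
    Finset.insert_subset hx ((Finset.erase_subset _ _).trans hU)
  have := h.pos_union_erase hT hs hU' hg hg2 hp
  rw [hY _ _ (by omega) (by omega)] at this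
  · omega
  · intro e
    have h1 : s ∈ T.erase s ∪ insert x (U.erase r) := e ▸ Finset.mem_union_left _ hs
    rw [Finset.mem_union] at h1
    rcases h1 with h1 | h1
    · simp at h1
    · exact (Finset.mem_sdiff.1 (hU' h1)).2 hs

theorem card_le_level_one (h : IsCountSystem C n F) (hT : T ⊆ C) (hs : s ∈ T) (hU : U ⊆ C \ T)
    (hle : ∀ f ∈ F, ∀ Z, f Z ≤ 2) (hf : IsMinDefect C T F f) (hfU : f (T.erase s ∪ U) = 2)
    {x : ℕ} (hx : x ∈ C \ T) (hxU : x ∉ U) :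
    (U.powersetCard 2).card ≤ ∑ A ∈ U.powersetCard 2, f (T ∪ insert x (U \ A)) +
      ∑ r ∈ U, f (T.erase s ∪ insert x (U.erase r)) := by
  have key : ∀ r ∈ U, ∃ Y, ∀ A ∈ U.powersetCard 2, r ∈ A → f (T ∪ insert x (U \ A)) = 0 →
      f (T.erase s ∪ insert x (U.erase r)) = 1 ∧ T ∪ insert x (U \ A) = Y := by
    intro r hr
    obtain ⟨g, hg, hg2, Y, hY⟩ := h.exists_move_union hU hle hf hfU hr hx hxU
    refine ⟨Y, fun A hA hrA h0 => ?_⟩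
    rw [Finset.mem_powersetCard] at hA
    obtain ⟨r', hr'⟩ := Finset.card_eq_one.1
      (show (A.erase r).card = 1 by rw [Finset.card_erase_of_mem hrA, hA.2])
    have hU' : insert x (U.erase r) ⊆ C \ T :=
      Finset.insert_subset hx ((Finset.erase_subset _ _).trans hU)
    have hr'A : r' ∈ A.erase r := by simp [hr']
    rw [Finset.mem_erase] at hr'A
    have hr'U : r' ∈ U := hA.1 hr'A.2
    have h1 := h.pos_union_erase hT hs hU' hg hg2 (p := r') (by simp [hr'U, hr'A.1])
    have h2 : (insert x (U.erase r)).erase r' = insert x (U \ A) := by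
      have hAe : A = {r, r'} := by rw [← Finset.insert_erase hrA, hr']
      subst hAe
      grind
    rw [h2] at h1
    by_contra hn
    rw [hY _ _ _ h0] at h1
    · omega
    · intro e
      have h1 : s ∈ T.erase s ∪ insert x (U.erase r) := e ▸ Finset.mem_union_left _ hs
      rw [Finset.mem_union] at h1
      rcases h1 with h1 | h1
      · simp at h1
      · exact (Finset.mem_sdiff.1 (hU' h1)).2 hs
    · tauto
  have hcard : ((U.powersetCard 2).filter fun A => f (T ∪ insert x (U \ A)) = 0).card ≤
      (U.filter fun r => f (T.erase s ∪ insert x (U.erase r)) = 1).card := by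
    apply Finset.card_le_card_of_forall_subsingleton (fun A r => r ∈ A)
    · intro A hA
      rw [Finset.mem_filter] at hA
      have hA' := Finset.mem_powersetCard.1 hA.1
      obtain ⟨r, hr⟩ : A.Nonempty := Finset.card_pos.1 (by omega)
      obtain ⟨Y, hY⟩ := key r (hA'.1 hr)
      exact ⟨r, Finset.mem_filter.2 ⟨hA'.1 hr, (hY A hA.1 hr hA.2).1⟩, hr⟩
    · intro r hr A hA B hB
      rw [Finset.mem_filter] at hr
      obtain ⟨Y, hY⟩ := key r hr.1
      simp only [Set.mem_ofPred_eq, Finset.mem_filter] at hA hB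
      have e := (hY A hA.1.1 hA.2 hA.1.2).2.trans (hY B hB.1.1 hB.2 hB.1.2).2.symm
      have hA' := (Finset.mem_powersetCard.1 hA.1.1).1
      have hB' := (Finset.mem_powersetCard.1 hB.1.1).1
      have hUT : ∀ c ∈ U, c ∉ T ∧ c ≠ x := fun c hc =>
        ⟨(Finset.mem_sdiff.1 (hU hc)).2, fun e => hxU (e ▸ hc)⟩
      have hiff : ∀ c ∈ U, c ∉ A ↔ c ∉ B := by
        intro c hc
        have := congrArg (c ∈ ·) e
        simpa [hUT c hc, hc] using this
      ext c
      constructor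
      · intro hc
        by_contra hn
        exact (hiff c (hA' hc)).2 hn hc
      · intro hc
        by_contra hn
        exact (hiff c (hB' hc)).1 hn hc
  have h1 : ((U.powersetCard 2).filter fun A => ¬ f (T ∪ insert x (U \ A)) = 0).card ≤
      ∑ A ∈ U.powersetCard 2, f (T ∪ insert x (U \ A)) := by
    rw [Finset.card_filter]
    apply Finset.sum_le_sum
    intro A _
    split_ifs <;> omega
  have h2 : (U.filter fun r => f (T.erase s ∪ insert x (U.erase r)) = 1).card ≤
      ∑ r ∈ U, f (T.erase s ∪ insert x (U.erase r)) := by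
    rw [Finset.card_filter]
    apply Finset.sum_le_sum
    intro A _
    split_ifs <;> omega
  rw [← Finset.card_filter_add_card_filter_not fun A => f (T ∪ insert x (U \ A)) = 0]
  omega

end IsCountSystem
end VertexDistinguishing

namespace VertexDistinguishing
namespace IsCountSystem

variable {C T U : Finset ℕ} {n : ℕ} {F : Set (Finset ℕ → ℕ)} {f : Finset ℕ → ℕ} {s : ℕ}

theorem eq_of_hole (h : IsCountSystem C n F) (hT : T ⊆ C) (hs : s ∈ T) (hU : U ⊆ C \ T)
    (hle : ∀ f ∈ F, ∀ Z, f Z ≤ 2) {U₀ : Finset ℕ} (hU₀ : U₀ ⊆ U) (hU₀3 : U₀.card = 3)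
    {g : Finset ℕ → ℕ} {Yf : Finset ℕ} {r x x' p : ℕ} (hr : r ∈ U₀) (hx : x ∈ (C \ T) \ U)
    (hx' : x' ∈ (C \ T) \ U) (hxx' : x ≠ x')
    (hg : IsMinDefect C T F g) (hg2 : g (T.erase s ∪ insert x (U.erase r)) = 2)
    (hY : ∀ Z, Z ≠ T.erase s ∪ insert x (U.erase r) → Z ≠ Yf → f Z = 0 → g Z = 0)
    (hp : p ∈ U₀) (hpr : p ≠ r) (h1 : f (T ∪ ((U \ U₀) ∪ {x, x'})) = 0)
    (h2 : f (T.erase s ∪ insert p ((U \ U₀) ∪ {x, x'})) = 0) :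
    x' ∈ Yf ∧ Yf ⊆ T ∪ U ∪ {x, x'} := by
  obtain ⟨t, ht⟩ : ((U₀.erase r).erase p).Nonempty := by
    rw [← Finset.card_pos, Finset.card_erase_of_mem (by simp [hp, hpr]),
      Finset.card_erase_of_mem hr]
    omega
  have hU₀eq : U₀ = {r, p, t} := by
    symm
    apply Finset.eq_of_subset_of_card_le
    · grind
    · rw [hU₀3, Finset.card_eq_three.2 ⟨r, p, t, by grind, by grind, by grind, rfl⟩]
  have hxm := Finset.mem_sdiff.1 hx
  have hxm' := Finset.mem_sdiff.1 hx'
  have hU1 : insert x (U.erase r) ⊆ C \ T :=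
    Finset.insert_subset hxm.1 ((Finset.erase_subset _ _).trans hU)
  have hrU := hU₀ hr
  have hpU := hU₀ hp
  have htU : t ∈ U := hU₀ (by grind)
  have hUT : ∀ c ∈ U, c ∉ T := fun c hc => (Finset.mem_sdiff.1 (hU hc)).2
  have hxT := (Finset.mem_sdiff.1 hxm.1).2
  have hxT' := (Finset.mem_sdiff.1 hxm'.1).2
  have hrpt : r ≠ t ∧ p ≠ t := by grind
  have e1 : insert x' ((insert x (U.erase r)).erase t) = insert p ((U \ U₀) ∪ {x, x'}) := by
    subst hU₀eq
    ext c
    simp only [Finset.mem_insert, Finset.mem_erase, Finset.mem_union, Finset.mem_sdiff,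
      Finset.mem_singleton]
    grind
  have e2 : (insert p ((U \ U₀) ∪ {x, x'})).erase p = (U \ U₀) ∪ {x, x'} := by
    apply Finset.erase_insert
    grind
  by_contra hn
  have hne : ∀ Z, x' ∈ Z → Z ≠ T.erase s ∪ insert x (U.erase r) := by
    rintro Z hZ rfl
    grind
  have hz1 : g (T ∪ ((U \ U₀) ∪ {x, x'})) = 0 := by
    refine hY _ (hne _ (by simp)) ?_ h1
    rintro rfl
    refine hn ⟨by simp, ?_⟩
    grind
  have hz2 : g (T.erase s ∪ insert p ((U \ U₀) ∪ {x, x'})) = 0 := by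
    refine hY _ (hne _ (by simp)) ?_ h2
    rintro rfl
    refine hn ⟨by simp, ?_⟩
    grind
  have := h.pos_of_replace hT hs hU1 hle hg hg2 (r := t) (x := x') (p := p)
    (by grind) hxm'.1 (by grind) (by rwa [e1]) (by rw [e1]; simp)
  rw [e1, e2] at this
  omega

theorem card_le_level_two (h : IsCountSystem C n F) (hT : T ⊆ C) (hs : s ∈ T) (hU : U ⊆ C \ T)
    (hle : ∀ f ∈ F, ∀ Z, f Z ≤ 2) (hf : IsMinDefect C T F f) (hfU : f (T.erase s ∪ U) = 2)
    {U₀ : Finset ℕ} (hU₀ : U₀ ⊆ U) (hU₀3 : U₀.card = 3) :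
    ∃ m, m * 2 ≤ ((C \ T) \ U).card ∧ (((C \ T) \ U).powersetCard 2).card ≤ m +
      ∑ Y ∈ ((C \ T) \ U).powersetCard 2, (f (T ∪ ((U \ U₀) ∪ Y)) +
        ∑ p ∈ U₀, f (T.erase s ∪ insert p ((U \ U₀) ∪ Y))) := by
  set Q := (C \ T) \ U with hQ
  set H := (Q.powersetCard 2).filter fun Y => f (T ∪ ((U \ U₀) ∪ Y)) = 0 ∧
    ∃ p ∈ U₀, f (T.erase s ∪ insert p ((U \ U₀) ∪ Y)) = 0 with hH
  refine ⟨H.card, ?_, ?_⟩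
  · have hdisj : (H : Set (Finset ℕ)).PairwiseDisjoint id := by
      intro Y hY Y' hY' hne
      rw [Function.onFun, id, id, Finset.disjoint_left]
      intro x hxY hxY'
      simp only [hH, Finset.coe_filter, Finset.mem_powersetCard, Set.mem_ofPred_eq] at hY hY'
      obtain ⟨⟨hYQ, hY2⟩, hY0, p, hp, hYp⟩ := hY
      obtain ⟨⟨hYQ', hY2'⟩, hY0', p', hp', hYp'⟩ := hY'
      obtain ⟨y, hy⟩ := Finset.card_eq_one.1
        (show (Y.erase x).card = 1 by rw [Finset.card_erase_of_mem hxY, hY2])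
      obtain ⟨y', hy'⟩ := Finset.card_eq_one.1
        (show (Y'.erase x).card = 1 by rw [Finset.card_erase_of_mem hxY', hY2'])
      have hYe : Y = {x, y} := by rw [← hy, Finset.insert_erase hxY]
      have hYe' : Y' = {x, y'} := by rw [← hy', Finset.insert_erase hxY']
      have hxy : y ≠ x := Finset.ne_of_mem_erase (by rw [hy]; simp : y ∈ Y.erase x)
      have hxy' : y' ≠ x := Finset.ne_of_mem_erase (by rw [hy']; simp : y' ∈ Y'.erase x)
      have hyy' : y ≠ y' := by
        rintro rfl
        exact hne (hYe.trans hYe'.symm)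
      subst hYe hYe'
      obtain ⟨r, hr, hrp⟩ := Finset.exists_mem_notMem_of_card_lt_card
        (show ({p, p'} : Finset ℕ).card < U₀.card from
          lt_of_le_of_lt Finset.card_le_two (by omega))
      simp only [Finset.mem_insert, Finset.mem_singleton, not_or] at hrp
      have hxQ : x ∈ Q := hYQ hxY
      have hyQ : y ∈ Q := hYQ (by simp)
      have hyQ' : y' ∈ Q := hYQ' (by simp)
      have hxm := Finset.mem_sdiff.1 hxQ
      obtain ⟨g, hg, hg2, Yf, hYf⟩ := h.exists_move_union hU hle hf hfU (hU₀ hr) hxm.1 hxm.2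
      have hYf' := fun Z hZ hZf => hYf Z hZ (fun _ => hZf)
      have a1 := h.eq_of_hole hT hs hU hle hU₀ hU₀3 hr hxQ hyQ hxy.symm hg hg2 hYf' hp
        (Ne.symm hrp.1) hY0 hYp
      have a2 := h.eq_of_hole hT hs hU hle hU₀ hU₀3 hr hxQ hyQ' hxy'.symm hg hg2 hYf' hp'
        (Ne.symm hrp.2) hY0' hYp'
      have a3 := a2.2 a1.1
      grind
    have hcard := Finset.card_biUnion hdisj
    rw [Finset.sum_congr rfl (g := fun _ => 2), Finset.sum_const, smul_eq_mul] at hcard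
    · rw [← hcard]
      apply Finset.card_le_card
      rw [Finset.biUnion_subset]
      intro Y hY
      exact (Finset.mem_powersetCard.1 (Finset.mem_filter.1 hY).1).1
    · intro Y hY
      exact (Finset.mem_powersetCard.1 (Finset.mem_filter.1 hY).1).2
  · rw [← Finset.card_filter_add_card_filter_not fun Y => f (T ∪ ((U \ U₀) ∪ Y)) = 0 ∧
      ∃ p ∈ U₀, f (T.erase s ∪ insert p ((U \ U₀) ∪ Y)) = 0, ← hH]
    gcongr
    rw [Finset.card_filter]
    apply Finset.sum_le_sum
    intro Y hY
    split_ifs with hc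
    · exact Nat.zero_le _
    · by_contra! hlt
      rw [Nat.lt_one_iff, Nat.add_eq_zero_iff, Finset.sum_eq_zero_iff] at hlt
      obtain ⟨p, hp⟩ : U₀.Nonempty := Finset.card_pos.1 (by omega)
      exact hc ⟨hlt.1, p, hp, hlt.2 p hp⟩

end IsCountSystem
end VertexDistinguishing

namespace VertexDistinguishing

theorem sum_le_sum_filter_of_injOn {ι : Type*} {K : Finset (Finset ℕ)} {f key : Finset ℕ → ℕ}
    (I : Finset ι) (e : ι → Finset ℕ) (κ : ℕ) (he : Set.InjOn e I) (hK : ∀ i ∈ I, e i ∈ K)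
    (hκ : ∀ i ∈ I, key (e i) = κ) :
    ∑ i ∈ I, f (e i) ≤ ∑ Z ∈ K.filter fun Z => key Z = κ, f Z := by
  classical
  rw [← Finset.sum_image (f := f) he]
  apply Finset.sum_le_sum_of_subset
  intro Z hZ
  obtain ⟨i, hi, rfl⟩ := Finset.mem_image.1 hZ
  exact Finset.mem_filter.2 ⟨hK i hi, hκ i hi⟩

theorem union_union_inter {A J W Q : Finset ℕ} (hA : Disjoint A Q) (hJ : Disjoint J Q)
    (hW : W ⊆ Q) : (A ∪ (J ∪ W)) ∩ Q = W := by
  rw [Finset.union_inter_distrib_right, Finset.union_inter_distrib_right,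
    Finset.disjoint_iff_inter_eq_empty.1 hA, Finset.disjoint_iff_inter_eq_empty.1 hJ,
    Finset.inter_eq_left.2 hW, Finset.empty_union, Finset.empty_union]

namespace IsCountSystem

variable {C T U : Finset ℕ} {n : ℕ} {F : Set (Finset ℕ → ℕ)} {f : Finset ℕ → ℕ} {s : ℕ}

set_option maxHeartbeats 1000000 in
theorem count_le (h : IsCountSystem C n F) (hT : T ⊆ C) (hs : s ∈ T) (hU : U ⊆ C \ T)
    (hle : ∀ f ∈ F, ∀ Z, f Z ≤ 2) (hf : IsMinDefect C T F f) (hfU : f (T.erase s ∪ U) = 2)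
    (hU3 : 3 ≤ U.card) :
    ∃ m, m * 2 ≤ ((C \ T) \ U).card ∧
      2 + U.card + ((C \ T) \ U).card * U.card.choose 2 + ((C \ T) \ U).card.choose 2 ≤ n + m := by
  obtain ⟨U₀, hU₀, hU₀3⟩ := Finset.exists_subset_card_eq hU3
  obtain ⟨m, hm, hm2⟩ := h.card_le_level_two hT hs hU hle hf hfU hU₀ hU₀3
  have hm1 := fun x (hx : x ∈ (C \ T) \ U) => h.card_le_level_one hT hs hU hle hf hfU
    (Finset.mem_sdiff.1 hx).1 (Finset.mem_sdiff.1 hx).2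
  have hm0 : ∀ p ∈ U, 1 ≤ f (T ∪ U.erase p) := fun p hp => h.pos_union_erase hT hs hU hf hfU hp
  refine ⟨m, hm, ?_⟩
  set Q := (C \ T) \ U with hQ
  have hm1' := Finset.sum_le_sum hm1
  have hm0' := Finset.sum_le_sum hm0
  simp only [Finset.sum_const, Finset.card_powersetCard, smul_eq_mul, mul_one,
    Finset.sum_add_distrib] at hm1' hm0' hm2
  rw [← Finset.sum_product', ← Finset.sum_product'] at hm1'
  rw [← Finset.sum_product'] at hm2
  have hUT : ∀ c ∈ U, c ∉ T := fun c hc => (Finset.mem_sdiff.1 (hU hc)).2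
  have hUC : U ⊆ C := hU.trans Finset.sdiff_subset
  have hQT : ∀ c ∈ Q, c ∉ T ∧ c ∉ U := fun c hc =>
    ⟨(Finset.mem_sdiff.1 (Finset.mem_sdiff.1 hc).1).2, (Finset.mem_sdiff.1 hc).2⟩
  have hQC : Q ⊆ C := Finset.sdiff_subset.trans Finset.sdiff_subset
  have hsQ : s ∉ Q := fun e => (hQT s e).1 hs
  have hsU : s ∉ U := fun e => hUT s e hs
  have hTe : T.erase s ⊆ C := (Finset.erase_subset _ _).trans hT
  have hTQ : Disjoint T Q := Finset.disjoint_right.2 fun c hc => (hQT c hc).1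
  set key : Finset ℕ → ℕ := fun Z => 2 * (Z ∩ Q).card + if s ∈ Z then 1 else 0 with hkey
  have keyI : ∀ J W, W ⊆ Q → Disjoint J Q → key (T ∪ (J ∪ W)) = 2 * W.card + 1 := by
    intro J W hW hJ
    change 2 * ((T ∪ (J ∪ W)) ∩ Q).card + (if s ∈ T ∪ (J ∪ W) then 1 else 0) = _
    rw [if_pos (by simp [hs])]
    rw [union_union_inter hTQ hJ hW]
  have keyO : ∀ J W, W ⊆ Q → Disjoint J Q → s ∉ J → key (T.erase s ∪ (J ∪ W)) = 2 * W.card := by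
    intro J W hW hJ hsJ
    have hsJW : s ∉ T.erase s ∪ (J ∪ W) := by
      simp only [Finset.mem_union, Finset.mem_erase, ne_eq, not_true_eq_false, false_and, false_or,
        not_or]
      exact ⟨hsJ, fun e => hsQ (hW e)⟩
    change 2 * ((T.erase s ∪ (J ∪ W)) ∩ Q).card + (if s ∈ T.erase s ∪ (J ∪ W) then 1 else 0) = _
    rw [if_neg hsJW, add_zero,
      union_union_inter (hTQ.mono_left (Finset.erase_subset _ _)) hJ hW]
  clear_value key
  have hdisj : ∀ J ⊆ U, Disjoint J Q := fun J hJ => by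
    rw [Finset.disjoint_left]
    exact fun c hc hcQ => (hQT c hcQ).2 (hJ hc)
  have l0 := sum_le_sum_filter_of_injOn (K := C.powerset) (f := f) (key := key) {U}
    (fun J => T.erase s ∪ J) 0 (by simp) (by
      simpa using Finset.union_subset hTe hUC) (by
      simpa using keyO U ∅ (by simp) (hdisj _ subset_rfl) hsU)
  have l1 := sum_le_sum_filter_of_injOn (K := C.powerset) (f := f) (key := key) U
    (fun p => T ∪ U.erase p) 1 (by
      intro p hp p' hp' e
      dsimp only at e
      by_contra hne
      have h1 : p ∈ T ∪ U.erase p := by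
        rw [e]
        exact Finset.mem_union_right _ (Finset.mem_erase.2 ⟨hne, hp⟩)
      simp [hUT p hp] at h1) (by
      intro p hp
      exact Finset.mem_powerset.2 (Finset.union_subset hT ((Finset.erase_subset _ _).trans hUC))) (by
      intro p hp
      simpa using keyI (U.erase p) ∅ (by simp) (hdisj _ (Finset.erase_subset _ _)))
  have l3 := sum_le_sum_filter_of_injOn (K := C.powerset) (f := f) (key := key)
    (Q ×ˢ U.powersetCard 2) (fun z => T ∪ insert z.1 (U \ z.2)) 3 (by
      rintro ⟨x, A⟩ hz ⟨x', A'⟩ hz' e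
      simp only [Finset.coe_product, Set.mem_prod, Finset.mem_coe,
        Finset.mem_powersetCard] at hz hz'
      dsimp only at e
      have hx : x ∈ T ∪ insert x' (U \ A') := e ▸ (by simp)
      obtain rfl : x = x' := by grind
      rw [Prod.mk.injEq]
      refine ⟨rfl, ?_⟩
      ext c
      have := congrArg (c ∈ ·) e
      simp only [Finset.mem_union, Finset.mem_insert, Finset.mem_sdiff, eq_iff_iff] at this
      grind) (by
      rintro ⟨x, A⟩ hz
      simp only [Finset.mem_product] at hz
      exact Finset.mem_powerset.2 (Finset.union_subset hT (Finset.insert_subset (hQC hz.1)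
        (Finset.sdiff_subset.trans hUC)))) (by
      rintro ⟨x, A⟩ hz
      simp only [Finset.mem_product] at hz
      have := keyI (U \ A) {x} (by simpa using hz.1) (hdisj _ Finset.sdiff_subset)
      rwa [Finset.union_comm (U \ A), ← Finset.insert_eq] at this)
  have l2 := sum_le_sum_filter_of_injOn (K := C.powerset) (f := f) (key := key)
    (Q ×ˢ U) (fun z => T.erase s ∪ insert z.1 (U.erase z.2)) 2 (by
      rintro ⟨x, r⟩ hz ⟨x', r'⟩ hz' e
      simp only [Finset.coe_product, Set.mem_prod, Finset.mem_coe] at hz hz'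
      dsimp only at e
      have hx : x ∈ T.erase s ∪ insert x' (U.erase r') := e ▸ (by simp)
      obtain rfl : x = x' := by grind
      rw [Prod.mk.injEq]
      refine ⟨rfl, ?_⟩
      have := congrArg (r ∈ ·) e
      simp only [Finset.mem_union, Finset.mem_insert, Finset.mem_erase, eq_iff_iff] at this
      grind) (by
      rintro ⟨x, r⟩ hz
      simp only [Finset.mem_product] at hz
      exact Finset.mem_powerset.2 (Finset.union_subset hTe (Finset.insert_subset (hQC hz.1)
        ((Finset.erase_subset _ _).trans hUC)))) (by
      rintro ⟨x, r⟩ hz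
      simp only [Finset.mem_product] at hz
      have := keyO (U.erase r) {x} (by simpa using hz.1) (hdisj _ (Finset.erase_subset _ _))
        (fun e => hsU (Finset.mem_of_mem_erase e))
      rwa [Finset.union_comm (U.erase r), ← Finset.insert_eq] at this)
  have l5 := sum_le_sum_filter_of_injOn (K := C.powerset) (f := f) (key := key)
    (Q.powersetCard 2) (fun Y => T ∪ ((U \ U₀) ∪ Y)) 5 (by
      intro Y hY Y' hY' e
      simp only [Finset.mem_coe, Finset.mem_powersetCard] at hY hY'
      dsimp only at e
      ext c
      have := congrArg (c ∈ ·) e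
      simp only [Finset.mem_union, Finset.mem_sdiff, eq_iff_iff] at this
      grind) (by
      intro Y hY
      rw [Finset.mem_powersetCard] at hY
      exact Finset.mem_powerset.2 (Finset.union_subset hT (Finset.union_subset
        (Finset.sdiff_subset.trans hUC) (hY.1.trans hQC)))) (by
      intro Y hY
      rw [Finset.mem_powersetCard] at hY
      rw [keyI _ _ hY.1 (hdisj _ Finset.sdiff_subset), hY.2])
  have l4 := sum_le_sum_filter_of_injOn (K := C.powerset) (f := f) (key := key)
    (Q.powersetCard 2 ×ˢ U₀) (fun z => T.erase s ∪ insert z.2 ((U \ U₀) ∪ z.1)) 4 (by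
      rintro ⟨Y, p⟩ hz ⟨Y', p'⟩ hz' e
      simp only [Finset.coe_product, Set.mem_prod, Finset.mem_coe,
        Finset.mem_powersetCard] at hz hz'
      dsimp only at e
      have hp : p ∈ T.erase s ∪ insert p' ((U \ U₀) ∪ Y') := e ▸ (by simp)
      obtain rfl : p = p' := by grind
      rw [Prod.mk.injEq]
      refine ⟨?_, rfl⟩
      ext c
      have := congrArg (c ∈ ·) e
      simp only [Finset.mem_union, Finset.mem_insert, Finset.mem_sdiff, Finset.mem_erase,
        eq_iff_iff] at this
      grind) (by
      rintro ⟨Y, p⟩ hz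
      simp only [Finset.mem_product, Finset.mem_powersetCard] at hz
      exact Finset.mem_powerset.2 (Finset.union_subset hTe (Finset.insert_subset
        (hUC (hU₀ hz.2)) (Finset.union_subset
        (Finset.sdiff_subset.trans hUC) (hz.1.1.trans hQC))))) (by
      rintro ⟨Y, p⟩ hz
      simp only [Finset.mem_product, Finset.mem_powersetCard] at hz
      have := keyO (insert p (U \ U₀)) Y hz.1.1
        (hdisj _ (Finset.insert_subset (hU₀ hz.2) Finset.sdiff_subset)) (by grind)
      rwa [hz.1.2, Finset.insert_union] at this)
  have htot := h.total hf.1 (C.powerset.filter fun Z => key Z ∈ Finset.range 6)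
  rw [← Finset.sum_fiberwise_of_maps_to (g := key) (t := Finset.range 6)
    (fun Z hZ => (Finset.mem_filter.1 hZ).2)] at htot
  have hfib : ∀ κ ∈ Finset.range 6,
      ∑ Z ∈ (C.powerset.filter fun Z => key Z ∈ Finset.range 6).filter (fun Z => key Z = κ), f Z =
        ∑ Z ∈ C.powerset.filter (fun Z => key Z = κ), f Z := by
    intro κ hκ
    rw [Finset.filter_filter]
    apply Finset.sum_congr _ (fun _ _ => rfl)
    apply Finset.filter_congr
    grind
  rw [Finset.sum_congr rfl hfib] at htot
  simp only [Finset.sum_range_succ, Finset.sum_range_zero, zero_add] at htot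
  rw [Finset.sum_singleton, hfU] at l0
  omega

theorem exists_forall_subset (h : IsCountSystem C n F) (hF : F.Nonempty) (hT : T ⊆ C)
    (hT3 : T.card = 3) (hn : 2 * n ≤ (C.card - 4) ^ 2) :
    ∃ f ∈ F, ∀ Z, f Z ≤ 2 ∧ (f Z = 2 → T ⊆ Z) := by
  have hle : ∀ f ∈ F, ∀ Z, f Z ≤ 2 := fun f hf => h.le_two hn hf
  obtain ⟨f₀, hf₀⟩ := hF
  obtain ⟨f, hf, hmin⟩ := exists_forall_le_of_exists (· ∈ F) (defect C T) ⟨f₀, hf₀⟩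
  have hgood : IsMinDefect C T F f := ⟨hf, hmin⟩
  refine ⟨f, hf, fun Z => ⟨hle f hf Z, fun hZ => ?_⟩⟩
  by_contra hTZ
  obtain ⟨f₁, S₁, hf₁, hS₁, hTS₁, hc₁⟩ := h.exists_card_add_two_le hT hT3 hle hgood hZ hTZ
  obtain ⟨g, S, hg, hgS, hdS, hcS⟩ := h.exists_card_sdiff_eq_one hT hT3 hle hf₁ hS₁ hTS₁ hc₁
  obtain ⟨hSC, hS5⟩ := h.support hg.1 (Z := S) (by omega)
  obtain ⟨s, hs⟩ := Finset.card_eq_one.1 hdS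
  have hsm : s ∈ T \ S := by simp [hs]
  rw [Finset.mem_sdiff] at hsm
  have hTe : T.erase s = T ∩ S := by
    ext c
    have : c ∈ T \ S ↔ c = s := by simp [hs]
    grind
  have hSe : T.erase s ∪ (S \ T) = S := by
    rw [hTe]
    grind
  have hSTC : S \ T ⊆ C \ T := Finset.sdiff_subset_sdiff hSC subset_rfl
  have hc : (S \ T).card + 2 = S.card := by
    have e1 := Finset.card_sdiff_add_card_inter S T
    rw [Finset.inter_comm, ← hTe, Finset.card_erase_of_mem hsm.1, hT3] at e1
    exact e1
  obtain ⟨m, hm, hm2⟩ := h.count_le hT hsm.1 hSTC hle hg (by rwa [hSe]) (by omega)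
  have hCT := Finset.card_sdiff_of_subset hT
  have hQ := Finset.card_sdiff_of_subset hSTC
  have e1 := two_mul_choose_two (S \ T).card
  have e2 := two_mul_choose_two ((C \ T) \ (S \ T)).card
  obtain ⟨v, hv⟩ : ∃ v, (S \ T).card = v + 3 := ⟨(S \ T).card - 3, by omega⟩
  obtain ⟨w, hw⟩ : ∃ w, ((C \ T) \ (S \ T)).card = w + 1 :=
    ⟨((C \ T) \ (S \ T)).card - 1, by omega⟩
  rw [show C.card - 4 = v + 3 + w by omega] at hn
  rw [hv] at e1 hm2
  rw [hw] at e2 hm2 hm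
  generalize (v + 3).choose 2 = x at e1 hm2
  generalize (w + 1).choose 2 = y at e2 hm2
  have e3 : (w + 1) * (2 * x + (v + 3)) = (w + 1) * ((v + 3) * (v + 3)) := by rw [e1]
  ring_nf at e1 e2 e3 hm2 hn hm
  have := Nat.zero_le (w * v ^ 2)
  have := Nat.zero_le (w * v)
  linarith

end IsCountSystem
end VertexDistinguishing

namespace VertexDistinguishing

variable {V : Type*}

/-- The pairs of vertices whose palettes differ by exchanging `a` and `b`. -/
def swapPairs (P : V → Finset ℕ) (a b : ℕ) : SimpleGraph V where
  Adj x y := ¬ (a ∈ P x ↔ b ∈ P x) ∧ P y = swapColors a b (P x)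
  symm := ⟨fun x y h => ⟨by simpa [h.2, iff_comm] using h.1, by rw [h.2, swapColors_swapColors]⟩⟩
  loopless := ⟨fun x h => h.1 (by
    have h2 := congrArg (a ∈ ·) h.2
    simpa using h2)⟩

theorem swapPairs_adj {P : V → Finset ℕ} {a b : ℕ} {x y : V} :
    (swapPairs P a b).Adj x y ↔ ¬ (a ∈ P x ↔ b ∈ P x) ∧ P y = swapColors a b (P x) := Iff.rfl

/-- The component of `x` in the graph of edges colored `a` or `b` together with the mating `M`. -/
def kempeComponent (G : SimpleGraph V) (φ : Sym2 V → ℕ) (a b : ℕ) (M : SimpleGraph V) (x : V) :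
    Set V := {y | (twoColored G φ a b ⊔ M).Reachable x y}

theorem mem_kempeComponent_self (G : SimpleGraph V) (φ : Sym2 V → ℕ) (a b : ℕ) (M : SimpleGraph V)
    (x : V) : x ∈ kempeComponent G φ a b M x := SimpleGraph.Reachable.refl x

theorem kempeClosed_kempeComponent (G : SimpleGraph V) (φ : Sym2 V → ℕ) (a b : ℕ)
    (M : SimpleGraph V) (x : V) : KempeClosed G φ a b (kempeComponent G φ a b M x) :=
  kempeClosed_reachable G φ a b M x

theorem mem_kempeComponent_of_adj {G : SimpleGraph V} {φ : Sym2 V → ℕ} {a b : ℕ}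
    {M : SimpleGraph V} {x y z : V} (hy : y ∈ kempeComponent G φ a b M x) (h : M.Adj y z) :
    z ∈ kempeComponent G φ a b M x :=
  SimpleGraph.Reachable.trans hy (SimpleGraph.Adj.reachable (Or.inr h))

variable [Fintype V] {G : SimpleGraph V} {C : Finset ℕ} {φ : Sym2 V → ℕ} {M : SimpleGraph V}
  {a b : ℕ}

/-- The component of an unmated vertex contains exactly two unmated separated vertices. -/
theorem exists_other_end (h : ProperOn G C φ) (hM : IsMating M)
    (hMR : M ≤ swapPairs (palette G φ) a b) (hab : a ≠ b) {x : V}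
    (hx : ¬ (a ∈ palette G φ x ↔ b ∈ palette G φ x)) (hxM : ∀ z, ¬ M.Adj x z) :
    ∃ y, y ≠ x ∧ y ∈ kempeComponent G φ a b M x ∧ ¬ (a ∈ palette G φ y ↔ b ∈ palette G φ y) ∧
      (∀ z, ¬ M.Adj y z) ∧ ∀ z ∈ kempeComponent G φ a b M x,
        ¬ (a ∈ palette G φ z ↔ b ∈ palette G φ z) → (∀ w, ¬ M.Adj z w) → z = x ∨ z = y := by
  classical
  have hdeg := degree_kempe_eq h hM hab (fun x y hxy => by
    obtain ⟨h1, h2⟩ := swapPairs_adj.1 (hMR hxy)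
    rw [h2, mem_swapColors, Equiv.swap_apply_left]
    tauto)
  have hunm : ∀ z, ¬ (a ∈ palette G φ z ↔ b ∈ palette G φ z) → (∀ w, ¬ M.Adj z w) →
      (twoColored G φ a b ⊔ M).degree z = 1 := by
    intro z hz hzM
    rw [hdeg, if_neg (c := ∃ y, M.Adj z y) (by simpa using hzM)]
    split_ifs <;> tauto
  have hone : ∀ z, (twoColored G φ a b ⊔ M).degree z = 1 →
      ¬ (a ∈ palette G φ z ↔ b ∈ palette G φ z) ∧ ∀ w, ¬ M.Adj z w := by
    intro z hz
    rw [hdeg] at hz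
    by_cases hzM : ∃ w, M.Adj z w
    · obtain ⟨w, hw⟩ := hzM
      have := (swapPairs_adj.1 (hMR hw)).1
      rw [if_pos (c := ∃ y, M.Adj z y) ⟨w, hw⟩] at hz
      split_ifs at hz <;> first | omega | exact (this (by tauto)).elim
    · rw [if_neg (c := ∃ y, M.Adj z y) hzM] at hz
      refine ⟨?_, by simpa using hzM⟩
      split_ifs at hz <;> first | omega | tauto
  have hle : ∀ z, (twoColored G φ a b ⊔ M).degree z ≤ 2 := by
    intro z
    rw [hdeg]
    by_cases hzM : ∃ w, M.Adj z w
    · obtain ⟨w, hw⟩ := hzM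
      have := (swapPairs_adj.1 (hMR hw)).1
      split_ifs <;> first | omega | tauto
    · rw [if_neg hzM]
      split_ifs <;> omega
  obtain ⟨y, hyx, hxy, hy⟩ := exists_ne_degree_eq_one_of_reachable _ hle (hunm x hx hxM)
  refine ⟨y, hyx, hxy, (hone y hy).1, (hone y hy).2, fun z hz hzs hzM => ?_⟩
  by_contra! hne
  have := card_degree_le_one_of_reachable _ hle x {x, y, z} (by
    simp only [Finset.mem_insert, Finset.mem_singleton]
    rintro v (rfl | rfl | rfl)
    exacts [SimpleGraph.Reachable.refl _, hxy, hz]) (by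
    simp only [Finset.mem_insert, Finset.mem_singleton]
    rintro v (rfl | rfl | rfl)
    exacts [(hunm _ hx hxM).le, hy.le, (hunm _ hzs hzM).le])
  rw [Finset.card_eq_three.2 ⟨x, y, z, hyx.symm, hne.1.symm, hne.2.symm, rfl⟩] at this
  omega

/-- The number of vertices with palette `Z`. -/
noncomputable def paletteCount (G : SimpleGraph V) (φ : Sym2 V → ℕ) (Z : Finset ℕ) : ℕ :=
  numOf fun v => palette G φ v = Z

theorem mated_eq (hM : IsMating M) (hMR : M ≤ swapPairs (palette G φ) a b) {X : Set V}
    (hX : ∀ ⦃x y⦄, x ∈ X → M.Adj x y → y ∈ X) (Z : Finset ℕ) :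
    numOf (fun v => v ∈ X ∧ palette G φ v = Z ∧ ∃ w, M.Adj v w) =
      numOf fun v => v ∈ X ∧ palette G φ v = swapColors a b Z ∧ ∃ w, M.Adj v w := by
  apply card_mated_eq hM hX
  intro x y hxy
  rw [(swapPairs_adj.1 (hMR hxy)).2]
  exact (swapColors_injective a b).eq_iff.symm

theorem numOf_ends {X : Set V} {x y : V} (hxX : x ∈ X) (hyX : y ∈ X) (hyx : y ≠ x)
    {U : V → Prop} (hx : U x) (hy : U y) (hU : ∀ z ∈ X, U z → z = x ∨ z = y)
    (A : V → Prop) [DecidablePred A] :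
    numOf (fun v => v ∈ X ∧ A v ∧ U v) = (if A x then 1 else 0) + if A y then 1 else 0 := by
  classical
  rw [numOf_eq_card]
  have : (Finset.univ.filter fun v => v ∈ X ∧ A v ∧ U v) = ({x, y} : Finset V).filter A := by
    ext z
    simp only [Finset.mem_filter, Finset.mem_univ, true_and, Finset.mem_insert,
      Finset.mem_singleton]
    constructor
    · exact fun hz => ⟨hU z hz.1 hz.2.2, hz.2.1⟩
    · rintro ⟨rfl | rfl, h2⟩
      exacts [⟨hxX, h2, hx⟩, ⟨hyX, h2, hy⟩]
  rw [this, Finset.card_filter, Finset.sum_pair hyx.symm]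

theorem paletteCount_exchange (hM : IsMating M) (hMR : M ≤ swapPairs (palette G φ) a b) {x y : V}
    (hx : ¬ (a ∈ palette G φ x ↔ b ∈ palette G φ x)) (hxM : ∀ z, ¬ M.Adj x z) (hyx : y ≠ x)
    (hyX : y ∈ kempeComponent G φ a b M x)
    (hy : ¬ (a ∈ palette G φ y ↔ b ∈ palette G φ y)) (hyM : ∀ z, ¬ M.Adj y z)
    (hU : ∀ z ∈ kempeComponent G φ a b M x,
        ¬ (a ∈ palette G φ z ↔ b ∈ palette G φ z) → (∀ w, ¬ M.Adj z w) → z = x ∨ z = y)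
    (Z : Finset ℕ) :
    paletteCount G (exchange φ (kempeComponent G φ a b M x) a b) Z +
        (if palette G φ x = Z then 1 else 0) + (if palette G φ y = Z then 1 else 0) =
      paletteCount G φ Z + (if swapColors a b (palette G φ x) = Z then 1 else 0) +
        if swapColors a b (palette G φ y) = Z then 1 else 0 := by
  set X := kempeComponent G φ a b M x with hXdef
  have hXk : KempeClosed G φ a b X := kempeClosed_kempeComponent G φ a b M x
  have hXM : ∀ ⦃x y⦄, x ∈ X → M.Adj x y → y ∈ X := fun _ _ h1 h2 => mem_kempeComponent_of_adj h1 h2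
  have hxX : x ∈ X := mem_kempeComponent_self G φ a b M x
  have hnew : paletteCount G (exchange φ X a b) Z =
      numOf (fun v => v ∈ X ∧ palette G φ v = swapColors a b Z) +
        numOf (fun v => palette G φ v = Z ∧ v ∉ X) := by
    rw [paletteCount, numOf_split _ (· ∈ X), palette_exchange hXk]
    congr 1
    · apply numOf_congr
      intro v
      rw [and_comm, and_congr_right_iff]
      intro hv
      rw [swapOn_of_mem hv, swapColors_eq_iff]
    · apply numOf_congr
      intro v
      rw [and_congr_left_iff]
      intro hv
      rw [swapOn_of_notMem hv]
  have hold : paletteCount G φ Z = numOf (fun v => v ∈ X ∧ palette G φ v = Z) +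
        numOf (fun v => palette G φ v = Z ∧ v ∉ X) := by
    rw [paletteCount, numOf_split _ (· ∈ X)]
    congr 1
    exact numOf_congr fun v => and_comm
  by_cases hZ : a ∈ Z ↔ b ∈ Z
  · have e1 : palette G φ x ≠ Z := fun e => hx (e ▸ hZ)
    have e2 : palette G φ y ≠ Z := fun e => hy (e ▸ hZ)
    have e3 : swapColors a b (palette G φ x) ≠ Z := fun e => by
      rw [swapColors_eq_iff, swapColors_eq_self hZ] at e
      exact e1 e
    have e4 : swapColors a b (palette G φ y) ≠ Z := fun e => by
      rw [swapColors_eq_iff, swapColors_eq_self hZ] at e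
      exact e2 e
    rw [if_neg e1, if_neg e2, if_neg e3, if_neg e4, hnew, hold, swapColors_eq_self hZ]
  · have hsplit : ∀ W, ¬ (a ∈ W ↔ b ∈ W) → numOf (fun v => v ∈ X ∧ palette G φ v = W) =
        numOf (fun v => v ∈ X ∧ palette G φ v = W ∧ ∃ w, M.Adj v w) +
          ((if palette G φ x = W then 1 else 0) + if palette G φ y = W then 1 else 0) := by
      intro W hW
      rw [numOf_split _ (fun v => ∃ w, M.Adj v w),
        ← numOf_ends hxX hyX hyx (U := fun v => ∀ w, ¬ M.Adj v w ∧
          ¬ (a ∈ palette G φ v ↔ b ∈ palette G φ v)) (fun w => ⟨hxM w, hx⟩) (fun w => ⟨hyM w, hy⟩)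
          (fun z hz hzU => hU z hz (hzU z).2 (fun w => (hzU w).1)) (fun v => palette G φ v = W)]
      congr 1
      · exact numOf_congr fun v => and_assoc
      · apply numOf_congr
        intro v
        constructor
        · rintro ⟨⟨h1, h2⟩, h3⟩
          exact ⟨h1, h2, fun w => ⟨fun h => h3 ⟨w, h⟩, by rwa [h2]⟩⟩
        · rintro ⟨h1, h2, h3⟩
          exact ⟨⟨h1, h2⟩, fun ⟨w, hw⟩ => (h3 w).1 hw⟩
    have hZ' : ¬ (a ∈ swapColors a b Z ↔ b ∈ swapColors a b Z) := by
      simpa [iff_comm] using hZ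
    have h1 := hsplit Z hZ
    have h2 := hsplit _ hZ'
    have h3 := mated_eq hM hMR hXM Z
    simp only [swapColors_eq_iff]
    omega

end VertexDistinguishing

namespace VertexDistinguishing

variable {V : Type*} [Fintype V] {G : SimpleGraph V} {C : Finset ℕ} {φ : Sym2 V → ℕ}
  {M : SimpleGraph V} {a b : ℕ}

theorem paletteCount_unmated (hM : IsMating M) (hMR : M ≤ swapPairs (palette G φ) a b)
    (hmax : ∀ ⦃x y⦄, (swapPairs (palette G φ) a b).Adj x y → (∃ z, M.Adj x z) ∨ ∃ z, M.Adj y z)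
    {y : V} (hy : ¬ (a ∈ palette G φ y ↔ b ∈ palette G φ y)) (hyM : ∀ z, ¬ M.Adj y z) :
    paletteCount G φ (palette G φ y) = paletteCount G φ (swapColors a b (palette G φ y)) +
      numOf fun v => palette G φ v = palette G φ y ∧ ¬ ∃ w, M.Adj v w := by
  have h1 := mated_eq hM hMR (X := Set.univ) (fun _ _ _ _ => trivial) (palette G φ y)
  simp only [Set.mem_univ, true_and] at h1
  rw [paletteCount, numOf_split _ (fun v => ∃ w, M.Adj v w), h1]
  congr 1
  apply numOf_congr
  intro v
  refine ⟨fun h => h.1, fun h => ⟨h, ?_⟩⟩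
  rcases hmax (swapPairs_adj.2 ⟨hy, h⟩) with ⟨z, hz⟩ | hv
  · exact (hyM z hz).elim
  · exact hv

theorem exists_unmated (hM : IsMating M) (hMR : M ≤ swapPairs (palette G φ) a b) {S : Finset ℕ}
    (h : paletteCount G φ (swapColors a b S) < paletteCount G φ S) :
    ∃ x, palette G φ x = S ∧ ∀ z, ¬ M.Adj x z := by
  by_contra! hne
  have h1 := mated_eq hM hMR (X := Set.univ) (fun _ _ _ _ => trivial) S
  simp only [Set.mem_univ, true_and] at h1
  have h2 : paletteCount G φ S = numOf fun v => palette G φ v = S ∧ ∃ w, M.Adj v w :=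
    numOf_congr fun v => ⟨fun h => ⟨h, hne v h⟩, fun h => h.1⟩
  have h3 : (numOf fun v => palette G φ v = swapColors a b S ∧ ∃ w, M.Adj v w) ≤
      paletteCount G φ (swapColors a b S) := numOf_mono fun v h => h.1
  omega

/-- The sum of the squared multiplicities of the subsets of `C`. -/
def energy (C : Finset ℕ) (f : Finset ℕ → ℕ) : ℕ := ∑ Z ∈ C.powerset, f Z ^ 2

theorem energy_comp_swap {f : Finset ℕ → ℕ} {S T : Finset ℕ} (hS : S ⊆ C) (hT : T ⊆ C) :
    energy C (fun Z => f (Equiv.swap S T Z)) = energy C f := by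
  apply Finset.sum_equiv (Equiv.swap S T)
  · intro Z
    rcases eq_or_ne Z S with rfl | h1
    · simp [hS, hT]
    rcases eq_or_ne Z T with rfl | h2
    · simp [hS, hT]
    rw [Equiv.swap_apply_of_ne_of_ne h1 h2]
  · exact fun _ _ => rfl

/-- The multiplicity functions of the palettes of the proper colorings of least energy. -/
def minimalCounts (G : SimpleGraph V) (C : Finset ℕ) : Set (Finset ℕ → ℕ) :=
  {f | ∃ φ, ProperOn G C φ ∧ f = paletteCount G φ ∧
    ∀ φ', ProperOn G C φ' → energy C f ≤ energy C (paletteCount G φ')}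

theorem minimalCounts_nonempty (h : ∃ φ, ProperOn G C φ) : (minimalCounts G C).Nonempty := by
  obtain ⟨φ, hφ, hmin⟩ := exists_forall_le_of_exists (ProperOn G C)
    (fun φ => energy C (paletteCount G φ)) h
  exact ⟨_, φ, hφ, rfl, hmin⟩

theorem sum_paletteCount (G : SimpleGraph V) (φ : Sym2 V → ℕ) (T : Finset (Finset ℕ)) :
    ∑ Z ∈ T, paletteCount G φ Z = numOf fun v => palette G φ v ∈ T := by
  classical
  simp only [paletteCount, numOf_eq_card]
  exact Finset.sum_card_fiberwise_eq_card_filter _ _ _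

theorem paletteCount_move (hφ : ProperOn G C φ)
    {S : Finset ℕ} (ha : a ∈ C) (hb : b ∈ C) (haS : a ∈ S) (hbS : b ∉ S)
    (hlt : paletteCount G φ (swapColors a b S) < paletteCount G φ S) :
    ∃ g B, (∃ φ', ProperOn G C φ' ∧ g = paletteCount G φ') ∧ S ⊆ C ∧ B ⊆ C ∧
      ¬ (a ∈ B ↔ b ∈ B) ∧ B ≠ swapColors a b S ∧
      paletteCount G φ (swapColors a b B) < paletteCount G φ B ∧
      (B = S → paletteCount G φ (swapColors a b S) + 2 ≤ paletteCount G φ S) ∧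
      ∀ Z, g Z + (if S = Z then 1 else 0) + (if B = Z then 1 else 0) =
        paletteCount G φ Z + (if swapColors a b S = Z then 1 else 0) +
          if swapColors a b B = Z then 1 else 0 := by
  classical
  have hab : a ≠ b := fun e => hbS (e ▸ haS)
  obtain ⟨M, hMR, hM, hmax⟩ := exists_maximal_mating (swapPairs (palette G φ) a b)
  obtain ⟨x, rfl, hxM⟩ := exists_unmated hM hMR hlt
  have hx : ¬ (a ∈ palette G φ x ↔ b ∈ palette G φ x) := by tauto
  obtain ⟨y, hyx, hyX, hy, hyM, hU⟩ := exists_other_end hφ hM hMR hab hx hxM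
  have hcy := paletteCount_unmated hM hMR hmax hy hyM
  have hpos : 0 < numOf fun v => palette G φ v = palette G φ y ∧ ¬ ∃ w, M.Adj v w :=
    numOf_pos.2 ⟨y, rfl, by simpa using hyM⟩
  refine ⟨_, palette G φ y, ⟨_, hφ.exchange ha hb (kempeClosed_kempeComponent G φ a b M x), rfl⟩,
    hφ.palette_subset x, hφ.palette_subset y, hy, ?_, by omega, ?_,
    paletteCount_exchange hM hMR hx hxM hyx hyX hy hyM hU⟩
  · intro e
    rcases hmax (swapPairs_adj.2 ⟨hx, e⟩) with ⟨z, hz⟩ | ⟨z, hz⟩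
    exacts [hxM z hz, hyM z hz]
  · intro e
    have : 1 < numOf fun v => palette G φ v = palette G φ y ∧ ¬ ∃ w, M.Adj v w := by
      rw [numOf_eq_card, Finset.one_lt_card]
      exact ⟨x, by simp [e, hxM], y, by simp [hyM], hyx.symm⟩
    rw [e] at hcy this
    omega

theorem sum_sq_le_iff_of_double_transfer {α : Type*} [DecidableEq α] {K : Finset α} {f g : α → ℕ}
    {i j k l : α} (hi : i ∈ K) (hj : j ∈ K) (hk : k ∈ K) (hl : l ∈ K) (hij : i ≠ j) (hik : i ≠ k)
    (hil : i ≠ l) (hjk : j ≠ k) (hjl : j ≠ l) (hkl : k ≠ l) (h1 : g i + 1 = f i)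
    (h2 : g j = f j + 1) (h3 : g k + 1 = f k) (h4 : g l = f l + 1)
    (h : ∀ c, c ≠ i → c ≠ j → c ≠ k → c ≠ l → g c = f c) :
    ∑ c ∈ K, f c ^ 2 ≤ ∑ c ∈ K, g c ^ 2 ↔ f i + f k ≤ f j + f l + 2 := by
  have hsub : ({i, j, k, l} : Finset α) ⊆ K := by
    simp [Finset.insert_subset_iff, hi, hj, hk, hl]
  rw [← Finset.sum_sdiff hsub, ← Finset.sum_sdiff hsub]
  have : ∑ c ∈ K \ {i, j, k, l}, g c ^ 2 = ∑ c ∈ K \ {i, j, k, l}, f c ^ 2 := by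
    apply Finset.sum_congr rfl
    intro c hc
    simp only [Finset.mem_sdiff, Finset.mem_insert, Finset.mem_singleton, not_or] at hc
    rw [h c hc.2.1 hc.2.2.1 hc.2.2.2.1 hc.2.2.2.2]
  rw [this, add_le_add_iff_left, Finset.sum_insert (by simp [hij, hik, hil]),
    Finset.sum_insert (by simp [hjk, hjl]), Finset.sum_pair hkl,
    Finset.sum_insert (by simp [hij, hik, hil]),
    Finset.sum_insert (by simp [hjk, hjl]), Finset.sum_pair hkl, h2, h4, ← h1, ← h3]
  constructor <;> intro h <;> nlinarith

theorem isCountSystem_minimalCounts [DecidableRel G.Adj] (h5 : ∀ v, 5 ≤ G.degree v)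
    (hd : ∀ d, (numOf fun v => G.degree v = d) ≤ C.card.choose d) :
    IsCountSystem C (Fintype.card V) (minimalCounts G C) where
  support := by
    rintro f ⟨φ, hφ, rfl, -⟩ Z hZ
    obtain ⟨v, rfl⟩ := numOf_pos.1 (Nat.pos_of_ne_zero hZ)
    refine ⟨hφ.palette_subset v, ?_⟩
    rw [hφ.card_palette v]
    exact h5 v
  total := by
    classical
    rintro f ⟨φ, hφ, rfl, -⟩ T
    rw [sum_paletteCount, numOf_eq_card]
    exact Finset.card_le_univ _
  layer := by
    rintro f ⟨φ, hφ, rfl, -⟩ d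
    rw [sum_paletteCount]
    refine le_trans (numOf_mono fun v hv => ?_) (hd d)
    rw [← hφ.card_palette v]
    exact (Finset.mem_powersetCard.1 hv).2
  move := by
    rintro f ⟨φ, hφ, rfl, hmin⟩ S a b ha hb haS hbS hlt
    rw [← swapColors_eq_insert_erase haS hbS] at hlt ⊢
    obtain ⟨g, B, ⟨φ', hφ', rfl⟩, hSC, hBC, hB, hBS', hltB, htwo, hg⟩ :=
      paletteCount_move hφ ha hb haS hbS hlt
    have hen := hmin φ' hφ'
    have hSC' := swapColors_subset ha hb hSC
    have hBC' := swapColors_subset ha hb hBC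
    have hSS' : S ≠ swapColors a b S := fun e => hbS (by rw [e]; simpa using haS)
    have hBB' : B ≠ swapColors a b B := fun e => hB (by
      have : a ∈ B ↔ a ∈ swapColors a b B := by rw [← e]
      simpa using this)
    rcases eq_or_ne B S with rfl | hBS
    · left
      have h2 := htwo rfl
      have hgB := hg B
      have hgB' := hg (swapColors a b B)
      rw [if_pos rfl, if_neg hBB'.symm] at hgB
      rw [if_pos rfl, if_neg hBB'] at hgB'
      have hfB : paletteCount G φ B = paletteCount G φ (swapColors a b B) + 2 := by
        by_contra hne
        refine (sum_sq_lt_of_transfer (t := 2) (f := paletteCount G φ) (g := paletteCount G φ')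
          (Finset.mem_powerset.2 hBC) (Finset.mem_powerset.2 hBC') hBB' hgB ?_ ?_ two_pos
          (by omega)).not_ge hen
        · omega
        · intro Z h1 h2
          have := hg Z
          rw [if_neg h1.symm, if_neg h2.symm] at this
          omega
      refine ⟨hfB, φ', hφ', ?_, ?_⟩
      · funext Z
        rcases eq_or_ne Z B with rfl | h1
        · rw [Equiv.swap_apply_left]
          omega
        rcases eq_or_ne Z (swapColors a b B) with rfl | h2
        · rw [Equiv.swap_apply_right]
          omega
        rw [Equiv.swap_apply_of_ne_of_ne h1 h2]
        have := hg Z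
        rw [if_neg h1.symm, if_neg h2.symm] at this
        omega
      · rw [energy_comp_swap hBC hBC']
        exact hmin
    · right
      have hB'S : swapColors a b B ≠ S := fun e => hBS' (swapColors_eq_iff.1 e)
      have hB'S' : swapColors a b B ≠ swapColors a b S :=
        fun e => hBS (swapColors_injective a b e)
      have g1 := hg S
      have g2 := hg (swapColors a b S)
      have g3 := hg B
      have g4 := hg (swapColors a b B)
      rw [if_pos rfl, if_neg hBS, if_neg hSS'.symm, if_neg hB'S] at g1
      rw [if_neg hSS', if_neg hBS', if_pos rfl, if_neg hB'S'] at g2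
      rw [if_neg hBS.symm, if_pos rfl, if_neg hBS'.symm, if_neg hBB'.symm] at g3
      rw [if_neg hB'S.symm, if_neg hBB', if_neg hB'S'.symm, if_pos rfl] at g4
      have g5 : ∀ Z, Z ≠ S → Z ≠ swapColors a b S → Z ≠ B → Z ≠ swapColors a b B →
          paletteCount G φ' Z = paletteCount G φ Z := by
        intro Z h1 h2 h3 h4
        have := hg Z
        rwa [if_neg h1.symm, if_neg h2.symm, if_neg h3.symm, if_neg h4.symm] at this
      have hsum := (sum_sq_le_iff_of_double_transfer (f := paletteCount G φ)
        (g := paletteCount G φ') (Finset.mem_powerset.2 hSC) (Finset.mem_powerset.2 hSC')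
        (Finset.mem_powerset.2 hBC) (Finset.mem_powerset.2 hBC') hSS' hBS.symm hB'S.symm
        hBS'.symm hB'S'.symm hBB' (by omega) (by omega) (by omega) (by omega) g5).1 hen
      refine ⟨by omega, B, hB, hBS, hBS', by omega, φ', hφ', ?_, ?_⟩
      · funext Z
        rcases eq_or_ne Z B with rfl | h3
        · rw [Equiv.swap_apply_left, Equiv.swap_apply_of_ne_of_ne hB'S hB'S']
          omega
        rcases eq_or_ne Z (swapColors a b B) with rfl | h4
        · rw [Equiv.swap_apply_right, Equiv.swap_apply_of_ne_of_ne hBS hBS']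
          omega
        rw [Equiv.swap_apply_of_ne_of_ne h3 h4]
        rcases eq_or_ne Z S with rfl | h1
        · rw [Equiv.swap_apply_left]
          omega
        rcases eq_or_ne Z (swapColors a b S) with rfl | h2
        · rw [Equiv.swap_apply_right]
          omega
        rw [Equiv.swap_apply_of_ne_of_ne h1 h2]
        exact (g5 Z h1 h2 h3 h4).symm
      · rw [energy_comp_swap (f := fun Z => paletteCount G φ (Equiv.swap S (swapColors a b S) Z))
          hBC hBC', energy_comp_swap hSC hSC']
        exact hmin

/-- A graph with enough room for its palettes has a proper coloring in which every palette occurs at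
most twice, and palettes occurring twice contain the three given colors. -/
theorem exists_properOn_paletteCount_le_two [DecidableRel G.Adj] (h5 : ∀ v, 5 ≤ G.degree v)
    (hd : ∀ d, (numOf fun v => G.degree v = d) ≤ C.card.choose d)
    (hn : 2 * Fintype.card V ≤ (C.card - 4) ^ 2) (hex : ∃ φ, ProperOn G C φ) {T : Finset ℕ}
    (hT : T ⊆ C) (hT3 : T.card = 3) :
    ∃ φ, ProperOn G C φ ∧ ∀ Z, paletteCount G φ Z ≤ 2 ∧ (paletteCount G φ Z = 2 → T ⊆ Z) := by
  obtain ⟨f, ⟨φ, hφ, rfl, -⟩, hf⟩ := (isCountSystem_minimalCounts h5 hd).exists_forall_subset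
    (minimalCounts_nonempty hex) hT hT3 hn
  exact ⟨φ, hφ, hf⟩

end VertexDistinguishing

namespace VertexDistinguishing

section Selection

variable {V α β : Type*}

/-- If every class has at least two members in `D` and every key is shared by at most two members
of `D`, then the classes have representatives with distinct keys. -/
theorem exists_representatives (D : Finset V) (P : V → α) (key : V → β) (c : V → ℕ) {t₁ t₂ : ℕ}
    (hP : ∀ x ∈ D, ∃ y ∈ D, y ≠ x ∧ P y = P x) (hc : ∀ x ∈ D, c x = t₁ ∨ c x = t₂)
    (hkey : ∀ x ∈ D, ∀ y ∈ D, key x = key y → c x = c y → x = y) :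
    ∃ X ⊆ D, (∀ x ∈ D, ∃ y ∈ X, P y = P x) ∧ Set.InjOn P X ∧ Set.InjOn key X := by
  classical
  have hall := (Finset.all_card_le_biUnion_card_iff_exists_injective
    (fun S : D.image P => (D.filter fun x => P x = S).image key)).1 (by
      intro s
      set K := s.biUnion fun S : D.image P => (D.filter fun x => P x = S).image key with hK
      have h1 : (D.filter fun x => P x ∈ s.image Subtype.val).card ≤ (K ×ˢ {t₁, t₂}).card := by
        apply Finset.card_le_card_of_injOn (fun x => (key x, c x))
        · intro x hx
          obtain ⟨hxD, hxs⟩ := Finset.mem_filter.1 hx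
          obtain ⟨S, hS, hSx⟩ := Finset.mem_image.1 hxs
          simp only [Finset.coe_product, Set.mem_prod, Finset.mem_coe]
          refine ⟨Finset.mem_biUnion.2 ⟨S, hS, Finset.mem_image.2 ⟨x, ?_, rfl⟩⟩, ?_⟩
          · exact Finset.mem_filter.2 ⟨hxD, hSx.symm⟩
          · simpa using hc x hxD
        · intro x hx y hy hxy
          rw [Prod.mk.injEq] at hxy
          exact hkey x (Finset.mem_filter.1 hx).1 y (Finset.mem_filter.1 hy).1 hxy.1 hxy.2
      have h2 : 2 * (s.image Subtype.val).card ≤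
          (D.filter fun x => P x ∈ s.image Subtype.val).card := by
        apply Finset.mul_card_image_le_card_of_maps_to (f := P)
        · exact fun x hx => (Finset.mem_filter.1 hx).2
        · intro S hS
          obtain ⟨⟨S', hS'⟩, -, rfl⟩ := Finset.mem_image.1 hS
          obtain ⟨x, hx, hxS⟩ := Finset.mem_image.1 hS'
          obtain ⟨y, hy, hyx, hPy⟩ := hP x hx
          change 1 < _
          rw [Finset.one_lt_card]
          simp only [Finset.mem_filter]
          exact ⟨x, ⟨⟨hx, hxS ▸ hS⟩, hxS⟩, y, ⟨⟨hy, hPy ▸ hxS ▸ hS⟩, hPy.trans hxS⟩, hyx.symm⟩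
      rw [Finset.card_product, Finset.card_image_of_injective _ Subtype.val_injective] at *
      have := Finset.card_le_two (a := t₁) (b := t₂)
      nlinarith)
  obtain ⟨f, hf, hft⟩ := hall
  have hr : ∀ S : D.image P, ∃ x ∈ D, P x = S ∧ key x = f S := by
    intro S
    obtain ⟨x, hx, hxf⟩ := Finset.mem_image.1 (hft S)
    exact ⟨x, (Finset.mem_filter.1 hx).1, (Finset.mem_filter.1 hx).2, hxf⟩
  choose r hrD hrP hrf using hr
  refine ⟨Finset.univ.image r, ?_, ?_, ?_, ?_⟩
  · intro x hx
    obtain ⟨S, -, rfl⟩ := Finset.mem_image.1 hx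
    exact hrD S
  · intro x hx
    exact ⟨r ⟨P x, Finset.mem_image_of_mem P hx⟩, Finset.mem_image_of_mem r (Finset.mem_univ _),
      hrP _⟩
  · intro x hx y hy hxy
    simp only [Finset.coe_image, Finset.coe_univ, Set.image_univ, Set.mem_range] at hx hy
    obtain ⟨S, rfl⟩ := hx
    obtain ⟨S', rfl⟩ := hy
    rw [hrP, hrP] at hxy
    rw [Subtype.ext hxy]
  · intro x hx y hy hxy
    simp only [Finset.coe_image, Finset.coe_univ, Set.image_univ, Set.mem_range] at hx hy
    obtain ⟨S, rfl⟩ := hx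
    obtain ⟨S', rfl⟩ := hy
    rw [hrf, hrf] at hxy
    rw [hf hxy]

end Selection

variable {V : Type*}

open Classical in
/-- Give all edges of `M` the color `s`. -/
noncomputable def recolor (φ : Sym2 V → ℕ) (M : SimpleGraph V) (s : ℕ) (e : Sym2 V) : ℕ :=
  if e ∈ M.edgeSet then s else φ e

theorem recolor_of_adj {φ : Sym2 V → ℕ} {M : SimpleGraph V} {s : ℕ} {v w : V} (h : M.Adj v w) :
    recolor φ M s s(v, w) = s := if_pos h

theorem recolor_of_not_adj {φ : Sym2 V → ℕ} {M : SimpleGraph V} {s : ℕ} {v w : V}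
    (h : ¬ M.Adj v w) : recolor φ M s s(v, w) = φ s(v, w) := if_neg h

theorem ProperOn.recolor {G : SimpleGraph V} {C : Finset ℕ} {φ : Sym2 V → ℕ} {M : SimpleGraph V}
    {s : ℕ} (h : ProperOn G C φ) (hM : IsMating M) (hs : s ∉ C) :
    ProperOn G (insert s C) (recolor φ M s) where
  mem v w hvw := by
    by_cases hm : M.Adj v w
    · rw [recolor_of_adj hm]
      exact Finset.mem_insert_self _ _
    · rw [recolor_of_not_adj hm]
      exact Finset.mem_insert_of_mem (h.mem hvw)
  inj v w w' hvw hvw' e := by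
    by_cases hm : M.Adj v w <;> by_cases hm' : M.Adj v w'
    · exact hM hm hm'
    · rw [recolor_of_adj hm, recolor_of_not_adj hm'] at e
      exact (hs (e ▸ h.mem hvw')).elim
    · rw [recolor_of_not_adj hm, recolor_of_adj hm'] at e
      exact (hs (e ▸ h.mem hvw)).elim
    · rw [recolor_of_not_adj hm, recolor_of_not_adj hm'] at e
      exact h.inj hvw hvw' e

variable [Fintype V] {G : SimpleGraph V} {C T : Finset ℕ} {φ : Sym2 V → ℕ} {M : SimpleGraph V}
  {s : ℕ}

theorem palette_recolor_of_forall_not {v : V} (h : ∀ w, ¬ M.Adj v w) :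
    palette G (recolor φ M s) v = palette G φ v := by
  ext c
  simp only [mem_palette, recolor_of_not_adj (h _)]

theorem palette_recolor_of_adj (hφ : ProperOn G C φ) (hM : IsMating M) (hMG : M ≤ G) {v w : V}
    (h : M.Adj v w) :
    palette G (recolor φ M s) v = insert s ((palette G φ v).erase (φ s(v, w))) := by
  ext c
  simp only [mem_palette, Finset.mem_insert, Finset.mem_erase]
  constructor
  · rintro ⟨z, hz, rfl⟩
    by_cases hm : M.Adj v z
    · exact Or.inl (recolor_of_adj hm)
    · rw [recolor_of_not_adj hm]
      refine Or.inr ⟨fun e => hm ?_, z, hz, rfl⟩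
      rw [hφ.inj hz (hMG h) e]
      exact h
  · rintro (rfl | ⟨hc, z, hz, rfl⟩)
    · exact ⟨w, hMG h, recolor_of_adj h⟩
    · refine ⟨z, hz, recolor_of_not_adj fun hm => hc ?_⟩
      rw [hM hm h]

/-- Some vertex outside `{u, v}` that shares its palette with another vertex is joined to `u` or `v`
by an edge whose color lies in `T`. -/
def IsActive (G : SimpleGraph V) (T : Finset ℕ) (φ : Sym2 V → ℕ) (u v : V) : Prop :=
  ∃ x w w', (x = u ∨ x = v) ∧ w ≠ u ∧ w ≠ v ∧ G.Adj x w ∧ φ s(x, w) ∈ T ∧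
    w ≠ w' ∧ palette G φ w = palette G φ w'

theorem IsActive.symm {u v : V} (h : IsActive G T φ u v) : IsActive G T φ v u := by
  obtain ⟨x, w, w', hx, h1, h2, h3⟩ := h
  exact ⟨x, w, w', hx.symm, h2, h1, h3⟩

/-- `ψ` arises from `φ` by recoloring edges with colors in `T` using `T` and the new color `s`, and
the only vertices sharing their palettes are active pairs for `φ`. -/
structure IsVariant (G : SimpleGraph V) (C T : Finset ℕ) (s : ℕ) (φ ψ : Sym2 V → ℕ) : Prop where
  proper : ProperOn G (insert s C) ψ
  eq_of_notMem : ∀ ⦃v w⦄, G.Adj v w → φ s(v, w) ∉ T → ψ s(v, w) = φ s(v, w)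
  mem_of_mem : ∀ ⦃v w⦄, G.Adj v w → φ s(v, w) ∈ T → ψ s(v, w) ∈ insert s T
  active : ∀ ⦃x y⦄, x ≠ y → palette G ψ x = palette G ψ y →
    palette G φ x = palette G φ y ∧ IsActive G T φ x y

open Classical in
/-- The palette of `v` together with the information which of the two colors may be dropped. -/
noncomputable def hallKey (t₁ t₂ c : ℕ) (P : Finset ℕ) : Finset ℕ :=
  if t₁ ∈ P ∧ t₂ ∈ P then P else P.erase c

theorem hallKey_inj {t₁ t₂ c : ℕ} {P Q : Finset ℕ} (hP : c ∈ P) (hQ : c ∈ Q)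
    (h : hallKey t₁ t₂ c P = hallKey t₁ t₂ c Q) : P = Q := by
  unfold hallKey at h
  have h1 : c ∉ P.erase c := Finset.notMem_erase c P
  have h2 : c ∉ Q.erase c := Finset.notMem_erase c Q
  split_ifs at h
  · exact h
  · exact (h2 (h ▸ hP)).elim
  · exact (h1 (h ▸ hQ)).elim
  · rw [← Finset.insert_erase hP, h, Finset.insert_erase hQ]

/-- A step of the recoloring: the pairs that are not active are separated by giving the new color
to a matching of edges leaving them. -/
theorem exists_isVariant (hφ : ProperOn G C φ) (hs : s ∉ C) {t₁ t₂ : ℕ} (ht : t₁ ≠ t₂)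
    (ht₁ : t₁ ∈ T) (ht₂ : t₂ ∈ T)
    (htwo : ∀ x y z, palette G φ x = palette G φ y → palette G φ x = palette G φ z →
      x = y ∨ x = z ∨ y = z)
    (hT : ∀ x y, x ≠ y → palette G φ x = palette G φ y → T ⊆ palette G φ x) :
    ∃ ψ, IsVariant G C T s φ ψ := by
  classical
  set P := palette G φ with hP
  set D : Finset V := Finset.univ.filter fun x => ∃ y, x ≠ y ∧ P x = P y ∧ ¬ IsActive G T φ x y
    with hD
  have hDmem : ∀ x, x ∈ D ↔ ∃ y, x ≠ y ∧ P x = P y ∧ ¬ IsActive G T φ x y := by simp [hD]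
  have hTD : ∀ x ∈ D, T ⊆ P x := by
    intro x hx
    obtain ⟨y, h1, h2, -⟩ := (hDmem x).1 hx
    exact hT x y h1 h2
  have hw : ∀ x, ∃ w, x ∈ D → G.Adj x w ∧ (φ s(x, w) = t₁ ∨ φ s(x, w) = t₂) ∧
      ∀ w', P w = P w' → w = w' := by
    intro x
    by_cases hx : x ∈ D
    · obtain ⟨y, hxy, hPxy, hact⟩ := (hDmem x).1 hx
      obtain ⟨w, hxw, hcw, hwy⟩ : ∃ w, G.Adj x w ∧ (φ s(x, w) = t₁ ∨ φ s(x, w) = t₂) ∧ w ≠ y := by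
        by_cases hc : φ s(x, y) = t₁
        · obtain ⟨w, hxw, hcw⟩ := mem_palette.1 (hTD x hx ht₂)
          exact ⟨w, hxw, Or.inr hcw, fun e => ht (by rw [← hc, ← hcw, e])⟩
        · obtain ⟨w, hxw, hcw⟩ := mem_palette.1 (hTD x hx ht₁)
          exact ⟨w, hxw, Or.inl hcw, fun e => hc (by rw [← hcw, e])⟩
      refine ⟨w, fun _ => ⟨hxw, hcw, fun w' hw' => ?_⟩⟩
      by_contra hne
      refine hact ⟨x, w, w', Or.inl rfl, hxw.ne', hwy, hxw, ?_, hne, hw'⟩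
      rcases hcw with e | e <;> rw [e] <;> assumption
    · exact ⟨x, fun h => (hx h).elim⟩
  choose w hw using hw
  have hwP : ∀ x ∈ D, φ s(x, w x) ∈ P (w x) := fun x hx => mem_palette_right (hw x hx).1
  have hwx : ∀ x ∈ D, ∀ y ∈ D, w x = w y → φ s(x, w x) = φ s(y, w y) → x = y := by
    intro x hx y hy e1 e2
    have h1 := (hw x hx).1.symm
    have h2 := (hw y hy).1.symm
    rw [Sym2.eq_swap, Sym2.eq_swap (a := y)] at e2
    rw [← e1] at h2 e2
    exact hφ.inj h1 h2 e2
  have hDnot : ∀ x ∈ D, ∀ y ∈ D, x ≠ w y := by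
    rintro x hx y hy rfl
    obtain ⟨z, h1, h2, -⟩ := (hDmem _).1 hx
    exact h1 ((hw y hy).2.2 z h2)
  obtain ⟨X, hXD, hXall, hXP, hXkey⟩ := exists_representatives D P
    (fun x => hallKey t₁ t₂ (φ s(x, w x)) (P (w x))) (fun x => φ s(x, w x)) (t₁ := t₁) (t₂ := t₂)
    (by
      intro x hx
      obtain ⟨y, h1, h2, h3⟩ := (hDmem x).1 hx
      exact ⟨y, (hDmem y).2 ⟨x, h1.symm, h2.symm, fun h => h3 h.symm⟩, h1.symm, h2.symm⟩)
    (fun x hx => (hw x hx).2.1)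
    (by
      intro x hx y hy h1 h2
      refine hwx x hx y hy ((hw x hx).2.2 _ ?_) h2
      simp only [h2] at h1
      exact hallKey_inj (h2 ▸ hwP x hx) (hwP y hy) h1)
  have hXw : ∀ x ∈ X, ∀ y ∈ X, w x = w y → x = y := by
    intro x hx y hy e
    by_cases hc : φ s(x, w x) = φ s(y, w y)
    · exact hwx x (hXD hx) y (hXD hy) e hc
    · apply hXkey hx hy
      have h1 := hwP x (hXD hx)
      have h2 := hwP y (hXD hy)
      have h3 := (hw x (hXD hx)).2.1
      have h4 := (hw y (hXD hy)).2.1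
      rw [← e] at h2
      have : t₁ ∈ P (w x) ∧ t₂ ∈ P (w x) := by
        rw [← e] at hc h4
        rcases h3 with h3 | h3 <;> rcases h4 with h4 | h4
        · exact (hc (h3.trans h4.symm)).elim
        · exact ⟨h3 ▸ h1, h4 ▸ h2⟩
        · exact ⟨h4 ▸ h2, h3 ▸ h1⟩
        · exact (hc (h3.trans h4.symm)).elim
      simp only [hallKey, ← e, if_pos this]
  let M : SimpleGraph V :=
    { Adj := fun x y => (x ∈ X ∧ y = w x) ∨ (y ∈ X ∧ x = w y)
      symm := ⟨fun x y h => h.symm⟩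
      loopless := ⟨fun x h => by
        rcases h with ⟨h1, h2⟩ | ⟨h1, h2⟩ <;> exact hDnot x (hXD h1) x (hXD h1) h2⟩ }
  have hMadj : ∀ x y, M.Adj x y ↔ (x ∈ X ∧ y = w x) ∨ (y ∈ X ∧ x = w y) := fun _ _ => Iff.rfl
  have hM : IsMating M := by
    intro x y z hxy hxz
    rw [hMadj] at hxy hxz
    rcases hxy with ⟨h1, rfl⟩ | ⟨h1, rfl⟩ <;> rcases hxz with ⟨h3, h4⟩ | ⟨h3, h4⟩
    · exact h4.symm
    · exact (hDnot x (hXD h1) z (hXD h3) h4).elim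
    · exact (hDnot _ (hXD h3) y (hXD h1) rfl).elim
    · exact hXw y h1 z h3 h4
  have hMG : M ≤ G := by
    intro x y hxy
    rw [hMadj] at hxy
    rcases hxy with ⟨h1, rfl⟩ | ⟨h1, rfl⟩
    exacts [(hw x (hXD h1)).1, (hw y (hXD h1)).1.symm]
  have hMT : ∀ x y, M.Adj x y → φ s(x, y) ∈ T := by
    intro x y hxy
    rw [hMadj] at hxy
    rcases hxy with ⟨h1, rfl⟩ | ⟨h1, rfl⟩
    · rcases (hw x (hXD h1)).2.1 with e | e <;> rw [e] <;> assumption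
    · rw [Sym2.eq_swap]
      rcases (hw y (hXD h1)).2.1 with e | e <;> rw [e] <;> assumption
  have hsP : ∀ v, s ∉ P v := fun v h => hs (hφ.palette_subset v h)
  refine ⟨recolor φ M s, hφ.recolor hM hs, ?_, ?_, ?_⟩
  · intro x y hxy hc
    exact recolor_of_not_adj fun hm => hc (hMT x y hm)
  · intro x y hxy hc
    by_cases hm : M.Adj x y
    · rw [recolor_of_adj hm]
      exact Finset.mem_insert_self _ _
    · rw [recolor_of_not_adj hm]
      exact Finset.mem_insert_of_mem hc
  · intro x y hxy hpal
    by_cases hx : ∃ z, M.Adj x z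
    · obtain ⟨x', hx⟩ := hx
      rw [palette_recolor_of_adj hφ hM hMG hx] at hpal
      by_cases hy : ∃ z, M.Adj y z
      · obtain ⟨y', hy⟩ := hy
        rw [palette_recolor_of_adj hφ hM hMG hy] at hpal
        exfalso
        have h1 : (P x).erase (φ s(x, x')) = (P y).erase (φ s(y, y')) := by
          rw [← Finset.erase_insert (a := s) (s := (P x).erase (φ s(x, x'))), hpal,
            Finset.erase_insert]
          exacts [fun h => hsP _ (Finset.mem_of_mem_erase h),
            fun h => hsP _ (Finset.mem_of_mem_erase h)]
        have hcx : φ s(x, x') ∈ P x := mem_palette_left (hMG hx)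
        have hcy : φ s(y, y') ∈ P y := mem_palette_left (hMG hy)
        have h2 : φ s(x, x') = φ s(y, y') → P x = P y := by
          intro e
          rw [← Finset.insert_erase hcx, h1, e, Finset.insert_erase hcy]
        have h3 : φ s(x, x') ≠ φ s(y, y') → φ s(x, x') ∉ P y ∧ φ s(y, y') ∉ P x := by
          intro hne
          constructor
          · intro h
            exact Finset.notMem_erase _ (P x) (h1 ▸ Finset.mem_erase.2 ⟨hne, h⟩)
          · intro h
            exact Finset.notMem_erase _ (P y) (h1 ▸ Finset.mem_erase.2 ⟨hne.symm, h⟩)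
        have hxT := hMT x x' hx
        have hyT := hMT y y' hy
        rw [hMadj] at hx hy
        by_cases hc : φ s(x, x') = φ s(y, y')
        · have hPP := h2 hc
          rcases hx with ⟨hxX, rfl⟩ | ⟨hxX, rfl⟩
          · rcases hy with ⟨hyX, rfl⟩ | ⟨hyX, rfl⟩
            · exact hxy (hXP hxX hyX hPP)
            · exact hxy ((hw _ (hXD hyX)).2.2 _ hPP.symm).symm
          · exact hxy ((hw _ (hXD hxX)).2.2 _ hPP)
        · obtain ⟨h4, h5⟩ := h3 hc
          rcases hx with ⟨hxX, rfl⟩ | ⟨hxX, rfl⟩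
          · exact h5 (hTD x (hXD hxX) hyT)
          rcases hy with ⟨hyX, rfl⟩ | ⟨hyX, rfl⟩
          · exact h4 (hTD y (hXD hyX) hxT)
          have hne : x' ≠ y' := fun e => hxy (by rw [e])
          apply hne
          apply hXkey hxX hyX
          rw [Sym2.eq_swap, Sym2.eq_swap (a := w y')] at h1
          have h6 := (hw x' (hXD hxX)).2.1
          have h7 := (hw y' (hXD hyX)).2.1
          rw [Sym2.eq_swap] at h4 h5
          rw [Sym2.eq_swap, Sym2.eq_swap (a := w y')] at hc
          have h8 : ¬ (t₁ ∈ P (w x') ∧ t₂ ∈ P (w x')) := by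
            rcases h7 with e | e <;> rw [e] at h5 <;> tauto
          have h9 : ¬ (t₁ ∈ P (w y') ∧ t₂ ∈ P (w y')) := by
            rcases h6 with e | e <;> rw [e] at h4 <;> tauto
          simp only [hallKey, if_neg h8, if_neg h9, h1]
      · rw [palette_recolor_of_forall_not (by simpa using hy)] at hpal
        exact (hsP y (by rw [hP, ← hpal]; exact Finset.mem_insert_self _ _)).elim
    · rw [palette_recolor_of_forall_not (by simpa using hx)] at hpal
      by_cases hy : ∃ z, M.Adj y z
      · obtain ⟨y', hy⟩ := hy
        rw [palette_recolor_of_adj hφ hM hMG hy] at hpal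
        exact (hsP x (by rw [hP, hpal]; exact Finset.mem_insert_self _ _)).elim
      · rw [palette_recolor_of_forall_not (by simpa using hy)] at hpal
        refine ⟨hpal, ?_⟩
        by_contra hact
        obtain ⟨z, hzX, hz⟩ := hXall x ((hDmem x).2 ⟨y, hxy, hpal, hact⟩)
        rcases htwo x y z hpal hz.symm with e | e | e
        · exact hxy e
        · exact hx ⟨w x, (hMadj _ _).2 (Or.inl ⟨e ▸ hzX, rfl⟩)⟩
        · exact hy ⟨w y, (hMadj _ _).2 (Or.inl ⟨e ▸ hzX, rfl⟩)⟩

end VertexDistinguishing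

namespace VertexDistinguishing

variable {V : Type*} [Fintype V] {G : SimpleGraph V} {C T : Finset ℕ} {s : ℕ}
  {φ ψ : Sym2 V → ℕ} {a b : ℕ}

/-- A proper coloring in which every palette occurs at most twice, and palettes occurring twice
contain the three colors of `T`. -/
structure IsNearVdec (G : SimpleGraph V) (C T : Finset ℕ) (s : ℕ) (φ : Sym2 V → ℕ) : Prop where
  proper : ProperOn G C φ
  notMem : s ∉ C
  subset : T ⊆ C
  card_eq : T.card = 3
  eq_or_eq : ∀ ⦃x y z⦄, palette G φ x = palette G φ y → palette G φ x = palette G φ z →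
    x = y ∨ x = z ∨ y = z
  subset_palette : ∀ ⦃x y⦄, x ≠ y → palette G φ x = palette G φ y → T ⊆ palette G φ x

/-- The only color of `B` missing in `P` is `d`. -/
def Misses (B P : Finset ℕ) (d : ℕ) : Prop := ∀ c ∈ B, c ∈ P ↔ c ≠ d

theorem swap_mem {a b c : ℕ} {B : Finset ℕ} (ha : a ∈ B) (hb : b ∈ B) (hc : c ∈ B) :
    Equiv.swap a b c ∈ B := by
  rw [Equiv.swap_apply_def]
  split_ifs <;> assumption

theorem Misses.swapColors {B P : Finset ℕ} {d : ℕ} (h : Misses B P d) (ha : a ∈ B) (hb : b ∈ B) :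
    Misses B (swapColors a b P) (Equiv.swap a b d) := by
  intro c hc
  rw [mem_swapColors, h _ (swap_mem ha hb hc), ne_eq, ne_eq, Equiv.swap_apply_eq_iff]

theorem Misses.eq {B P : Finset ℕ} {d e : ℕ} (h : Misses B P d) (h' : Misses B P e) (hd : d ∈ B) :
    d = e := by
  by_contra hne
  exact (h d hd).1 ((h' d hd).2 hne) rfl

namespace IsNearVdec

theorem notMem_T (h : IsNearVdec G C T s φ) : s ∉ T := fun hs => h.notMem (h.subset hs)

theorem card_insert (h : IsNearVdec G C T s φ) : (insert s T).card = 4 := by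
  rw [Finset.card_insert_of_notMem h.notMem_T, h.card_eq]

theorem palette_sdiff (h : IsNearVdec G C T s φ) (hψ : IsVariant G C T s φ ψ) (v : V) :
    palette G ψ v \ insert s T = palette G φ v \ T := by
  ext c
  simp only [Finset.mem_sdiff, mem_palette]
  constructor
  · rintro ⟨⟨w, hw, rfl⟩, hc⟩
    have hT : φ s(v, w) ∉ T := fun hT => hc (hψ.mem_of_mem hw hT)
    rw [hψ.eq_of_notMem hw hT]
    exact ⟨⟨w, hw, rfl⟩, hT⟩
  · rintro ⟨⟨w, hw, rfl⟩, hc⟩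
    refine ⟨⟨w, hw, hψ.eq_of_notMem hw hc⟩, fun hs => ?_⟩
    rcases Finset.mem_insert.1 hs with hs | hs
    · exact h.notMem (hs ▸ h.proper.mem hw)
    · exact hc hs

theorem card_palette_eq (h : IsNearVdec G C T s φ) (hψ : IsVariant G C T s φ ψ) (v : V) :
    (palette G ψ v).card = (palette G φ v).card := by
  classical
  rw [hψ.proper.card_palette v, h.proper.card_palette v]

theorem exists_misses (h : IsNearVdec G C T s φ) (hψ : IsVariant G C T s φ ψ) {x y : V}
    (hxy : x ≠ y) (hP : palette G φ x = palette G φ y) :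
    ∃ d ∈ insert s T, Misses (insert s T) (palette G ψ x) d := by
  have hT := h.subset_palette hxy hP
  have h1 := Finset.card_sdiff_add_card_inter (palette G ψ x) (insert s T)
  have h2 := Finset.card_sdiff_add_card_inter (palette G φ x) T
  rw [h.palette_sdiff hψ, h.card_palette_eq hψ] at h1
  rw [Finset.inter_eq_right.2 hT, h.card_eq] at h2
  have h3 := Finset.card_sdiff_add_card_inter (insert s T) (palette G ψ x)
  rw [Finset.inter_comm, h.card_insert] at h3
  obtain ⟨d, hd⟩ := Finset.card_eq_one.1 (show (insert s T \ palette G ψ x).card = 1 by omega)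
  refine ⟨d, ?_, fun c hc => ?_⟩
  · have : d ∈ insert s T \ palette G ψ x := by simp [hd]
    exact (Finset.mem_sdiff.1 this).1
  · have : c ∈ insert s T \ palette G ψ x ↔ c = d := by simp [hd]
    rw [Finset.mem_sdiff] at this
    tauto

theorem palette_eq_of_swapColors (h : IsNearVdec G C T s φ) (hψ : IsVariant G C T s φ ψ)
    (ha : a ∈ insert s T) (hb : b ∈ insert s T) {x x' y : V} (hxx' : x ≠ x')
    (hP : palette G φ x = palette G φ x')
    (hy : palette G ψ y = swapColors a b (palette G ψ x)) : palette G φ y = palette G φ x := by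
  have hT := h.subset_palette hxx' hP
  have e : palette G φ y \ T = palette G φ x \ T := by
    rw [← h.palette_sdiff hψ, ← h.palette_sdiff hψ, hy]
    ext c
    simp only [Finset.mem_sdiff, mem_swapColors]
    rw [and_congr_left_iff]
    intro hc
    rw [Equiv.swap_apply_of_ne_of_ne (fun e => hc (by rw [e]; exact ha))
      (fun e => hc (by rw [e]; exact hb))]
  have hc : (palette G φ y).card = (palette G φ x).card := by
    rw [← h.card_palette_eq hψ, ← h.card_palette_eq hψ, hy, card_swapColors]
  have h1 := Finset.card_sdiff_add_card_inter (palette G φ x) T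
  have h2 := Finset.card_sdiff_add_card_inter (palette G φ y) T
  rw [Finset.inter_eq_right.2 hT] at h1
  rw [e] at h2
  have hTy : T ⊆ palette G φ y := by
    rw [← Finset.inter_eq_right]
    exact Finset.eq_of_subset_of_card_le Finset.inter_subset_right (by omega)
  rw [← Finset.sdiff_union_of_subset hT, ← e, Finset.sdiff_union_of_subset hTy]

theorem isMating_swapPairs (h : IsNearVdec G C T s φ) (hψ : IsVariant G C T s φ ψ)
    (ha : a ∈ insert s T) (hb : b ∈ insert s T) : IsMating (swapPairs (palette G ψ) a b) := by
  intro x y z hxy hxz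
  by_contra hne
  obtain ⟨hP, -⟩ := hψ.active hne (hxy.2.trans hxz.2.symm)
  have hyx := h.palette_eq_of_swapColors hψ ha hb hne hP hxy.symm.2
  rcases h.eq_or_eq hyx.symm hP with e | e | e
  exacts [hxy.ne' e, hne e, hxz.ne e]

theorem palette_eq_of_exchange {X : Set V} (hX : KempeClosed G ψ a b X)
    (hXR : ∀ ⦃x y⦄, x ∈ X → (swapPairs (palette G ψ) a b).Adj x y → y ∈ X) {x y : V}
    (he : palette G (exchange ψ X a b) x = palette G (exchange ψ X a b) y) :
    palette G ψ x = palette G ψ y := by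
  have key : ∀ x y, x ∈ X → y ∉ X → swapColors a b (palette G ψ x) = palette G ψ y →
      palette G ψ x = palette G ψ y := by
    intro x y hx hy e
    by_cases hsep : a ∈ palette G ψ x ↔ b ∈ palette G ψ x
    · rw [← e, swapColors_eq_self hsep]
    · exact (hy (hXR hx (swapPairs_adj.2 ⟨hsep, e.symm⟩))).elim
  rw [palette_exchange hX] at he
  by_cases hx : x ∈ X <;> by_cases hy : y ∈ X
  · rw [swapOn_of_mem hx, swapOn_of_mem hy] at he
    exact swapColors_injective a b he
  · rw [swapOn_of_mem hx, swapOn_of_notMem hy] at he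
    exact key x y hx hy he
  · rw [swapOn_of_notMem hx, swapOn_of_mem hy] at he
    exact (key y x hy hx he.symm).symm
  · rwa [swapOn_of_notMem hx, swapOn_of_notMem hy] at he

theorem isVariant_exchange (h : IsNearVdec G C T s φ) (hψ : IsVariant G C T s φ ψ)
    (ha : a ∈ insert s T) (hb : b ∈ insert s T) {X : Set V} (hX : KempeClosed G ψ a b X)
    (hXR : ∀ ⦃x y⦄, x ∈ X → (swapPairs (palette G ψ) a b).Adj x y → y ∈ X) :
    IsVariant G C T s φ (exchange ψ X a b) where
  proper := hψ.proper.exchange (Finset.insert_subset_insert s h.subset ha)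
    (Finset.insert_subset_insert s h.subset hb) hX
  eq_of_notMem v w hvw hc := by
    have e := hψ.eq_of_notMem hvw hc
    have hB : ψ s(v, w) ∉ insert s T := by
      rw [e, Finset.mem_insert, not_or]
      exact ⟨fun e => h.notMem (e ▸ h.proper.mem hvw), hc⟩
    rw [exchange_eq_of_ne (fun e => hB (by rw [e]; exact ha)) (fun e => hB (by rw [e]; exact hb)),
      e]
  mem_of_mem v w hvw hc := by
    have hB := hψ.mem_of_mem hvw hc
    rcases exchange_eq_or (φ := ψ) (X := X) (a := a) (b := b) s(v, w) with e | e <;> rw [e]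
    · exact hB
    · exact swap_mem ha hb hB
  active x y hxy he := hψ.active hxy (palette_eq_of_exchange hX hXR he)

end IsNearVdec

/-- The number of pairs of vertices sharing their palettes. -/
noncomputable def coincidences (G : SimpleGraph V) (ψ : Sym2 V → ℕ) : ℕ :=
  numOf fun p : V × V => p.1 ≠ p.2 ∧ palette G ψ p.1 = palette G ψ p.2

/-- A variant of `φ` with the fewest coincidences, and two vertices `u`, `v` sharing a palette
without the color `α`. -/
structure IsToken (G : SimpleGraph V) (C T : Finset ℕ) (s : ℕ) (φ : Sym2 V → ℕ) (u v : V) (α : ℕ)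
    (ψ : Sym2 V → ℕ) : Prop where
  variant : IsVariant G C T s φ ψ
  minimal : ∀ ⦃ψ'⦄, IsVariant G C T s φ ψ' → coincidences G ψ ≤ coincidences G ψ'
  ne : u ≠ v
  eq : palette G ψ u = palette G ψ v
  misses : Misses (insert s T) (palette G ψ u) α

theorem not_sep_iff {B P : Finset ℕ} {d : ℕ} (h : Misses B P d) (ha : a ∈ B) (hb : b ∈ B)
    (hab : a ≠ b) : ¬ (a ∈ P ↔ b ∈ P) ↔ d = a ∨ d = b := by
  rw [h a ha, h b hb]
  grind

namespace IsToken

variable {u v : V} {α β : ℕ}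

theorem unmated (ht : IsToken G C T s φ u v α ψ) (h : IsNearVdec G C T s φ)
    (hα : α ∈ insert s T) (hβ : β ∈ insert s T) (z : V) :
    ¬ (swapPairs (palette G ψ) α β).Adj u z := by
  intro hz
  obtain ⟨hP, -⟩ := ht.variant.active ht.ne ht.eq
  have hzu := h.palette_eq_of_swapColors ht.variant hα hβ ht.ne hP hz.2
  rcases h.eq_or_eq hP hzu.symm with e | e | e
  · exact ht.ne e
  · exact hz.ne e
  · subst e
    have h1 := hz.2
    rw [← ht.eq] at h1
    have h2 : α ∈ palette G ψ u ↔ α ∈ swapColors α β (palette G ψ u) := by rw [← h1]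
    rw [mem_swapColors, Equiv.swap_apply_left] at h2
    exact hz.1 h2

theorem separated (ht : IsToken G C T s φ u v α ψ) (hα : α ∈ insert s T) (hβ : β ∈ insert s T)
    (hαβ : α ≠ β) : ¬ (α ∈ palette G ψ u ↔ β ∈ palette G ψ u) :=
  (not_sep_iff ht.misses hα hβ hαβ).2 (Or.inl rfl)

theorem symm (ht : IsToken G C T s φ u v α ψ) : IsToken G C T s φ v u α ψ :=
  ⟨ht.variant, ht.minimal, ht.ne.symm, ht.eq.symm, ht.eq ▸ ht.misses⟩

theorem coincidences_exchange {X : Set V} (hX : KempeClosed G ψ a b X)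
    (hXR : ∀ ⦃x y⦄, x ∈ X → (swapPairs (palette G ψ) a b).Adj x y → y ∈ X) :
    coincidences G (exchange ψ X a b) ≤ coincidences G ψ :=
  numOf_mono fun _ hp => ⟨hp.1, IsNearVdec.palette_eq_of_exchange hX hXR hp.2⟩

/-- The component of `u` contains `v`. -/
theorem mem_component (ht : IsToken G C T s φ u v α ψ) (h : IsNearVdec G C T s φ)
    (hα : α ∈ insert s T) (hβ : β ∈ insert s T) (hαβ : α ≠ β) :
    v ∈ kempeComponent G ψ α β (swapPairs (palette G ψ) α β) u := by
  by_contra hv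
  set X := kempeComponent G ψ α β (swapPairs (palette G ψ) α β) u with hXdef
  have hX : KempeClosed G ψ α β X := kempeClosed_kempeComponent _ _ _ _ _ _
  have hXR : ∀ ⦃x y⦄, x ∈ X → (swapPairs (palette G ψ) α β).Adj x y → y ∈ X :=
    fun _ _ => mem_kempeComponent_of_adj
  have huX : u ∈ X := mem_kempeComponent_self _ _ _ _ _ _
  refine (ht.minimal (h.isVariant_exchange ht.variant hα hβ hX hXR)).not_gt ?_
  unfold coincidences
  rw [numOf_split (fun p : V × V => p.1 ≠ p.2 ∧ palette G ψ p.1 = palette G ψ p.2)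
    (fun p => palette G (exchange ψ X α β) p.1 = palette G (exchange ψ X α β) p.2)]
  refine Nat.lt_of_le_of_lt ?_ (Nat.lt_add_of_pos_right ?_)
  · apply numOf_mono
    exact fun p hp => ⟨⟨hp.1, IsNearVdec.palette_eq_of_exchange hX hXR hp.2⟩, hp.2⟩
  · refine numOf_pos.2 ⟨(u, v), ⟨ht.ne, ht.eq⟩, fun e => ?_⟩
    simp only [palette_exchange hX, swapOn_of_mem huX, swapOn_of_notMem hv, ← ht.eq] at e
    have h2 : α ∈ palette G ψ u ↔ α ∈ swapColors α β (palette G ψ u) := by rw [e]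
    rw [mem_swapColors, Equiv.swap_apply_left] at h2
    exact ht.separated hα hβ hαβ h2

/-- The only unmated vertices in the component of `u` are `u` and `v`. -/
theorem eq_or_eq_of_mem_component (ht : IsToken G C T s φ u v α ψ) (h : IsNearVdec G C T s φ)
    (hα : α ∈ insert s T) (hβ : β ∈ insert s T) (hαβ : α ≠ β) {z : V}
    (hz : z ∈ kempeComponent G ψ α β (swapPairs (palette G ψ) α β) u)
    (hsep : ¬ (α ∈ palette G ψ z ↔ β ∈ palette G ψ z))
    (hun : ∀ y, ¬ (swapPairs (palette G ψ) α β).Adj z y) : z = u ∨ z = v := by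
  obtain ⟨y, -, -, -, -, hy⟩ := exists_other_end ht.variant.proper
    (h.isMating_swapPairs ht.variant hα hβ) le_rfl hαβ (ht.separated hα hβ hαβ)
    (ht.unmated h hα hβ)
  rcases hy v (ht.mem_component h hα hβ hαβ) (ht.symm.separated hα hβ hαβ)
    (ht.symm.unmated h hα hβ) with e | e
  · exact (ht.ne e.symm).elim
  · rw [e]
    exact hy z hz hsep hun

/-- A twin that is missing one of two colors can only be mated with its partner. -/
theorem unmated_of_misses (h : IsNearVdec G C T s φ) (hψ : IsVariant G C T s φ ψ)
    (ha : a ∈ insert s T) (hb : b ∈ insert s T) {x y : V} (hxy : x ≠ y)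
    (hP : palette G φ x = palette G φ y) {d e : ℕ} (hd : Misses (insert s T) (palette G ψ x) d)
    (he : Misses (insert s T) (palette G ψ y) e) (heB : e ∈ insert s T)
    (hne : e ≠ Equiv.swap a b d) (z : V) : ¬ (swapPairs (palette G ψ) a b).Adj x z := by
  intro hz
  have hzx := h.palette_eq_of_swapColors hψ ha hb hxy hP hz.2
  rcases h.eq_or_eq hP hzx.symm with e | e | e
  · exact hxy e
  · exact hz.ne e
  · subst e
    exact hne (he.eq (hz.2 ▸ hd.swapColors ha hb) heB)

theorem exists_flip (ht : IsToken G C T s φ u v α ψ) (h : IsNearVdec G C T s φ)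
    (hα : α ∈ insert s T) (hβ : β ∈ insert s T) (hαβ : α ≠ β) {x y : V} (hxy : x ≠ y)
    (hP : palette G φ x = palette G φ y) (hxu : x ≠ u) (hxv : x ≠ v) {d e : ℕ}
    (hd : Misses (insert s T) (palette G ψ x) d) (he : Misses (insert s T) (palette G ψ y) e)
    (heB : e ∈ insert s T) (hdαβ : d = α ∨ d = β) (hne : e ≠ Equiv.swap α β d) :
    ∃ ψ', IsToken G C T s φ u v α ψ' ∧ (∀ w, G.Adj u w → ψ' s(u, w) = ψ s(u, w)) ∧
      Misses (insert s T) (palette G ψ' x) (Equiv.swap α β d) ∧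
      (Misses (insert s T) (palette G ψ' y) e ∨
        Misses (insert s T) (palette G ψ' y) (Equiv.swap α β e)) := by
  have hun := unmated_of_misses h ht.variant hα hβ hxy hP hd he heB hne
  have hsep := (not_sep_iff hd hα hβ hαβ).2 hdαβ
  set X := kempeComponent G ψ α β (swapPairs (palette G ψ) α β) x with hXdef
  have hX : KempeClosed G ψ α β X := kempeClosed_kempeComponent _ _ _ _ _ _
  have hXR : ∀ ⦃x y⦄, x ∈ X → (swapPairs (palette G ψ) α β).Adj x y → y ∈ X :=
    fun _ _ => mem_kempeComponent_of_adj
  have hxX : x ∈ X := mem_kempeComponent_self _ _ _ _ _ _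
  have huX : u ∉ X := by
    intro hu
    rcases ht.eq_or_eq_of_mem_component h hα hβ hαβ (SimpleGraph.Reachable.symm hu) hsep hun with
      e | e
    exacts [hxu e, hxv e]
  have hvX : v ∉ X := by
    intro hv
    rcases ht.symm.eq_or_eq_of_mem_component h hα hβ hαβ (SimpleGraph.Reachable.symm hv) hsep
      hun with e | e
    exacts [hxv e, hxu e]
  refine ⟨exchange ψ X α β, ⟨h.isVariant_exchange ht.variant hα hβ hX hXR,
    fun ψ' hψ' => (coincidences_exchange hX hXR).trans (ht.minimal hψ'), ht.ne, ?_, ?_⟩,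
    fun w hw => exchange_of_notMem hX huX hw, ?_, ?_⟩
  · rw [palette_exchange hX, swapOn_of_notMem huX, swapOn_of_notMem hvX, ht.eq]
  · rw [palette_exchange hX, swapOn_of_notMem huX]
    exact ht.misses
  · rw [palette_exchange hX, swapOn_of_mem hxX]
    exact hd.swapColors hα hβ
  · rw [palette_exchange hX]
    by_cases hy : y ∈ X
    · rw [swapOn_of_mem hy]
      exact Or.inr (he.swapColors hα hβ)
    · rw [swapOn_of_notMem hy]
      exact Or.inl he

/-- A neighbor of `u` missing `α` has a partner missing the color of the joining edge. -/
theorem eq_color_of_misses (ht : IsToken G C T s φ u v α ψ) (h : IsNearVdec G C T s φ)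
    (hα : α ∈ insert s T) {w w' : V} (hw : G.Adj u w) (hi : ψ s(u, w) ∈ insert s T) (hwv : w ≠ v)
    (hww' : w ≠ w') (hP : palette G φ w = palette G φ w')
    (hd : Misses (insert s T) (palette G ψ w) α) {e : ℕ}
    (he : Misses (insert s T) (palette G ψ w') e) (heB : e ∈ insert s T) : e = ψ s(u, w) := by
  by_contra hne
  have hαi : α ≠ ψ s(u, w) := fun e => (hd α hα).1 (e ▸ mem_palette_right hw) rfl
  have hun := unmated_of_misses h ht.variant hα hi hww' hP hd he heB
    (by rwa [Equiv.swap_apply_left])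
  have hsep := (not_sep_iff hd hα hi hαi).2 (Or.inl rfl)
  have hmem := kempeClosed_kempeComponent G ψ α (ψ s(u, w))
    (swapPairs (palette G ψ) α (ψ s(u, w))) u (mem_kempeComponent_self _ _ _ _ _ _) hw
    (Or.inr rfl)
  rcases ht.eq_or_eq_of_mem_component h hα hi hαi hmem hsep hun with e | e
  exacts [hw.ne' e, hwv e]

theorem false_of_adj (ht : IsToken G C T s φ u v α ψ) (h : IsNearVdec G C T s φ)
    (hα : α ∈ insert s T) {w w' : V} (hw : G.Adj u w) (hT : φ s(u, w) ∈ T) (hwv : w ≠ v)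
    (hww' : w ≠ w') (hP : palette G φ w = palette G φ w') : False := by
  have hwu : w ≠ u := hw.ne'
  have hPuv := (ht.variant.active ht.ne ht.eq).1
  have hw'u : w' ≠ u := by
    rintro rfl
    rcases h.eq_or_eq hP.symm hPuv with e | e | e
    exacts [hww' e.symm, ht.ne e, hwv e]
  have hw'v : w' ≠ v := by
    rintro rfl
    rcases h.eq_or_eq hP.symm hPuv.symm with e | e | e
    exacts [hww' e.symm, ht.ne e.symm, hwu e]
  have hi := ht.variant.mem_of_mem hw hT
  set i := ψ s(u, w) with hidef
  have hcard := h.card_insert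
  set B := insert s T with hB
  have hαi : α ≠ i := fun e => (ht.misses α hα).1 (e ▸ mem_palette_left hw) rfl
  -- the pair of missing colors is never `(α, e)` with `e ≠ i`
  have hend : ∀ ψ' e, IsToken G C T s φ u v α ψ' → ψ' s(u, w) = i →
      Misses B (palette G ψ' w) α → Misses B (palette G ψ' w') e → e ∈ B → e = i := by
    intro ψ' e ht' hi' hd he heB
    rw [← hi']
    exact ht'.eq_color_of_misses h hα hw (by rwa [hi']) hwv hww' hP hd he heB
  have hll : ∀ ψ' l e, IsToken G C T s φ u v α ψ' → ψ' s(u, w) = i → Misses B (palette G ψ' w) l →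
      Misses B (palette G ψ' w') e → l ∈ B → e ∈ B → l ≠ α → l ≠ i → e ≠ α → e ≠ i → False := by
    intro ψ' l e ht' hi' hd he hl heB hlα hli heα hei
    obtain ⟨ψ'', ht'', hi'', hd'', he''⟩ := ht'.exists_flip h hα hl hlα.symm hww' hP hwu hwv hd he
      heB (Or.inr rfl) (by rwa [Equiv.swap_apply_right])
    rw [Equiv.swap_apply_right] at hd''
    have hi3 := (hi'' w hw).trans hi'
    rcases he'' with he'' | he''
    · exact hei (hend ψ'' e ht'' hi3 hd'' he'' heB)
    · have := hend ψ'' _ ht'' hi3 hd'' he'' (swap_mem hα hl heB)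
      rw [Equiv.swap_apply_eq_iff, Equiv.swap_apply_of_ne_of_ne hαi.symm hli.symm] at this
      exact hei this
  have hlα : ∀ ψ' l, IsToken G C T s φ u v α ψ' → ψ' s(u, w) = i → Misses B (palette G ψ' w) l →
      Misses B (palette G ψ' w') α → l ∈ B → l ≠ α → l ≠ i → False := by
    intro ψ' l ht' hi' hd he hl hlα hli
    obtain ⟨j, hj, hjn⟩ : ∃ j ∈ B, j ∉ ({α, i, l} : Finset ℕ) :=
      Finset.exists_mem_notMem_of_card_lt_card (by
        have := Finset.card_le_three (a := α) (b := i) (c := l)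
        omega)
    simp only [Finset.mem_insert, Finset.mem_singleton, not_or] at hjn
    obtain ⟨ψ'', ht'', hi'', he'', hd''⟩ := ht'.exists_flip h hα hj (Ne.symm hjn.1) hww'.symm
      hP.symm hw'u hw'v he hd hl (Or.inl rfl) (by
        rw [Equiv.swap_apply_left]
        exact Ne.symm hjn.2.2)
    rw [Equiv.swap_apply_of_ne_of_ne hlα (Ne.symm hjn.2.2), or_self] at hd''
    rw [Equiv.swap_apply_left] at he''
    exact hll ψ'' l j ht'' ((hi'' w hw).trans hi') hd'' he'' hl hj hlα hli hjn.1 hjn.2.1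
  have hli : ∀ ψ' l, IsToken G C T s φ u v α ψ' → ψ' s(u, w) = i → Misses B (palette G ψ' w) l →
      Misses B (palette G ψ' w') i → l ∈ B → l ≠ α → l ≠ i → False := by
    intro ψ' l ht' hi' hd he hl hlα' hli
    obtain ⟨ψ'', ht'', hi'', he'', hd''⟩ := ht'.exists_flip h hα hi hαi hww'.symm
      hP.symm hw'u hw'v he hd hl (Or.inr rfl) (by rwa [Equiv.swap_apply_right])
    rw [Equiv.swap_apply_of_ne_of_ne hlα' hli, or_self] at hd''
    rw [Equiv.swap_apply_right] at he''
    exact hlα ψ'' l ht'' ((hi'' w hw).trans hi') hd'' he'' hl hlα' hli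
  obtain ⟨d, hdB, hd⟩ := h.exists_misses ht.variant hww' hP
  obtain ⟨e, heB, he⟩ := h.exists_misses ht.variant hww'.symm hP.symm
  have hdi : d ≠ i := fun e => (hd i hi).1 (mem_palette_right hw) e.symm
  by_cases hdα : d = α
  · subst hdα
    obtain rfl : e = i := hend ψ e ht rfl hd he heB
    obtain ⟨l, hl, hln⟩ : ∃ l ∈ B, l ∉ ({d, i} : Finset ℕ) :=
      Finset.exists_mem_notMem_of_card_lt_card (by
        have := Finset.card_le_two (a := d) (b := i)
        omega)
    simp only [Finset.mem_insert, Finset.mem_singleton, not_or] at hln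
    obtain ⟨ψ'', ht'', hi'', hd'', he''⟩ := ht.exists_flip h hα hl (Ne.symm hln.1) hww' hP hwu hwv
      hd he heB (Or.inl rfl) (by
        rw [Equiv.swap_apply_left]
        exact Ne.symm hln.2)
    rw [Equiv.swap_apply_of_ne_of_ne hαi.symm (Ne.symm hln.2), or_self] at he''
    rw [Equiv.swap_apply_left] at hd''
    exact hli ψ'' l ht'' (hi'' w hw) hd'' he'' hl hln.1 hln.2
  · by_cases heα : e = α
    · subst heα
      exact hlα ψ d ht rfl hd he hdB hdα hdi
    by_cases hei : e = i
    · subst hei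
      exact hli ψ d ht rfl hd he hdB hdα hdi
    · exact hll ψ d e ht rfl hd he hdB heB hdα hdi heα hei

end IsToken

/-- One additional color suffices to separate all vertices of a nearly distinguishing coloring. -/
theorem IsNearVdec.exists_injective_palette (h : IsNearVdec G C T s φ) :
    ∃ ψ, ProperOn G (insert s C) ψ ∧ Function.Injective (palette G ψ) := by
  obtain ⟨t₁, t₂, t₃, h12, -, -, hTe⟩ := Finset.card_eq_three.1 h.card_eq
  obtain ⟨ψ, hψ, hmin⟩ := exists_forall_le_of_exists (IsVariant G C T s φ) (coincidences G)
    (exists_isVariant h.proper h.notMem h12 (by simp [hTe]) (by simp [hTe]) h.eq_or_eq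
      h.subset_palette)
  refine ⟨ψ, hψ.proper, fun u v huv => ?_⟩
  by_contra hne
  obtain ⟨hP, x, w, w', hx, hwu, hwv, hxw, hT, hww', hPw⟩ := hψ.active hne huv
  obtain ⟨α, hα, hmiss⟩ := h.exists_misses hψ hne hP
  have ht : IsToken G C T s φ u v α ψ := ⟨hψ, hmin, hne, huv, hmiss⟩
  rcases hx with rfl | rfl
  · exact ht.false_of_adj h hα hxw hT hwv hww' hPw
  · exact ht.symm.false_of_adj h hα hxw hT hwu hww' hPw

end VertexDistinguishing

namespace VertexDistinguishing

variable {V : Type*} {G : SimpleGraph V} {C : Finset ℕ} {φ : Sym2 V → ℕ}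

theorem colorSet_eq_palette [Fintype V] (v : V) : colorSet G φ v = palette G φ v := by
  ext c
  rw [Finset.mem_coe, mem_palette]
  constructor
  · rintro ⟨e, he, hv, rfl⟩
    obtain ⟨w, rfl⟩ := hv
    exact ⟨w, he, rfl⟩
  · rintro ⟨w, hw, rfl⟩
    exact ⟨s(v, w), hw, Sym2.mem_mk_left v w, rfl⟩

theorem ProperOn.isEdgeKColoring {k : ℕ} (h : ProperOn G (Finset.Icc 1 k) φ) :
    IsEdgeKColoring G k φ := by
  constructor
  · intro e
    induction e with | _ v w => exact fun he => h.mem he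
  · rintro e he f hf hef ⟨v, ⟨x, rfl⟩, ⟨y, rfl⟩⟩ hc
    exact hef (congrArg (s(v, ·)) (h.inj he hf hc))

theorem ProperOn.isVDEC [Fintype V] {k : ℕ} (h : ProperOn G (Finset.Icc 1 k) φ)
    (hinj : Function.Injective (palette G φ)) : IsVDEC G k φ := by
  refine ⟨h.isEdgeKColoring, fun u v huv he => huv (hinj ?_)⟩
  rwa [colorSet_eq_palette, colorSet_eq_palette, Finset.coe_inj] at he

variable [Fintype V]

theorem IsNearVdec.of_paletteCount {T : Finset ℕ} {s : ℕ} (hφ : ProperOn G C φ) (hs : s ∉ C)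
    (hT : T ⊆ C) (hT3 : T.card = 3)
    (h : ∀ Z, paletteCount G φ Z ≤ 2 ∧ (paletteCount G φ Z = 2 → T ⊆ Z)) :
    IsNearVdec G C T s φ where
  proper := hφ
  notMem := hs
  subset := hT
  card_eq := hT3
  eq_or_eq x y z hxy hxz := by
    classical
    by_contra! hne
    have h2 := (h (palette G φ x)).1
    rw [paletteCount, numOf_eq_card] at h2
    have : ({x, y, z} : Finset V) ⊆ Finset.univ.filter (palette G φ · = palette G φ x) := by
      intro w hw
      simp only [Finset.mem_insert, Finset.mem_singleton] at hw
      rcases hw with rfl | rfl | rfl <;> simp [← hxy, ← hxz]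
    have h3 := Finset.card_le_card this
    rw [Finset.card_eq_three.2 ⟨x, y, z, hne.1, hne.2.1, hne.2.2, rfl⟩] at h3
    omega
  subset_palette x y hne hxy := by
    classical
    refine (h (palette G φ x)).2 ((h (palette G φ x)).1.antisymm ?_)
    have : ({x, y} : Finset V) ⊆ Finset.univ.filter (palette G φ · = palette G φ x) := by
      intro w hw
      simp only [Finset.mem_insert, Finset.mem_singleton] at hw
      rcases hw with rfl | rfl <;> simp [← hxy]
    rw [paletteCount, numOf_eq_card, ← Finset.card_pair hne]
    exact Finset.card_le_card this

theorem le_choose_add_succ (m d : ℕ) : m ≤ (m + d).choose (d + 1) := by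
  induction d with
  | zero => simp
  | succ d ih =>
    rw [← add_assoc, Nat.choose_succ_succ]
    exact ih.trans (Nat.le_add_right _ _)

theorem degree_le_of_card_degree_le [DecidableRel G.Adj] {k : ℕ}
    (h : ∀ d, (numOf fun v => G.degree v = d) ≤ k.choose d) (z : V) : G.degree z ≤ k := by
  by_contra! hlt
  have h1 := h (G.degree z)
  rw [Nat.choose_eq_zero_of_lt hlt, Nat.le_zero, numOf_eq_zero] at h1
  exact h1 z rfl

theorem card_degree_le_choose_paramK [DecidableRel G.Adj] (hδ : 0 < G.minDegree) (d : ℕ) :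
    (numOf fun v => G.degree v = d) ≤ (paramK G).choose d := by
  rw [numOf_eq_card]
  by_cases hd : G.minDegree ≤ d ∧ d ≤ G.maxDegree
  · refine Nat.sInf_mem (s := {k | ∀ d : ℕ, G.minDegree ≤ d → d ≤ G.maxDegree →
      (Finset.univ.filter (fun v => G.degree v = d)).card ≤ k.choose d})
      ⟨Fintype.card V + G.maxDegree, fun d hd hd' => ?_⟩ d hd.1 hd.2
    refine (Finset.card_le_univ _).trans ?_
    obtain ⟨d, rfl⟩ := Nat.exists_eq_add_of_lt (hδ.trans_le hd)
    rw [zero_add] at hd' ⊢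
    exact (le_choose_add_succ _ d).trans (Nat.choose_le_choose _ (by omega))
  · rw [Finset.card_eq_zero.2]
    · exact Nat.zero_le _
    · refine Finset.filter_eq_empty_iff.2 fun v _ hv => hd ?_
      exact hv ▸ ⟨G.minDegree_le_degree v, G.degree_le_maxDegree v⟩

theorem exists_properOn_of_card_degree_le [DecidableRel G.Adj] [Nonempty V]
    (h : ∀ d, (numOf fun v => G.degree v = d) ≤ C.card.choose d) : ∃ φ, ProperOn G C φ := by
  obtain ⟨z, hz⟩ := G.exists_maximal_degree_vertex
  have hzC := degree_le_of_card_degree_le h z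
  refine exists_properOn G C z hzC fun v hv => ?_
  have hvz : G.degree v ≤ G.degree z := hz ▸ G.degree_le_maxDegree v
  by_contra! hlt
  have e : C.card = G.degree z := by omega
  have h1 := h (G.degree z)
  rw [e, Nat.choose_self, numOf_eq_card, Finset.card_le_one] at h1
  exact hv (h1 v (by simp; omega) z (by simp))

end VertexDistinguishing

open VertexDistinguishing in
/-- For a vdec graph `G` on `n` vertices with `Δ(G) ≥ √(2n) + 4` and `δ(G) ≥ 5`,
`χ'_vd(G) ≤ k(G) + 1`. -/
theorem vdIndex_le_paramK_add_one {V : Type*} [Fintype V] (G : SimpleGraph V) [DecidableRel G.Adj]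
    (h : IsVdecGraph G)
    (hΔ : Real.sqrt (2 * Fintype.card V) + 4 ≤ (G.maxDegree : ℝ))
    (hδ : 5 ≤ G.minDegree) :
    vdIndex G ≤ paramK G + 1 := by
  have hV : Nonempty V := by
    by_contra hV
    rw [not_nonempty_iff] at hV
    simp at hδ
  have hd := card_degree_le_choose_paramK (G := G) (by omega)
  set k := paramK G
  have hkC : (Finset.Icc 1 k).card = k := by simp
  obtain ⟨z, hz⟩ := G.exists_maximal_degree_vertex
  have hΔk : G.maxDegree ≤ k := hz ▸ degree_le_of_card_degree_le hd z
  have hδΔ : G.minDegree ≤ G.maxDegree := G.minDegree_le_maxDegree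
  have hn : 2 * Fintype.card V ≤ (k - 4) ^ 2 := by
    have h1 : Real.sqrt (2 * Fintype.card V) ≤ ((k - 4 : ℕ) : ℝ) := by
      have h2 : (G.maxDegree : ℝ) ≤ k := by exact_mod_cast hΔk
      rw [Nat.cast_sub (by omega)]
      push_cast
      linarith
    rw [Real.sqrt_le_left (by positivity)] at h1
    exact_mod_cast h1
  have hT : ({1, 2, 3} : Finset ℕ) ⊆ Finset.Icc 1 k := by
    intro c hc
    simp only [Finset.mem_insert, Finset.mem_singleton] at hc
    rw [Finset.mem_Icc]
    omega
  have hs : k + 1 ∉ Finset.Icc 1 k := by simp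
  rw [← hkC] at hn
  have hd' : ∀ d, (numOf fun v => G.degree v = d) ≤ (Finset.Icc 1 k).card.choose d := by
    rwa [hkC]
  obtain ⟨φ, hφ, hcount⟩ := exists_properOn_paletteCount_le_two
    (fun v => hδ.trans (G.minDegree_le_degree v)) hd' hn
    (exists_properOn_of_card_degree_le hd') hT (by simp)
  obtain ⟨ψ, hψ, hinj⟩ :=
    (IsNearVdec.of_paletteCount hφ hs hT (by simp) hcount).exists_injective_palette
  rw [Finset.insert_Icc_right_eq_Icc_add_one (by omega)] at hψ
  exact Nat.sInf_le ⟨ψ, hψ.isVDEC hinj⟩
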